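/- There exists a dense subset M' of ℝ consisting of irrational numbers such that for every μ ∈ M' and every θ ∈ ℝ, the Hausdorff dimension of σ(H_{μ,θ}), viewed as a subset of ℝ, is strictly positive. -/

import Mathlib

open Real MeasureTheory

namespace CritAM

open scoped Matrix ComplexOrder

section Compound

variable {n : Type*} [Fintype n] {i : ℕ}

/-- Andréief's identity. -/
lemma sum_conj_det_mul_det (Y Z : Matrix n (Fin i) ℂ) :
    ∑ a : Fin i → n, star (Y.submatrix a id).det * (Z.submatrix a id).det
      = (i.factorial : ℂ) * (Yᴴ * Z).det := by
  have h1 : (Yᴴ * Z).det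
      = ∑ a : Fin i → n, (∏ s, star (Y (a s) s)) * (Z.submatrix a id).det := by
    have : (Yᴴ * Z) = fun s => ∑ m, star (Y m s) • Z m := by
      ext s t
      simp [Matrix.mul_apply, Finset.sum_apply]
    rw [this]
    have h := (Matrix.detRowAlternating (R := ℂ) (n := Fin i)).toMultilinearMap.map_sum
      (fun s m => star (Y m s) • Z m)
    refine h.trans (Finset.sum_congr rfl fun a _ => ?_)
    exact (Matrix.detRowAlternating (R := ℂ) (n := Fin i)).toMultilinearMap.map_smul_univ
      (fun s => star (Y (a s) s)) (fun s => Z (a s))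
  have h2 : ∀ σ : Equiv.Perm (Fin i), (Yᴴ * Z).det
      = ∑ a : Fin i → n, (∏ s, star (Y (a (σ s)) s)) *
        (((Equiv.Perm.sign σ : ℤ) : ℂ) * (Z.submatrix a id).det) := by
    intro σ
    rw [h1, ← Equiv.sum_comp (Equiv.arrowCongr σ.symm (Equiv.refl n))]
    refine Finset.sum_congr rfl fun a _ => ?_
    have := Matrix.det_permute σ (Z.submatrix a id)
    rw [← this]
    rfl
  have h3 : (i.factorial : ℂ) * (Yᴴ * Z).det = ∑ _σ : Equiv.Perm (Fin i), (Yᴴ * Z).det := by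
    simp [Fintype.card_perm]
  rw [h3, Finset.sum_congr rfl fun σ _ => h2 σ, Finset.sum_comm]
  refine Finset.sum_congr rfl fun a _ => ?_
  rw [Matrix.det_apply, star_sum, Finset.sum_mul]
  refine Finset.sum_congr rfl fun σ _ => ?_
  have : star (Equiv.Perm.sign σ • ∏ s, (Y.submatrix a id) (σ s) s)
      = ((Equiv.Perm.sign σ : ℤ) : ℂ) * ∏ s, star (Y (a (σ s)) s) := by
    rw [Units.smul_def, zsmul_eq_mul, star_mul', star_prod]
    simp
  rw [this]
  ring

/-- The vector of all `i × i` minors, with repetitions, normalised. -/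
noncomputable def minors (Y : Matrix n (Fin i) ℂ) : EuclideanSpace ℂ (Fin i → n) :=
  WithLp.toLp 2 fun a => ((√(i.factorial : ℝ))⁻¹ : ℂ) * (Y.submatrix a id).det

lemma inner_minors (Y Z : Matrix n (Fin i) ℂ) :
    inner ℂ (minors Y) (minors Z) = (Yᴴ * Z).det := by
  have h := sum_conj_det_mul_det Y Z
  have hf : ((√(i.factorial : ℝ) : ℝ) : ℂ) * ((√(i.factorial : ℝ) : ℝ) : ℂ) = i.factorial := by
    rw [← Complex.ofReal_mul, Real.mul_self_sqrt (by positivity)]; simp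
  have hf0 : (i.factorial : ℂ) ≠ 0 := by exact_mod_cast i.factorial_ne_zero
  have hs0 : ((√(i.factorial : ℝ) : ℝ) : ℂ) ≠ 0 := by
    intro h0; rw [h0] at hf; simp at hf; exact hf0 hf.symm
  have : (Yᴴ * Z).det = (i.factorial : ℂ)⁻¹ *
      ∑ a : Fin i → n, star (Y.submatrix a id).det * (Z.submatrix a id).det := by
    rw [h]; field_simp
  rw [this, PiLp.inner_apply, Finset.mul_sum]
  refine Finset.sum_congr rfl fun a _ => ?_
  simp only [minors, RCLike.inner_apply, map_mul, map_inv₀, Complex.conj_ofReal]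
  rw [← hf]
  field_simp
  rfl

lemma norm_minors_of_isometry {Y : Matrix n (Fin i) ℂ} (hY : Yᴴ * Y = 1) : ‖minors Y‖ = 1 := by
  have h := inner_minors Y Y
  rw [hY, Matrix.det_one, inner_self_eq_norm_sq_to_K] at h
  have h' : ((‖minors Y‖ : ℝ) : ℂ) ^ 2 = 1 := h
  have : ‖minors Y‖ ^ 2 = 1 := by exact_mod_cast h'
  nlinarith [norm_nonneg (minors Y)]

lemma norm_det_le_one_of_isometry {Y Z : Matrix n (Fin i) ℂ} (hY : Yᴴ * Y = 1)
    (hZ : Zᴴ * Z = 1) : ‖(Yᴴ * Z).det‖ ≤ 1 := by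
  rw [← inner_minors]
  refine (norm_inner_le_norm _ _).trans ?_
  rw [norm_minors_of_isometry hY, norm_minors_of_isometry hZ]; norm_num

lemma norm_inner_sub_inner_mul_inner_le {E : Type*} [NormedAddCommGroup E]
    [InnerProductSpace ℂ E] {ψ u v : E} (hψ : ‖ψ‖ = 1) (hu : ‖u‖ = 1) (hv : ‖v‖ = 1) {δ : ℝ}
    (h1 : 1 - δ ≤ ‖inner ℂ u ψ‖) (h2 : 1 - δ ≤ ‖inner ℂ ψ v‖) (hδ : δ ≤ 1) :
    ‖inner ℂ u v - inner ℂ u ψ * inner ℂ ψ v‖ ≤ 2 * δ := by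
  set α := u - inner ℂ ψ u • ψ
  set β := v - inner ℂ ψ v • ψ
  have hψψ : inner ℂ ψ ψ = (1 : ℂ) := by rw [inner_self_eq_norm_sq_to_K, hψ]; simp
  have key : ∀ x : E, ‖x‖ = 1 → 1 - δ ≤ ‖inner ℂ ψ x‖ →
      ‖x - inner ℂ ψ x • ψ‖ ^ 2 ≤ 2 * δ := by
    intro x hx h
    have ho : inner ℂ (inner ℂ ψ x • ψ) (x - inner ℂ ψ x • ψ) = (0 : ℂ) := by
      rw [inner_smul_left, inner_sub_right, inner_smul_right, hψψ]; simp
    have hp := norm_add_sq_eq_norm_sq_add_norm_sq_of_inner_eq_zero _ _ ho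
    rw [add_sub_cancel, hx, norm_smul, hψ] at hp
    nlinarith
  have hα := key u hu (by rwa [norm_inner_symm])
  have hβ := key v hv h2
  have e : inner ℂ u v - inner ℂ u ψ * inner ℂ ψ v = inner ℂ α β := by
    simp only [α, β, inner_sub_left, inner_sub_right, inner_smul_left, inner_smul_right, hψψ,
      inner_conj_symm]
    ring
  rw [e]
  refine (norm_inner_le_norm _ _).trans ?_
  nlinarith [sq_nonneg (‖α‖ - ‖β‖)]

lemma norm_pow_sub_one_le [DecidableEq n] {X : Matrix n (Fin i) ℂ} {A B : Matrix n n ℂ}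
    (hX : Xᴴ * X = 1)
    (hA : Aᴴ * A = 1) (hB : Bᴴ * B = 1) {w : ℂ} (hAB : A * B = w • (B * A)) {δ : ℝ}
    (hδ : δ ≤ 1 / 8) (h1 : 1 - δ ≤ ‖(Xᴴ * A * X).det‖) (h2 : 1 - δ ≤ ‖(Xᴴ * B * X).det‖) :
    ‖w ^ i - 1‖ ≤ 8 * δ := by
  have hA' : A * Aᴴ = 1 := mul_eq_one_comm.1 hA
  have hB' : B * Bᴴ = 1 := mul_eq_one_comm.1 hB
  have iso : ∀ {C : Matrix n n ℂ}, Cᴴ * C = 1 → (C * X)ᴴ * (C * X) = 1 := by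
    intro C hC
    rw [Matrix.conjTranspose_mul, Matrix.mul_assoc, ← Matrix.mul_assoc Cᴴ, hC, Matrix.one_mul, hX]
  have step : ∀ {C D : Matrix n n ℂ}, C * Cᴴ = 1 → Dᴴ * D = 1 →
      1 - δ ≤ ‖(Xᴴ * C * X).det‖ → 1 - δ ≤ ‖(Xᴴ * D * X).det‖ →
      ‖(Xᴴ * (C * D) * X).det - (Xᴴ * C * X).det * (Xᴴ * D * X).det‖ ≤ 2 * δ := by
    intro C D hC hD h1 h2
    have hC' : Cᴴᴴ * Cᴴ = 1 := by rwa [Matrix.conjTranspose_conjTranspose]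
    have e1 : inner ℂ (minors (Cᴴ * X)) (minors X) = (Xᴴ * C * X).det := by
      rw [inner_minors, Matrix.conjTranspose_mul, Matrix.conjTranspose_conjTranspose]
    have e2 : inner ℂ (minors X) (minors (D * X)) = (Xᴴ * D * X).det := by
      rw [inner_minors, Matrix.mul_assoc]
    have e3 : inner ℂ (minors (Cᴴ * X)) (minors (D * X)) = (Xᴴ * (C * D) * X).det := by
      rw [inner_minors, Matrix.conjTranspose_mul, Matrix.conjTranspose_conjTranspose]
      simp only [Matrix.mul_assoc]
    have := norm_inner_sub_inner_mul_inner_le (norm_minors_of_isometry hX)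
      (norm_minors_of_isometry (iso hC')) (norm_minors_of_isometry (iso hD))
      (δ := δ) (by rwa [e1]) (by rwa [e2]) (by linarith)
    rwa [e1, e2, e3] at this
  have s1 := step hA' hB h1 h2
  have s2 := step hB' hA h2 h1
  set a := (Xᴴ * A * X).det
  set b := (Xᴴ * B * X).det
  set d := (Xᴴ * (B * A) * X).det
  have hd : (Xᴴ * (A * B) * X).det = w ^ i * d := by
    rw [hAB, Matrix.mul_smul, Matrix.smul_mul, Matrix.det_smul]; simp [d]
  rw [hd] at s1
  have h3 : ‖(w ^ i - 1) * d‖ ≤ 4 * δ := by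
    have : (w ^ i - 1) * d = (w ^ i * d - a * b) - (d - b * a) := by ring
    rw [this]
    exact (norm_sub_le _ _).trans (by linarith)
  have hδ0 : 0 ≤ δ := by have := norm_nonneg (d - b * a); linarith
  have hba : (1 - δ) * (1 - δ) ≤ ‖b * a‖ := by
    rw [norm_mul]; exact mul_le_mul h2 h1 (by linarith) (norm_nonneg _)
  have hd2 : 1 / 2 ≤ ‖d‖ := by
    have := norm_sub_norm_le (b * a) d
    rw [norm_sub_rev] at this
    nlinarith
  rw [norm_mul] at h3
  nlinarith [norm_nonneg (w ^ i - 1)]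

end Compound

end CritAM

namespace CritAM

section Schwarz

lemma norm_sub_one_le_of_bounded {f : ℂ → ℂ} {c z : ℂ} {R m : ℝ} (hR : 0 < R)
    (hd : DifferentiableOn ℂ f (Metric.ball c R)) (hm : 1 < m)
    (hb : ∀ w ∈ Metric.ball c R, ‖f w‖ ≤ m) (hc : f c = 1) (hz : dist z c ≤ R / 4) :
    ‖f z - 1‖ ≤ (m ^ 2 - 1) / 3 := by
  have hzR : z ∈ Metric.ball c R := by rw [Metric.mem_ball]; linarith
  have hne : ∀ w ∈ Metric.ball c R, (m : ℂ) ^ 2 - f w ≠ 0 := by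
    intro w hw h
    have h1 : f w = ((m ^ 2 : ℝ) : ℂ) := by push_cast; linear_combination -h
    have := hb w hw
    rw [h1, Complex.norm_real, Real.norm_of_nonneg (by positivity)] at this
    nlinarith
  set g : ℂ → ℂ := fun w => (f w - 1) * m / ((m : ℂ) ^ 2 - f w)
  have hgd : DifferentiableOn ℂ g (Metric.ball c R) :=
    ((hd.sub_const 1).mul_const _).div ((differentiableOn_const _).sub hd) hne
  have hg0 : g c = 0 := by simp [g, hc]
  have hgm : Set.MapsTo g (Metric.ball c R) (Metric.closedBall (g c) 1) := by
    intro w hw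
    rw [hg0, mem_closedBall_zero_iff]
    simp only [g]
    rw [norm_div, div_le_one (norm_pos_iff.2 (hne w hw)), norm_mul,
      ← sq_le_sq₀ (by positivity) (by positivity), mul_pow]
    have hfw := hb w hw
    have e1 : ‖f w‖ ^ 2 = (f w).re ^ 2 + (f w).im ^ 2 := by
      rw [Complex.sq_norm, Complex.normSq_apply]; ring
    have e2 : ‖f w - 1‖ ^ 2 = ((f w).re - 1) ^ 2 + (f w).im ^ 2 := by
      rw [Complex.sq_norm, Complex.normSq_apply]; simp; ring
    have e3 : ‖(m : ℂ) ^ 2 - f w‖ ^ 2 = (m ^ 2 - (f w).re) ^ 2 + (f w).im ^ 2 := by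
      rw [Complex.sq_norm, Complex.normSq_apply, ← Complex.ofReal_pow]
      simp only [Complex.sub_re, Complex.sub_im, Complex.ofReal_re, Complex.ofReal_im]; ring
    rw [e2, e3, Complex.norm_real, Real.norm_eq_abs, sq_abs]
    have : ‖f w‖ ^ 2 ≤ m ^ 2 := by gcongr
    nlinarith [mul_nonneg (show 0 ≤ m ^ 2 - 1 by nlinarith) (sub_nonneg.2 this)]
  have hs := Complex.dist_le_div_mul_dist_of_mapsTo_ball hgd hgm hzR
  rw [hg0, dist_zero_right] at hs
  have hs' : ‖g z‖ ≤ 1 / 4 := by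
    refine hs.trans ?_
    rw [div_mul_eq_mul_div, div_le_iff₀ hR]; linarith
  have e : (f z - 1) * (m + g z) = g z * (m ^ 2 - 1) := by
    have h1 : g z * ((m : ℂ) ^ 2 - f z) = (f z - 1) * m := by
      simp only [g]; field_simp [hne z hzR]
    linear_combination -h1
  have h2 := congrArg norm e
  rw [norm_mul, norm_mul] at h2
  have h3 : 3 / 4 ≤ ‖(m : ℂ) + g z‖ := by
    have := norm_sub_norm_le (m : ℂ) (-g z)
    rw [sub_neg_eq_add, norm_neg, Complex.norm_real, Real.norm_of_nonneg (by linarith)] at this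
    linarith
  have h4 : ‖(m : ℂ) ^ 2 - 1‖ = m ^ 2 - 1 := by
    rw [← Complex.ofReal_pow, ← Complex.ofReal_one, ← Complex.ofReal_sub, Complex.norm_real,
      Real.norm_of_nonneg (by nlinarith)]
  rw [h4] at h2
  have h5 : ‖g z‖ * (m ^ 2 - 1) ≤ 1 / 4 * (m ^ 2 - 1) := by
    gcongr; nlinarith
  nlinarith [norm_nonneg (f z - 1)]

lemma le_norm_of_isMaxOn_penalized {f : ℂ → ℂ} {c : ℂ} {R ε s : ℝ} (hR : 0 < R) (hε : 0 < ε)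
    (hd : DifferentiableOn ℂ f (Metric.ball c R)) (hc : f c ≠ 0)
    (hb : ∀ w ∈ Metric.ball c R,
      ‖f w‖ * exp (-ε * w.im ^ 2) ≤ ‖f c‖ * exp (-ε * c.im ^ 2)) (hs : |s| ≤ R / 4) :
    (1 - (exp (2 * ε * R ^ 2) - 1) / 3) * ‖f c‖ ≤ ‖f (c + s)‖ := by
  set g : ℂ → ℂ := fun w => f w / f c * Complex.exp (2 * Complex.I * ε * c.im * (w - c))
  have hexp : ∀ w : ℂ, ‖Complex.exp (2 * Complex.I * ε * c.im * (w - c))‖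
      = exp (-2 * ε * c.im * (w.im - c.im)) := by
    intro w
    rw [Complex.norm_exp]
    congr 1
    simp [Complex.mul_re, Complex.mul_im]
  have hgd : DifferentiableOn ℂ g (Metric.ball c R) :=
    (hd.div_const _).mul (by fun_prop)
  have hgc : g c = 1 := by simp [g, hc]
  have hfc : 0 < ‖f c‖ := norm_pos_iff.2 hc
  have hgb : ∀ w ∈ Metric.ball c R, ‖g w‖ ≤ exp (ε * R ^ 2) := by
    intro w hw
    simp only [g]
    rw [norm_mul, norm_div, hexp]
    have h1 := hb w hw
    have h2 : ‖f w‖ ≤ ‖f c‖ * exp (ε * w.im ^ 2 - ε * c.im ^ 2) := by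
      have : exp (ε * w.im ^ 2 - ε * c.im ^ 2) = exp (-ε * c.im ^ 2) * exp (ε * w.im ^ 2) := by
        rw [← Real.exp_add]; ring_nf
      rw [this, ← mul_assoc]
      refine le_trans ?_ (mul_le_mul_of_nonneg_right h1 (exp_pos _).le)
      rw [mul_assoc, ← Real.exp_add]; simp
    have h3 : ‖f w‖ / ‖f c‖ ≤ exp (ε * w.im ^ 2 - ε * c.im ^ 2) := by
      rw [div_le_iff₀ hfc]; linarith
    refine (mul_le_mul_of_nonneg_right h3 (exp_pos _).le).trans ?_
    rw [← Real.exp_add, Real.exp_le_exp]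
    have h4 : |w.im - c.im| ≤ R := by
      rw [← Complex.sub_im]
      exact (Complex.abs_im_le_norm _).trans (by rw [← dist_eq_norm]; exact hw.le)
    have h5 : (w.im - c.im) ^ 2 ≤ R ^ 2 := sq_le_sq' (by linarith [neg_abs_le (w.im - c.im)])
      (by linarith [le_abs_self (w.im - c.im)])
    nlinarith
  have hz : dist (c + s) c ≤ R / 4 := by simpa [dist_eq_norm] using hs
  have hm : 1 < exp (ε * R ^ 2) := Real.one_lt_exp_iff.2 (by positivity)
  have key := norm_sub_one_le_of_bounded hR hgd hm hgb hgc hz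
  rw [← Real.exp_nat_mul] at key
  have hn : ‖g (c + s)‖ = ‖f (c + s)‖ / ‖f c‖ := by
    simp only [g]
    rw [norm_mul, norm_div, hexp]; simp
  have h6 := norm_sub_norm_le 1 (g (c + s))
  rw [norm_sub_rev, norm_one, hn] at h6
  rw [← le_div_iff₀ hfc]
  have : ((2 : ℕ) : ℝ) * (ε * R ^ 2) = 2 * ε * R ^ 2 := by push_cast; ring
  rw [this] at key
  linarith

end Schwarz

end CritAM

namespace CritAM

open scoped Matrix ComplexOrder

section MaxMinor

variable {n : Type*} [Fintype n] {i : ℕ}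

lemma exists_isometry_mul {Z : Matrix n (Fin i) ℂ} (hZ : (Zᴴ * Z).det ≠ 0) :
    ∃ (X : Matrix n (Fin i) ℂ) (T : Matrix (Fin i) (Fin i) ℂ), Xᴴ * X = 1 ∧ Z = X * T := by
  open scoped MatrixOrder Matrix.Norms.L2Operator in
  have h0 : (0 : Matrix (Fin i) (Fin i) ℂ) ≤ Zᴴ * Z :=
    (Matrix.posSemidef_conjTranspose_mul_self Z).nonneg
  set T : Matrix (Fin i) (Fin i) ℂ := CFC.sqrt (Zᴴ * Z)
  have hT : T * T = Zᴴ * Z := CFC.sqrt_mul_sqrt_self _ h0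
  have hTs : Tᴴ = T := (CFC.sqrt_nonneg (Zᴴ * Z)).isSelfAdjoint
  have hd : IsUnit T.det := by
    rw [isUnit_iff_ne_zero]
    intro h
    rw [← hT, Matrix.det_mul, h] at hZ
    simp at hZ
  refine ⟨Z * T⁻¹, T, ?_, ?_⟩
  · rw [Matrix.conjTranspose_mul, Matrix.conjTranspose_nonsing_inv, hTs, Matrix.mul_assoc,
      ← Matrix.mul_assoc Zᴴ, ← hT, Matrix.mul_assoc, Matrix.mul_nonsing_inv _ hd, Matrix.mul_one,
      Matrix.nonsing_inv_mul _ hd]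
  · rw [Matrix.mul_assoc, Matrix.nonsing_inv_mul _ hd, Matrix.mul_one]

lemma eq_mul_inv_mul_of_bordered [DecidableEq n] {P : Matrix n n ℂ} {U V : Matrix n (Fin i) ℂ}
    (hrank : ∀ U' V' : Matrix n (Fin i ⊕ Unit) ℂ, (U'ᴴ * P * V').det = 0)
    (hM : (Uᴴ * P * V).det ≠ 0) :
    P = (P * V) * (Uᴴ * P * V)⁻¹ * (Uᴴ * P) := by
  ext a b
  set Ua : Matrix n Unit ℂ := Matrix.of fun m _ => if m = a then 1 else 0
  set Vb : Matrix n Unit ℂ := Matrix.of fun m _ => if m = b then 1 else 0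
  have h := hrank (Matrix.fromCols U Ua) (Matrix.fromCols V Vb)
  have e : (Matrix.fromCols U Ua)ᴴ * P * Matrix.fromCols V Vb
      = Matrix.fromBlocks (Uᴴ * P * V) (Uᴴ * P * Vb) (Uaᴴ * P * V) (Uaᴴ * P * Vb) := by
    rw [Matrix.conjTranspose_fromCols_eq_fromRows_conjTranspose, Matrix.fromRows_mul,
      Matrix.fromRows_mul_fromCols]
  let _ := Matrix.invertibleOfIsUnitDet _ (isUnit_iff_ne_zero.2 hM)
  rw [e, Matrix.det_fromBlocks₁₁, mul_eq_zero, or_iff_right hM, Matrix.det_unique,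
    Matrix.sub_apply, sub_eq_zero, Matrix.invOf_eq_nonsing_inv] at h
  have hQ : ∀ Q : Matrix n n ℂ, (Uaᴴ * Q * Vb) default default = Q a b := by
    intro Q
    simp [Matrix.mul_apply, Ua, Vb, Matrix.conjTranspose_apply]
  have h2 : Uaᴴ * P * V * (Uᴴ * P * V)⁻¹ * (Uᴴ * P * Vb)
      = Uaᴴ * ((P * V) * (Uᴴ * P * V)⁻¹ * (Uᴴ * P)) * Vb := by
    simp only [Matrix.mul_assoc]
  rw [hQ, h2, hQ] at h
  exact h

lemma exists_isometry_det_le [DecidableEq n] {P : Matrix n n ℂ} {U V : Matrix n (Fin i) ℂ}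
    (hU : Uᴴ * U = 1)
    (hV : Vᴴ * V = 1)
    (hrank : ∀ U' V' : Matrix n (Fin i ⊕ Unit) ℂ, (U'ᴴ * P * V').det = 0)
    (hM : (Uᴴ * P * V).det ≠ 0)
    (hmax : ∀ U' V' : Matrix n (Fin i) ℂ, U'ᴴ * U' = 1 → V'ᴴ * V' = 1 →
      ‖(U'ᴴ * P * V').det‖ ≤ ‖(Uᴴ * P * V).det‖) :
    ∃ X : Matrix n (Fin i) ℂ, Xᴴ * X = 1 ∧ ∀ C : Matrix n n ℂ, Cᴴ * C = 1 →
      ‖(Uᴴ * (C * P * Cᴴ) * V).det‖ ≤ ‖(Uᴴ * P * V).det‖ * ‖(Xᴴ * C * X).det‖ := by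
  have hm : 0 < ‖(Uᴴ * P * V).det‖ := norm_pos_iff.2 hM
  have hZ : ((P * V)ᴴ * (P * V)).det ≠ 0 := by
    intro h
    rw [← inner_minors, inner_self_eq_zero] at h
    apply hM
    rw [Matrix.mul_assoc, ← inner_minors, h, inner_zero_right]
  obtain ⟨X, T, hX, hXT⟩ := exists_isometry_mul hZ
  have hT : ‖T.det‖ ≤ ‖(Uᴴ * P * V).det‖ := by
    have := hmax X V hX hV
    rwa [Matrix.mul_assoc, hXT, ← Matrix.mul_assoc, hX, Matrix.one_mul] at this
  have hUX : ‖(Uᴴ * P * V).det‖ = ‖(Uᴴ * X).det‖ * ‖T.det‖ := by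
    rw [Matrix.mul_assoc, hXT, ← Matrix.mul_assoc, Matrix.det_mul, norm_mul]
  have hUX1 : ‖(Uᴴ * X).det‖ = 1 := by
    refine le_antisymm (norm_det_le_one_of_isometry hU hX) ?_
    by_contra hlt
    push Not at hlt
    have : 0 < ‖T.det‖ := by
      rcases (norm_nonneg T.det).eq_or_lt with h | h
      · rw [← h] at hUX; simp at hUX; exact absurd hUX hM
      · exact h
    nlinarith
  refine ⟨X, hX, fun C hC => ?_⟩
  have hCX : ‖(Uᴴ * (C * X)).det‖ = ‖(Xᴴ * C * X).det‖ := by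
    have h1 : ‖inner ℂ (minors X) (minors U)‖ = ‖minors X‖ * ‖minors U‖ := by
      rw [norm_inner_symm, inner_minors, hUX1, norm_minors_of_isometry hX,
        norm_minors_of_isometry hU, one_mul]
    have hX0 : minors X ≠ 0 := by
      intro h; have := norm_minors_of_isometry hX; rw [h] at this; simp at this
    rw [norm_inner_eq_norm_iff hX0 (by
      intro h; have := norm_minors_of_isometry hU; rw [h] at this; simp at this)] at h1
    obtain ⟨r, -, hr⟩ := h1
    have hr1 : ‖r‖ = 1 := by
      have := congrArg norm hr
      rwa [norm_smul, norm_minors_of_isometry hX, norm_minors_of_isometry hU, mul_one,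
        eq_comm] at this
    rw [← inner_minors, hr, inner_smul_left, inner_minors, norm_mul, RCLike.norm_conj, hr1,
      one_mul, Matrix.mul_assoc]
  have hC' : Cᴴᴴ * Cᴴ = 1 := by
    rw [Matrix.conjTranspose_conjTranspose]; exact mul_eq_one_comm.1 hC
  have hY : ‖(Uᴴ * P * (Cᴴ * V)).det‖ ≤ ‖(Uᴴ * P * V).det‖ := by
    refine hmax U (Cᴴ * V) hU ?_
    rw [Matrix.conjTranspose_mul, Matrix.mul_assoc, ← Matrix.mul_assoc Cᴴᴴ, hC', Matrix.one_mul,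
      hV]
  have hfac : Uᴴ * (C * P * Cᴴ) * V
      = (Uᴴ * (C * X)) * T * (Uᴴ * P * V)⁻¹ * (Uᴴ * P * (Cᴴ * V)) := by
    conv_lhs => rw [eq_mul_inv_mul_of_bordered hrank hM, hXT]
    simp only [Matrix.mul_assoc]
  rw [hfac, Matrix.det_mul, Matrix.det_mul, Matrix.det_mul, Matrix.det_nonsing_inv,
    Ring.inverse_eq_inv', norm_mul, norm_mul, norm_mul, norm_inv, hCX]
  set m := ‖(Uᴴ * P * V).det‖
  calc ‖(Xᴴ * C * X).det‖ * ‖T.det‖ * m⁻¹ * ‖(Uᴴ * P * (Cᴴ * V)).det‖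
      ≤ ‖(Xᴴ * C * X).det‖ * m * m⁻¹ * m := by gcongr
    _ = m * ‖(Xᴴ * C * X).det‖ := by field_simp

end MaxMinor

end CritAM

namespace CritAM

open scoped Matrix ComplexOrder

section Penalized

open scoped Matrix.Norms.L2Operator

variable {n : Type*} [Fintype n] {i : ℕ}

lemma norm_multiset_prod_le_pow {s : Multiset ℂ} {c : ℝ} (hc : 0 ≤ c) (h : ∀ x ∈ s, ‖x‖ ≤ c) :
    ‖s.prod‖ ≤ c ^ Multiset.card s := by
  induction s using Multiset.induction_on with
  | empty => simp
  | cons a s ih =>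
    rw [Multiset.prod_cons, norm_mul, Multiset.card_cons, pow_succ']
    exact mul_le_mul (h a (Multiset.mem_cons_self a s))
      (ih fun x hx => h x (Multiset.mem_cons_of_mem hx)) (norm_nonneg _) hc

lemma norm_det_le_norm_pow (M : Matrix (Fin i) (Fin i) ℂ) : ‖M.det‖ ≤ ‖M‖ ^ i := by
  rcases i.eq_zero_or_pos with rfl | hi
  · simp
  have _ : Nonempty (Fin i) := ⟨⟨0, hi⟩⟩
  have hcard : Multiset.card M.charpoly.roots = i := by
    rw [Polynomial.splits_iff_card_roots.1 (IsAlgClosed.splits M.charpoly),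
      Matrix.charpoly_natDegree_eq_dim, Fintype.card_fin]
  rw [Matrix.det_eq_prod_roots_charpoly]
  refine (norm_multiset_prod_le_pow (norm_nonneg M) fun x hx => ?_).trans_eq (by rw [hcard])
  refine spectrum.norm_le_norm_of_mem ?_
  rw [Matrix.mem_spectrum_iff_isRoot_charpoly]
  exact (Polynomial.mem_roots'.1 hx).2

lemma norm_le_one_of_isometry {m : Type*} [Fintype m] [DecidableEq m] {U : Matrix n m ℂ}
    (hU : Uᴴ * U = 1) : ‖U‖ ≤ 1 := by
  have h := Matrix.l2_opNorm_conjTranspose_mul_self U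
  rw [hU] at h
  have h1 : ‖(1 : Matrix m m ℂ)‖ ≤ 1 := by
    rw [← Matrix.diagonal_one, Matrix.l2_opNorm_diagonal]
    exact (pi_norm_le_iff_of_nonneg zero_le_one).2 (by simp)
  nlinarith [norm_nonneg U]

lemma norm_det_compression_le [DecidableEq n] {U V : Matrix n (Fin i) ℂ} (hU : Uᴴ * U = 1)
    (hV : Vᴴ * V = 1)
    (P : Matrix n n ℂ) : ‖(Uᴴ * P * V).det‖ ≤ ‖P‖ ^ i := by
  refine (norm_det_le_norm_pow _).trans (pow_le_pow_left₀ (norm_nonneg _) ?_ i)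
  calc ‖Uᴴ * P * V‖ ≤ ‖Uᴴ‖ * ‖P‖ * ‖V‖ :=
        (Matrix.l2_opNorm_mul _ _).trans (by gcongr; exact Matrix.l2_opNorm_mul _ _)
    _ ≤ 1 * ‖P‖ * 1 := by
        gcongr
        · rw [Matrix.l2_opNorm_conjTranspose]; exact norm_le_one_of_isometry hU
        · exact norm_le_one_of_isometry hV
    _ = ‖P‖ := by ring

lemma differentiableOn_det_compression [DecidableEq n] {k : Type*} [Fintype k] [DecidableEq k]
    (U V : Matrix n k ℂ) {s : Set ℂ} {Q : ℂ → Matrix n n ℂ} (hQ : DifferentiableOn ℂ Q s) :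
    DifferentiableOn ℂ (fun z => (Uᴴ * Q z * V).det) s := by
  have hentry : ∀ a b, DifferentiableOn ℂ (fun z => (Uᴴ * Q z * V) a b) s := by
    intro a b
    let L : Matrix n n ℂ →ₗ[ℂ] ℂ :=
      { toFun := fun M => (Uᴴ * M * V) a b
        map_add' := fun M N => by rw [Matrix.mul_add, Matrix.add_mul]; rfl
        map_smul' := fun c M => by rw [Matrix.mul_smul, Matrix.smul_mul]; rfl }
    exact (LinearMap.toContinuousLinearMap L).differentiable.comp_differentiableOn hQ
  simp only [Matrix.det_apply]
  refine DifferentiableOn.fun_sum fun σ _ => ?_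
  refine DifferentiableOn.const_smul ?_ (Equiv.Perm.sign σ)
  exact DifferentiableOn.fun_finsetProd fun a _ => hentry _ _

lemma isCompact_isometries : IsCompact {U : Matrix n (Fin i) ℂ | Uᴴ * U = 1} := by
  have _ : ProperSpace (Matrix n (Fin i) ℂ) := FiniteDimensional.proper ℂ _
  refine Metric.isCompact_of_isClosed_isBounded ?_ ?_
  · exact isClosed_eq (by fun_prop) continuous_const
  · refine (Metric.isBounded_closedBall (x := (0 : Matrix n (Fin i) ℂ)) (r := 1)).subset ?_
    intro U hU
    rw [mem_closedBall_zero_iff]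
    exact norm_le_one_of_isometry hU

lemma exists_re_mem_Icc {α : Type*} {P : ℂ → α} (hP : ∀ z, P (z + (2 * π : ℝ)) = P z) (z : ℂ) :
    ∃ w : ℂ, w.re ∈ Set.Icc 0 (2 * π) ∧ w.im = z.im ∧ P w = P z := by
  have hp : Function.Periodic P ((2 * π : ℝ) : ℂ) := hP
  refine ⟨z - toIcoDiv two_pi_pos 0 z.re • ((2 * π : ℝ) : ℂ), ?_, ?_, hp.sub_zsmul_eq _⟩
  · have := toIcoMod_mem_Ico two_pi_pos 0 z.re
    rw [zero_add] at this
    have e : (z - toIcoDiv two_pi_pos 0 z.re • ((2 * π : ℝ) : ℂ)).re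
        = toIcoMod two_pi_pos 0 z.re := by
      rw [toIcoMod, zsmul_eq_mul, zsmul_eq_mul, Complex.sub_re, ← Complex.ofReal_intCast,
        ← Complex.ofReal_mul, Complex.ofReal_re]
    rw [e]
    exact ⟨this.1, this.2.le⟩
  · rw [zsmul_eq_mul, Complex.sub_im, ← Complex.ofReal_intCast,
        ← Complex.ofReal_mul, Complex.ofReal_im, sub_zero]

lemma exists_penalized_max {P : ℂ → ℂ → Matrix n n ℂ} {Y ε : ℝ} (hY : 0 ≤ Y)
    (hcont : ContinuousOn (fun z : ℂ × ℂ => P z.1 z.2) {z | |z.1.im| ≤ Y ∧ |z.2.im| ≤ Y})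
    (hper1 : ∀ z1 z2, P (z1 + (2 * π : ℝ)) z2 = P z1 z2)
    (hper2 : ∀ z1 z2, P z1 (z2 + (2 * π : ℝ)) = P z1 z2)
    {U V : Matrix n (Fin i) ℂ} (hU : Uᴴ * U = 1) (hV : Vᴴ * V = 1) :
    ∃ z1 z2 : ℂ, |z1.im| ≤ Y ∧ |z2.im| ≤ Y ∧ ∃ U0 V0 : Matrix n (Fin i) ℂ,
      U0ᴴ * U0 = 1 ∧ V0ᴴ * V0 = 1 ∧ ∀ w1 w2 : ℂ, |w1.im| ≤ Y → |w2.im| ≤ Y →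
        ∀ U V : Matrix n (Fin i) ℂ, Uᴴ * U = 1 → Vᴴ * V = 1 →
          ‖(Uᴴ * P w1 w2 * V).det‖ * exp (-ε * (w1.im ^ 2 + w2.im ^ 2))
            ≤ ‖(U0ᴴ * P z1 z2 * V0).det‖ * exp (-ε * (z1.im ^ 2 + z2.im ^ 2)) := by
  set D : Set ℂ := Set.Icc 0 (2 * π) ×ℂ Set.Icc (-Y) Y
  have hD : IsCompact D := isCompact_Icc.reProdIm isCompact_Icc
  have hDY : ∀ z ∈ D, |z.im| ≤ Y := fun z hz => abs_le.2 (Complex.mem_reProdIm.1 hz).2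
  set I := {U : Matrix n (Fin i) ℂ | Uᴴ * U = 1}
  have hI : IsCompact I := isCompact_isometries
  set F : (ℂ × ℂ) × (Matrix n (Fin i) ℂ × Matrix n (Fin i) ℂ) → ℝ := fun x =>
    ‖((x.2.1)ᴴ * P x.1.1 x.1.2 * x.2.2).det‖ * exp (-ε * (x.1.1.im ^ 2 + x.1.2.im ^ 2))
  have hF : ContinuousOn F ((D ×ˢ D) ×ˢ (I ×ˢ I)) := by
    have hP : ContinuousOn (fun x : (ℂ × ℂ) × (Matrix n (Fin i) ℂ × Matrix n (Fin i) ℂ) =>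
        P x.1.1 x.1.2) ((D ×ˢ D) ×ˢ (I ×ˢ I)) :=
      hcont.comp continuousOn_fst fun x hx => ⟨hDY _ hx.1.1, hDY _ hx.1.2⟩
    refine ContinuousOn.mul ?_ (by fun_prop)
    refine ContinuousOn.norm ?_
    rw [continuousOn_iff_continuous_domRestrict] at hP ⊢
    exact Continuous.matrix_det (((by fun_prop : Continuous fun x :
      ((D ×ˢ D) ×ˢ (I ×ˢ I) : Set ((ℂ × ℂ) × (Matrix n (Fin i) ℂ × Matrix n (Fin i) ℂ))) =>
        (x.1.2.1)ᴴ).matrix_mul hP).matrix_mul (by fun_prop))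
  have h0 : (0 : ℂ) ∈ D := by
    rw [Complex.mem_reProdIm]
    exact ⟨⟨le_rfl, two_pi_pos.le⟩, ⟨by simpa using hY, by simpa using hY⟩⟩
  obtain ⟨x, hx, hmax⟩ := ((hD.prod hD).prod (hI.prod hI)).exists_isMaxOn
    ⟨((0, 0), (U, V)), ⟨⟨h0, h0⟩, ⟨hU, hV⟩⟩⟩ hF
  refine ⟨x.1.1, x.1.2, hDY _ hx.1.1, hDY _ hx.1.2, x.2.1, x.2.2, hx.2.1, hx.2.2, ?_⟩
  intro w1 w2 h1 h2 U V hU hV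
  obtain ⟨v1, hv1, hv1', e1⟩ := exists_re_mem_Icc (P := fun z => P z w2) (fun z => hper1 z w2) w1
  obtain ⟨v2, hv2, hv2', e2⟩ := exists_re_mem_Icc (P := fun z => P v1 z) (fun z => hper2 v1 z) w2
  have := hmax (a := ((v1, v2), (U, V))) ⟨⟨Complex.mem_reProdIm.2 ⟨hv1, ?_⟩,
    Complex.mem_reProdIm.2 ⟨hv2, ?_⟩⟩, ⟨hU, hV⟩⟩
  · simp only [Set.mem_ofPred_eq, F] at this
    rwa [e2, e1, hv1', hv2'] at this
  · rw [hv1']; exact abs_le.1 h1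
  · rw [hv2']; exact abs_le.1 h2

/-- A family of matrices of rank at most `i`, holomorphic in two variables and covariant under two
unitaries that commute up to a phase `w`, constrains `w ^ i`. -/
lemma exists_isometry_of_covariant [DecidableEq n] {P : ℂ → ℂ → Matrix n n ℂ} {A B : Matrix n n ℂ}
    {Y Mb h : ℝ} (hi : 1 ≤ i) (hY : 0 < Y) (hMb : 1 < Mb) (hh : 0 < h) (hhY : 8 * h ≤ Y)
    (hcont : ContinuousOn (fun z : ℂ × ℂ => P z.1 z.2) {z | |z.1.im| ≤ Y ∧ |z.2.im| ≤ Y})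
    (hd1 : ∀ z2 : ℂ, |z2.im| ≤ Y → DifferentiableOn ℂ (fun z => P z z2) {z | |z.im| < Y})
    (hd2 : ∀ z1 : ℂ, |z1.im| ≤ Y → DifferentiableOn ℂ (fun z => P z1 z) {z | |z.im| < Y})
    (hbd : ∀ z1 z2 : ℂ, |z1.im| ≤ Y → |z2.im| ≤ Y → ‖P z1 z2‖ ≤ Mb)
    (hper1 : ∀ z1 z2, P (z1 + (2 * π : ℝ)) z2 = P z1 z2)
    (hper2 : ∀ z1 z2, P z1 (z2 + (2 * π : ℝ)) = P z1 z2)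
    (hA : Aᴴ * A = 1) (hB : Bᴴ * B = 1)
    (hPA : ∀ z1 z2, P (z1 + h) z2 = A * P z1 z2 * Aᴴ)
    (hPB : ∀ z1 z2, P z1 (z2 + h) = B * P z1 z2 * Bᴴ)
    (hrank : ∀ z1 z2 : ℂ, |z1.im| < Y → |z2.im| < Y →
      ∀ U V : Matrix n (Fin i ⊕ Unit) ℂ, (Uᴴ * P z1 z2 * V).det = 0)
    {U V : Matrix n (Fin i) ℂ} (hU : Uᴴ * U = 1)
    (hV : Vᴴ * V = 1)
    (h1 : 1 ≤ ‖(Uᴴ * P 0 0 * V).det‖) {δ : ℝ}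
    (hδ : δ = (exp (256 * i * log Mb * h ^ 2 / Y ^ 2) - 1) / 3) :
    ∃ X : Matrix n (Fin i) ℂ, Xᴴ * X = 1 ∧ 1 - δ ≤ ‖(Xᴴ * A * X).det‖ ∧
      1 - δ ≤ ‖(Xᴴ * B * X).det‖ := by
  set ε : ℝ := 8 * i * log Mb / Y ^ 2 with hε
  have hlog : 0 < log Mb := Real.log_pos hMb
  have hi0 : (0 : ℝ) < i := by exact_mod_cast hi
  have hε0 : 0 < ε := by positivity
  obtain ⟨z1, z2, hz1, hz2, U0, V0, hU0, hV0, hmax⟩ :=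
    exists_penalized_max (ε := ε) hY.le hcont hper1 hper2 hU hV
  have hval : 1 ≤ ‖(U0ᴴ * P z1 z2 * V0).det‖ * exp (-ε * (z1.im ^ 2 + z2.im ^ 2)) := by
    have := hmax 0 0 (by simpa using hY.le) (by simpa using hY.le) U V hU hV
    simp only [Complex.zero_im] at this
    refine le_trans ?_ this
    simpa using h1
  have hm : (U0ᴴ * P z1 z2 * V0).det ≠ 0 := by
    intro h; rw [h] at hval; simp at hval; linarith
  have hdet : ‖(U0ᴴ * P z1 z2 * V0).det‖ ≤ exp (i * log Mb) := by
    refine (norm_det_compression_le hU0 hV0 _).trans ?_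
    rw [mul_comm, Real.exp_mul, Real.exp_log (by linarith), Real.rpow_natCast]
    exact pow_le_pow_left₀ (norm_nonneg _) (hbd _ _ hz1 hz2) _
  have hy : z1.im ^ 2 + z2.im ^ 2 ≤ (Y / 2) ^ 2 := by
    have h2 : 1 ≤ exp (i * log Mb + -ε * (z1.im ^ 2 + z2.im ^ 2)) := by
      rw [Real.exp_add]
      exact hval.trans (by gcongr)
    rw [Real.one_le_exp_iff] at h2
    have h3 : ε * (z1.im ^ 2 + z2.im ^ 2) ≤ i * log Mb := by linarith
    have h4 : (i : ℝ) * log Mb ≤ ε * (Y / 2) ^ 2 := by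
      rw [hε]; field_simp; norm_num
    exact le_of_mul_le_mul_left (h3.trans h4) hε0
  have hy1 : |z1.im| ≤ Y / 2 := abs_le_of_sq_le_sq (by nlinarith [sq_nonneg z2.im]) (by positivity)
  have hy2 : |z2.im| ≤ Y / 2 := abs_le_of_sq_le_sq (by nlinarith [sq_nonneg z1.im]) (by positivity)
  have him : ∀ {z w : ℂ}, |z.im| ≤ Y / 2 → w ∈ Metric.ball z (4 * h) → |w.im| < Y := by
    intro z w hz hw
    have h2 : |w.im - z.im| < 4 * h := by
      rw [← Complex.sub_im]
      exact (Complex.abs_im_le_norm _).trans_lt (by rw [← dist_eq_norm]; exact hw)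
    have h3 : |w.im| ≤ |w.im - z.im| + |z.im| := by
      have := abs_add_le (w.im - z.im) z.im
      rwa [sub_add_cancel] at this
    linarith
  have hδ' : (exp (2 * ε * (4 * h) ^ 2) - 1) / 3 = δ := by
    rw [hδ, hε]; congr 3; ring
  have hs : |h| ≤ 4 * h / 4 := by rw [abs_of_pos hh]; linarith
  have hmax0 : ∀ U' V' : Matrix n (Fin i) ℂ, U'ᴴ * U' = 1 → V'ᴴ * V' = 1 →
      ‖(U'ᴴ * P z1 z2 * V').det‖ ≤ ‖(U0ᴴ * P z1 z2 * V0).det‖ := by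
    intro U' V' hU' hV'
    exact le_of_mul_le_mul_right (hmax z1 z2 hz1 hz2 U' V' hU' hV') (exp_pos _)
  have k1 := le_norm_of_isMaxOn_penalized (f := fun z => (U0ᴴ * P z z2 * V0).det) (c := z1)
    (R := 4 * h) (ε := ε) (s := h) (by positivity) hε0
    ((differentiableOn_det_compression _ _ (hd1 z2 hz2)).mono fun w hw => him hy1 hw) hm
      (fun w hw => by
      have := hmax w z2 (him hy1 hw).le hz2 U0 V0 hU0 hV0
      rw [mul_add, Real.exp_add, ← mul_assoc, mul_add, Real.exp_add, ← mul_assoc] at this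
      exact le_of_mul_le_mul_right this (exp_pos _)) hs
  have k2 := le_norm_of_isMaxOn_penalized (f := fun z => (U0ᴴ * P z1 z * V0).det) (c := z2)
    (R := 4 * h) (ε := ε) (s := h) (by positivity) hε0
    ((differentiableOn_det_compression _ _ (hd2 z1 hz1)).mono fun w hw => him hy2 hw) hm
      (fun w hw => by
      have := hmax z1 w hz1 (him hy2 hw).le U0 V0 hU0 hV0
      rw [add_comm, mul_add, Real.exp_add, ← mul_assoc, add_comm, mul_add, Real.exp_add,
        ← mul_assoc] at this
      exact le_of_mul_le_mul_right this (exp_pos _)) hs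
  rw [hδ'] at k1 k2
  simp only [hPA] at k1
  simp only [hPB] at k2
  obtain ⟨X, hX, hXC⟩ := exists_isometry_det_le hU0 hV0
    (hrank z1 z2 (by linarith) (by linarith)) hm hmax0
  have hpos : 0 < ‖(U0ᴴ * P z1 z2 * V0).det‖ := norm_pos_iff.2 hm
  refine ⟨X, hX, ?_, ?_⟩
  · have := k1.trans (hXC A hA)
    rw [mul_comm] at this
    exact le_of_mul_le_mul_left this hpos
  · have := k2.trans (hXC B hB)
    rw [mul_comm] at this
    exact le_of_mul_le_mul_left this hpos

end Penalized

end CritAM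

namespace CritAM

section Potential

variable {ι : Type*} [Fintype ι]

lemma sub_two_mul_sq_le_log {y : ℝ} (hy : -(1 / 2) ≤ y) : y - 2 * y ^ 2 ≤ log (1 + y) := by
  have h1 : 0 < 1 + y := by linarith
  have h2 := Real.one_sub_inv_le_log_of_pos h1
  refine le_trans ?_ h2
  have : 1 - (1 + y)⁻¹ = y / (1 + y) := by field_simp; ring
  rw [this, le_div_iff₀ h1]
  nlinarith [mul_nonneg (sq_nonneg y) (show 0 ≤ 1 + 2 * y by linarith)]

lemma abs_mul_log_le (x : ℝ) : |x * log x| ≤ 1 + x ^ 2 := by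
  rcases eq_or_ne x 0 with rfl | hx
  · simp
  have h0 : 0 < |x| := abs_pos.2 hx
  have h1 := Real.log_le_sub_one_of_pos h0
  have h2 := Real.one_sub_inv_le_log_of_pos h0
  rw [abs_mul, ← Real.log_abs, ← sq_abs x, ← abs_of_pos h0, ← abs_mul, abs_of_pos h0, abs_le]
  constructor
  · have : |x| * (1 - |x|⁻¹) = |x| - 1 := by field_simp
    nlinarith [mul_le_mul_of_nonneg_left h2 h0.le]
  · nlinarith [mul_le_mul_of_nonneg_left h1 h0.le]

/-- The normalised logarithmic potential at `x + iη` of a unit mass at `d`. -/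
noncomputable def pot (d x η : ℝ) : ℝ := log (((x - d) ^ 2 + η ^ 2) / (1 + d ^ 2))

lemma pot_eq (d x η : ℝ) :
    pot d x η = log (1 + (-2 * x * d + x ^ 2 + η ^ 2 - 1) / (1 + d ^ 2)) := by
  rw [pot]; congr 1; field_simp; ring

lemma integral_log_abs_sub_ge {a : ℝ} (ha : 0 ≤ a) :
    -200 ≤ ∫ t in (2 : ℝ)..4, (2 * log (t - a) - log (1 + a ^ 2)) := by
  have h_int : IntervalIntegrable (fun t => log (t - a)) volume 2 4 := by
    have := (intervalIntegral.intervalIntegrable_log' (a := 2 - a) (b := 4 - a)).comp_sub_right a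
    simpa using this
  rcases le_or_gt a 8 with h | h
  · rw [intervalIntegral.integral_sub (h_int.const_mul 2) intervalIntegrable_const,
      intervalIntegral.integral_const_mul,
      intervalIntegral.integral_comp_sub_right (fun t => log t),
      integral_log, intervalIntegral.integral_const]
    have h1 := (abs_le.1 (abs_mul_log_le (4 - a))).1
    have h2 := (abs_le.1 (abs_mul_log_le (2 - a))).2
    have h3 : log (1 + a ^ 2) ≤ a ^ 2 := by
      have := Real.log_le_sub_one_of_pos (show 0 < 1 + a ^ 2 by positivity); linarith
    have h4 : log (1 + a ^ 2) ≤ 5 := by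
      rw [Real.log_le_iff_le_exp (by positivity)]
      have : (2.7 : ℝ) ^ 5 ≤ exp 5 := by
        rw [show (5 : ℝ) = (5 : ℕ) * 1 by norm_num, Real.exp_nat_mul]
        gcongr
        linarith [Real.exp_one_gt_d9]
      nlinarith
    simp only [smul_eq_mul]
    nlinarith
  · have : ∫ t in (2 : ℝ)..4, (-100 : ℝ) = -200 := by
      rw [intervalIntegral.integral_const]; norm_num
    rw [← this]
    refine intervalIntegral.integral_mono_on (by norm_num) intervalIntegrable_const
      ((h_int.const_mul 2).sub intervalIntegrable_const) fun t ht => ?_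
    have h1 : 2 * log (t - a) = log ((a - t) ^ 2) := by
      rw [Real.log_pow, ← Real.log_neg_eq_log (t - a)]; norm_num
    rw [h1]
    have h2 : log (1 + a ^ 2) ≤ log (5 * (a - t) ^ 2) := by
      apply Real.log_le_log (by positivity)
      nlinarith [ht.1, ht.2]
    have h0 : (a - t) ^ 2 ≠ 0 := by
      have : 0 < a - t := by linarith [ht.2]
      positivity
    rw [Real.log_mul (by norm_num) h0] at h2
    have h5 : log 5 ≤ 4 := by
      have := Real.log_le_sub_one_of_pos (show (0 : ℝ) < 5 by norm_num); linarith
    linarith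

lemma exists_radius (N : Finset ι) (d : ι → ℝ) :
    ∃ t ∈ Set.Icc (2 : ℝ) 4, (∀ k, |d k| ≠ t) ∧
      -100 * (N.card : ℝ) ≤ ∑ k ∈ N, log ((t - |d k|) ^ 2 / (1 + d k ^ 2)) := by
  set f : ℝ → ℝ := fun t => ∑ k ∈ N, (2 * log (t - |d k|) - log (1 + |d k| ^ 2))
  have h_int : ∀ k, IntervalIntegrable (fun t => 2 * log (t - |d k|) - log (1 + |d k| ^ 2))
      volume 2 4 := by
    intro k
    have := (intervalIntegral.intervalIntegrable_log'
      (a := 2 - |d k|) (b := 4 - |d k|)).comp_sub_right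
      |d k|
    simp only [sub_add_cancel] at this
    exact (this.const_mul 2).sub intervalIntegrable_const
  have hf : -200 * (N.card : ℝ) ≤ ∫ t in (2 : ℝ)..4, f t := by
    rw [intervalIntegral.integral_finsetSum fun k _ => h_int k]
    have := Finset.card_nsmul_le_sum N _ (-200)
      fun k _ => integral_log_abs_sub_ge (abs_nonneg (d k))
    rw [nsmul_eq_mul] at this
    linarith
  have hfi : IntegrableOn f (Set.Icc 2 4) := by
    rw [integrableOn_Icc_iff_integrableOn_Ioc, ← intervalIntegrable_iff_integrableOn_Ioc_of_le
      (by norm_num)]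
    have := IntervalIntegrable.sum N fun k _ => h_int k
    have hfe : f = ∑ k ∈ N, fun t => 2 * log (t - |d k|) - log (1 + |d k| ^ 2) := by
      funext t; simp [f]
    rwa [hfe]
  set B : Set ℝ := (Set.Icc 2 4)ᶜ ∪ Set.range fun k => |d k|
  have hB : volume.restrict (Set.Icc (2 : ℝ) 4) B = 0 := by
    refine measure_union_null ?_ ((Set.finite_range _).measure_zero _)
    rw [Measure.restrict_apply measurableSet_Icc.compl]
    simp
  obtain ⟨t, htB, ht⟩ := exists_notMem_null_average_le (by simp; norm_num) hfi hB
  have htI : t ∈ Set.Icc (2 : ℝ) 4 := by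
    by_contra h; exact htB (Or.inl h)
  have htd : ∀ k, |d k| ≠ t := fun k hk => htB (Or.inr ⟨k, hk⟩)
  refine ⟨t, htI, htd, ?_⟩
  rw [setAverage_eq, integral_Icc_eq_integral_Ioc,
    ← intervalIntegral.integral_of_le (by norm_num)] at ht
  have hv : (volume.real (Set.Icc (2 : ℝ) 4))⁻¹ = 1 / 2 := by
    rw [Real.volume_real_Icc]; norm_num
  rw [hv, smul_eq_mul] at ht
  refine (show _ ≤ f t by linarith).trans_eq (Finset.sum_congr rfl fun k _ => ?_)
  have h1 : t - |d k| ≠ 0 := sub_ne_zero.2 (htd k).symm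
  rw [Real.log_div (pow_ne_zero 2 h1) (by positivity), Real.log_pow, sq_abs]
  norm_num

/-- Linearization of `pot` far from the origin. -/
lemma pot_ge_linear {d x η B : ℝ} (hB : 0 ≤ x ^ 2 + η ^ 2 - 1)
    (h1 : |2 * x * d| ≤ (1 + d ^ 2) / 2)
    (h2 : (-2 * x * d + (x ^ 2 + η ^ 2 - 1)) ^ 2 ≤ B * (1 + d ^ 2)) :
    -2 * x * (d / (1 + d ^ 2)) - 2 * B * (1 / (1 + d ^ 2)) ≤ pot d x η := by
  have hd1 : 0 < 1 + d ^ 2 := by positivity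
  rw [pot_eq, add_sub_assoc, add_assoc]
  set y := (-2 * x * d + (x ^ 2 + (η ^ 2 - 1))) / (1 + d ^ 2) with hy
  have hyd : y * (1 + d ^ 2) = -2 * x * d + (x ^ 2 + η ^ 2 - 1) := by
    rw [hy, div_mul_cancel₀ _ hd1.ne']; ring
  have hxd := abs_le.1 h1
  have hy1 : -(1 / 2) ≤ y := by
    by_contra h
    push Not at h
    have := mul_lt_mul_of_pos_right h hd1
    linarith
  refine le_trans ?_ (sub_two_mul_sq_le_log hy1)
  have hy2 : y ^ 2 * (1 + d ^ 2) ≤ B := by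
    rw [← hyd, mul_pow, sq (1 + d ^ 2), ← mul_assoc] at h2
    exact le_of_mul_le_mul_right h2 hd1
  have e : y - 2 * y ^ 2 - (-2 * x * (d / (1 + d ^ 2)) - 2 * B * (1 / (1 + d ^ 2)))
      = ((x ^ 2 + η ^ 2 - 1) + 2 * (B - y ^ 2 * (1 + d ^ 2))) / (1 + d ^ 2) := by
    rw [eq_div_iff hd1.ne']
    have h5 : d / (1 + d ^ 2) * (1 + d ^ 2) = d := div_mul_cancel₀ _ hd1.ne'
    have h6 : 1 / (1 + d ^ 2) * (1 + d ^ 2) = 1 := div_mul_cancel₀ _ hd1.ne'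
    linear_combination hyd + 2 * x * h5 + 2 * B * h6
  have : 0 ≤ ((x ^ 2 + η ^ 2 - 1) + 2 * (B - y ^ 2 * (1 + d ^ 2))) / (1 + d ^ 2) :=
    div_nonneg (by linarith) hd1.le
  linarith

lemma exists_circle {A S : ℝ} (hA0 : 0 < A) (hA : 1000 ≤ log A) (d : ι → ℝ)
    (hyp : ∀ x η : ℝ, |x| ≤ A - 1 → 0 < η → η ≤ A → ∑ k, pot (d k) x η ≤ S) :
    ∃ t ∈ Set.Icc (2 : ℝ) 4, (∀ k, |d k| ≠ t) ∧
      (∀ x η : ℝ, x ^ 2 + η ^ 2 = t ^ 2 → -(S / 2) ≤ ∑ k, pot (d k) x η) ∧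
      ((Finset.univ.filter fun k => |d k| ≤ t).card : ℝ) * log A ≤ S := by
  have hA1 : 1001 ≤ A := by
    have := Real.log_le_sub_one_of_pos hA0; linarith
  set r := √A with hr
  have hrA : r ^ 2 = A := Real.sq_sqrt hA0.le
  have hr0 : 0 ≤ r := Real.sqrt_nonneg A
  have hr1 : 501 ≤ r := by
    have h1 : log A = 2 * log r := by rw [← hrA, Real.log_pow]; norm_num
    have := Real.log_le_sub_one_of_pos (show 0 < r from Real.sqrt_pos.2 hA0)
    linarith
  set N := Finset.univ.filter fun k => |d k| ≤ r
  set F := Finset.univ.filter fun k => ¬ |d k| ≤ r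
  have hsplit : ∀ f : ι → ℝ, ∑ k, f k = ∑ k ∈ N, f k + ∑ k ∈ F, f k := fun f =>
    (Finset.sum_filter_add_sum_filter_not _ _ _).symm
  have hN : ∀ k ∈ N, d k ^ 2 ≤ A := fun k hk => by
    rw [← hrA, ← sq_abs]
    exact pow_le_pow_left₀ (abs_nonneg _) (Finset.mem_filter.1 hk).2 2
  have hF : ∀ k ∈ F, A ≤ d k ^ 2 := fun k hk => by
    rw [← hrA, ← sq_abs (d k)]
    exact pow_le_pow_left₀ hr0 (not_le.1 (Finset.mem_filter.1 hk).2).le 2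
  set G := ∑ k ∈ F, 1 / (1 + d k ^ 2)
  set β := ∑ k ∈ F, d k / (1 + d k ^ 2)
  have hG0 : 0 ≤ G := Finset.sum_nonneg fun k _ => by positivity
  -- evaluation at `iA`
  have htop : (N.card : ℝ) * log A + G * ((A + 1) * log A) ≤ S := by
    refine le_trans ?_ (hyp 0 A (by simp; linarith) hA0 le_rfl)
    rw [hsplit, Finset.sum_mul]
    refine add_le_add ?_ (Finset.sum_le_sum fun k hk => ?_)
    · rw [← nsmul_eq_mul]
      refine Finset.card_nsmul_le_sum _ _ _ fun k hk => ?_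
      refine Real.log_le_log hA0 ?_
      rw [le_div_iff₀ (by positivity)]
      nlinarith [hN k hk]
    · rw [pot_eq]
      have hx1 : (-2 * 0 * d k + 0 ^ 2 + A ^ 2 - 1) / (1 + d k ^ 2) ≤ A - 1 := by
        rw [div_le_iff₀ (by positivity)]
        nlinarith [hF k hk]
      have hx0 : 0 ≤ (-2 * 0 * d k + 0 ^ 2 + A ^ 2 - 1) / (1 + d k ^ 2) := by
        apply div_nonneg _ (by positivity); nlinarith
      have e : 1 / (1 + d k ^ 2) * ((A + 1) * log A)
          = (-2 * 0 * d k + 0 ^ 2 + A ^ 2 - 1) / (1 + d k ^ 2) / (A - 1) * log A := by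
        have : A - 1 ≠ 0 := by linarith
        field_simp; ring
      rw [e]
      set x := (-2 * 0 * d k + 0 ^ 2 + A ^ 2 - 1) / (1 + d k ^ 2)
      have hc := strictConcaveOn_log_Ioi.concaveOn.2 (Set.mem_Ioi.2 hA0)
        (Set.mem_Ioi.2 one_pos) (show 0 ≤ x / (A - 1) from div_nonneg hx0 (by linarith))
        (show 0 ≤ 1 - x / (A - 1) by
          rw [sub_nonneg, div_le_one (by linarith)]; exact hx1) (by ring)
      simp only [smul_eq_mul, Real.log_one, mul_zero, add_zero] at hc
      refine hc.trans_eq ?_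
      congr 1
      have : A - 1 ≠ 0 := by linarith
      field_simp; ring
  have hNS : (N.card : ℝ) * log A ≤ S := by
    have : 0 ≤ G * ((A + 1) * log A) := by positivity
    linarith
  have hGS : G * (A * 1000) ≤ S := by
    have h1 : 0 ≤ (N.card : ℝ) * log A := by positivity
    have h2 : G * (A * 1000) ≤ G * ((A + 1) * log A) := by gcongr; linarith
    linarith
  have hS0 : 0 ≤ S := le_trans (by positivity) hNS
  -- evaluation at `± √A / 4 + i √(1 + A)`
  have hside : ∀ x : ℝ, |x| = r / 4 → -2 * x * β - 6 * A * G ≤ S := by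
    intro x hx
    have hx2 : x ^ 2 = A / 16 := by rw [← sq_abs, hx, div_pow, hrA]; norm_num
    have hη : √(1 + A) ^ 2 = 1 + A := Real.sq_sqrt (by linarith)
    refine le_trans ?_ (hyp x √(1 + A) (by rw [hx]; nlinarith) (Real.sqrt_pos.2 (by linarith)) ?_)
    · rw [hsplit]
      have h1 : 0 ≤ ∑ k ∈ N, pot (d k) x √(1 + A) := by
        refine Finset.sum_nonneg fun k hk => Real.log_nonneg ?_
        rw [one_le_div (by positivity), hη]
        nlinarith [hN k hk, sq_nonneg (x - d k)]
      have h2 : -2 * x * β - 6 * A * G ≤ ∑ k ∈ F, pot (d k) x √(1 + A) := by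
        rw [Finset.mul_sum, Finset.mul_sum, ← Finset.sum_sub_distrib]
        refine Finset.sum_le_sum fun k hk => ?_
        have hd := hF k hk
        have h3 : r ≤ |d k| := by
          rw [← Real.sqrt_sq_eq_abs]; exact Real.sqrt_le_sqrt hd
        have h5 : r * |d k| ≤ d k ^ 2 := by
          rw [← sq_abs (d k), sq]; gcongr
        have h4 := pot_ge_linear (d := d k) (x := x) (η := √(1 + A)) (B := 3 * A)
          (by rw [hη, hx2]; linarith)
          (by rw [abs_mul, abs_mul, hx, abs_two]; linarith)
          (by
            have h4 : (-2 * x * d k + 17 * A / 16) ^ 2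
                ≤ 2 * (4 * x ^ 2 * d k ^ 2) + 2 * (17 * A / 16) ^ 2 := by
              linarith [sq_nonneg (2 * x * d k + 17 * A / 16)]
            have h6 : A * A ≤ A * d k ^ 2 := by gcongr
            have h7 := mul_self_nonneg A
            rw [hη, show x ^ 2 + (1 + A) - 1 = 17 * A / 16 by rw [hx2]; ring]
            refine h4.trans ?_
            rw [hx2]
            linarith)
        linarith
      linarith
    · rw [Real.sqrt_le_left (by linarith)]; nlinarith
  have hβ : r * |β| ≤ 3 * S := by
    have h1 := hside (r / 4) (abs_of_nonneg (by positivity))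
    have h2 := hside (-(r / 4)) (by rw [abs_neg]; exact abs_of_nonneg (by positivity))
    have h3 : r / 2 * |β| ≤ S + 6 * A * G := by
      rcases abs_cases β with ⟨h, -⟩ | ⟨h, -⟩ <;> rw [h] <;> linarith
    nlinarith
  obtain ⟨t, ht, htd, hnear⟩ := exists_radius N d
  refine ⟨t, ht, htd, fun x η hxη => ?_, ?_⟩
  · have hx4 : |x| ≤ t := by
      apply abs_le_of_sq_le_sq _ (by linarith [ht.1]); nlinarith [sq_nonneg η]
    have h1 : ∑ k ∈ N, log ((t - |d k|) ^ 2 / (1 + d k ^ 2)) ≤ ∑ k ∈ N, pot (d k) x η := by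
      refine Finset.sum_le_sum fun k _ => Real.log_le_log ?_ ?_
      · have : t - |d k| ≠ 0 := sub_ne_zero.2 (htd k).symm
        positivity
      · gcongr ?_ / _
        have h2 : x * d k ≤ t * |d k| := by
          refine (le_abs_self _).trans ?_
          rw [abs_mul]; gcongr
        nlinarith [sq_abs (d k)]
    have h2 : -2 * x * β - 162 * G ≤ ∑ k ∈ F, pot (d k) x η := by
      rw [Finset.mul_sum, Finset.mul_sum, ← Finset.sum_sub_distrib]
      refine Finset.sum_le_sum fun k hk => ?_
      have hd := hF k hk
      have h3 : 501 ≤ |d k| := hr1.trans (by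
        rw [← Real.sqrt_sq_eq_abs]; exact Real.sqrt_le_sqrt hd)
      have hd2 : 501 * |d k| ≤ d k ^ 2 := by
        rw [← sq_abs (d k), sq]; gcongr
      have hxd : |2 * x * d k| ≤ 8 * |d k| := by
        rw [abs_mul, abs_mul, abs_two]
        gcongr
        linarith [ht.2]
      have ht2 : 4 ≤ t ^ 2 := by nlinarith [ht.1]
      have ht3 : t ^ 2 ≤ 16 := by nlinarith [ht.1, ht.2]
      have h4 := pot_ge_linear (d := d k) (x := x) (η := η) (B := 81)
        (by rw [hxη]; linarith) (by linarith) (by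
          have hxd' := abs_le.1 hxd
          have h6 : |-2 * x * d k + (x ^ 2 + η ^ 2 - 1)| ≤ 8 * |d k| + 15 := by
            rw [hxη, abs_le]
            constructor <;> linarith
          rw [← sq_abs]
          refine (pow_le_pow_left₀ (abs_nonneg _) h6 2).trans ?_
          rw [← sq_abs (d k)] at hd2 ⊢
          linarith)
      linarith
    rw [hsplit]
    have hxβ : 2 * x * β ≤ 8 * |β| := by
      refine (le_abs_self _).trans ?_
      rw [abs_mul, abs_mul, abs_two]
      have := ht.2
      gcongr; linarith
    have hβ' : |β| ≤ S / 100 := by nlinarith [abs_nonneg β]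
    have hG' : G ≤ S / 1000000 := by nlinarith
    have hN' : (N.card : ℝ) ≤ S / 1000 := by nlinarith [Nat.cast_nonneg (α := ℝ) N.card]
    linarith
  · refine le_trans ?_ hNS
    refine mul_le_mul_of_nonneg_right (Nat.cast_le.2 (Finset.card_le_card fun k hk => ?_))
      (by linarith)
    rw [Finset.mem_filter] at hk ⊢
    exact ⟨hk.1, by linarith [hk.2, ht.2]⟩

end Potential
end CritAM

namespace CritAM

section DetLaurent
variable {n : Type*} [Fintype n] [DecidableEq n]

open Polynomial in
/-- The determinant of a Laurent pencil that is covariant under multiplication of the variable by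
a root of unity has only three terms. -/
lemma exists_det_laurent [Nonempty n] {W U V A : Matrix n n ℂ} {w : ℂ}
    (hw : IsPrimitiveRoot w (Fintype.card n)) (hA : A.det ≠ 0) (hW : A * W = W * A)
    (hU : A * U = w • (U * A)) (hV : A * V = w⁻¹ • (V * A)) :
    ∃ c : ℂ, ∀ x : ℂ, x ≠ 0 → (W - x • U - x⁻¹ • V).det
      = c + (-U).det * x ^ Fintype.card n + (-V).det * (x⁻¹) ^ Fintype.card n := by
  set q := Fintype.card n with hq
  have hq0 : 0 < q := Fintype.card_pos
  have hw0 : w ≠ 0 := hw.ne_zero hq0.ne'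
  let M : Matrix n n ℂ[X] := Matrix.of fun i j =>
    Polynomial.C (W i j) * X - Polynomial.C (U i j) * X ^ 2 - Polynomial.C (V i j)
  set P := M.det with hP
  have hPev : ∀ x, P.eval x = (x • W - x ^ 2 • U - V).det := by
    intro x
    rw [hP, ← Polynomial.coe_evalRingHom, RingHom.map_det]
    congr 1
    ext i j
    simp only [M, RingHom.mapMatrix_apply, Matrix.map_apply, Matrix.of_apply,
      Polynomial.coe_evalRingHom, eval_sub, eval_mul, eval_C, eval_X, eval_pow, Matrix.sub_apply,
      Matrix.smul_apply, smul_eq_mul]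
    ring
  have hPx : ∀ x ≠ 0, P.eval x = x ^ q * (W - x • U - x⁻¹ • V).det := by
    intro x hx
    rw [hPev, ← Matrix.det_smul]
    congr 1
    rw [smul_sub, smul_sub, smul_smul, smul_smul, mul_inv_cancel₀ hx, one_smul, sq]
  have hdeg : P.natDegree ≤ 2 * q := by
    rw [hP, Matrix.det_apply]
    refine Polynomial.natDegree_sum_le_of_forall_le _ _ fun σ _ => ?_
    refine (Polynomial.natDegree_smul_le _ _).trans ?_
    refine (Polynomial.natDegree_prod_le _ _).trans ?_
    refine (Finset.sum_le_card_nsmul _ _ 2 fun i _ => ?_).trans ?_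
    · simp only [M, Matrix.of_apply]
      compute_degree
    · simp [hq, mul_comm]
  have hinv : ∀ x ≠ 0, P.eval (w * x) = P.eval x := by
    intro x hx
    rw [hPx _ hx, hPx _ (mul_ne_zero hw0 hx), mul_pow, hw.pow_eq_one, one_mul]
    congr 1
    have h : A * (W - x • U - x⁻¹ • V) = (W - (w * x) • U - (w * x)⁻¹ • V) * A := by
      rw [mul_sub, mul_sub, sub_mul, sub_mul, hW, Matrix.mul_smul, Matrix.mul_smul, hU, hV,
        Matrix.smul_mul, Matrix.smul_mul, smul_smul, smul_smul, mul_inv, mul_comm x, mul_comm x⁻¹]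
    have h' := congrArg Matrix.det h
    rw [Matrix.det_mul, Matrix.det_mul, mul_comm] at h'
    exact (mul_right_cancel₀ hA h').symm
  have hcomp : P.comp (Polynomial.C w * X) = P := by
    refine Polynomial.eq_of_infinite_eval_eq _ _ ((Set.Infinite.mono (s := {0}ᶜ) ?_)
      (Set.finite_singleton (0 : ℂ)).infinite_compl)
    intro x hx
    simpa using hinv x hx
  have hco : ∀ k, ¬ q ∣ k → P.coeff k = 0 := by
    intro k hk
    have h := congrArg (fun Q => Polynomial.coeff Q k) hcomp
    simp only [Polynomial.comp_C_mul_X_coeff] at h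
    by_contra h0
    refine hk (hw.dvd_of_pow_eq_one k ?_)
    exact mul_left_cancel₀ h0 (by rw [h, mul_one])
  have heval : ∀ x, P.eval x = P.coeff 0 + P.coeff q * x ^ q + P.coeff (2 * q) * x ^ (2 * q) := by
    intro x
    rw [Polynomial.eval_eq_sum_range' (n := 2 * q + 1) (by omega)]
    rw [← Finset.sum_subset (s₁ := {0, q, 2 * q})]
    · rw [Finset.sum_insert, Finset.sum_pair]
      · simp [add_assoc]
      · omega
      · simp; omega
    · intro k hk
      simp only [Finset.mem_insert, Finset.mem_singleton] at hk
      simp only [Finset.mem_range]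
      omega
    · intro k hk hk'
      simp only [Finset.mem_insert, Finset.mem_singleton, not_or] at hk'
      simp only [Finset.mem_range] at hk
      rw [hco k, zero_mul]
      rintro ⟨m, rfl⟩
      have : m < 3 := by
        by_contra h
        push Not at h
        nlinarith
      obtain ⟨h1, h2, h3⟩ := hk'
      interval_cases m <;> omega
  have h0 : P.coeff 0 = (-V).det := by
    have := hPev 0
    rwa [heval, zero_pow hq0.ne', zero_pow (by omega), mul_zero, mul_zero, add_zero, add_zero,
      zero_smul, zero_pow two_ne_zero, zero_smul, sub_zero, zero_sub] at this
  have h2 : P.coeff (2 * q) = (-U).det := by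
    have h : ∀ y : ℂ, y ≠ 0 → P.coeff 0 * y ^ (2 * q) + P.coeff q * y ^ q + P.coeff (2 * q)
        = (y • W - U - y ^ 2 • V).det := by
      intro y hy
      have h1 := (heval y⁻¹).symm.trans (hPev y⁻¹)
      have h3 : (y ^ 2) • (y⁻¹ • W - y⁻¹ ^ 2 • U - V) = y • W - U - y ^ 2 • V := by
        rw [smul_sub, smul_sub, smul_smul, smul_smul, ← mul_pow, mul_inv_cancel₀ hy, one_pow,
          one_smul, sq, mul_assoc, mul_inv_cancel₀ hy, mul_one]
      have hz : y ^ q ≠ 0 := pow_ne_zero _ hy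
      rw [← h3, Matrix.det_smul, ← h1, ← hq, ← pow_mul, pow_mul', pow_mul', inv_pow]
      field_simp
    have hc1 : Continuous fun y : ℂ =>
        P.coeff 0 * y ^ (2 * q) + P.coeff q * y ^ q + P.coeff (2 * q) := by fun_prop
    have hc2 : Continuous fun y : ℂ => (y • W - U - y ^ 2 • V).det :=
      Continuous.matrix_det (by fun_prop)
    have := congrFun (hc1.ext_on (dense_compl_singleton (0 : ℂ)) hc2 (fun y hy => h y hy)) 0
    rwa [zero_pow hq0.ne', zero_pow (by omega), mul_zero, mul_zero, zero_add, zero_add,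
      zero_smul, zero_pow two_ne_zero, zero_smul, sub_zero, zero_sub] at this
  refine ⟨P.coeff q, fun x hx => ?_⟩
  have h := (heval x).symm.trans (hPx x hx)
  rw [h0, h2, pow_mul'] at h
  have hxq : x ^ q ≠ 0 := pow_ne_zero _ hx
  refine mul_left_cancel₀ hxq (h.symm.trans ?_)
  rw [inv_pow, mul_add, mul_add, mul_left_comm (x ^ q) (-V).det, mul_inv_cancel₀ hxq]
  ring

end DetLaurent
end CritAM

namespace CritAM

open scoped Matrix ComplexOrder Matrix.Norms.L2Operator

lemma norm_det_of_isometry {n : Type*} [Fintype n] [DecidableEq n] {A : Matrix n n ℂ}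
    (hA : Aᴴ * A = 1) : ‖A.det‖ = 1 := by
  have h := congrArg Matrix.det hA
  rw [Matrix.det_mul, Matrix.det_conjTranspose, Matrix.det_one] at h
  have h2 := congrArg norm h
  rw [norm_mul, norm_star, norm_one] at h2
  nlinarith [norm_nonneg A.det]

section Harper
variable {q : ℕ}

/-- The cyclic translation by `r`. -/
def shift (r : ZMod q) : Matrix (ZMod q) (ZMod q) ℂ :=
  Matrix.of fun n m => if n = m + r then 1 else 0

lemma shift_zero : (shift 0 : Matrix (ZMod q) (ZMod q) ℂ) = 1 := by
  ext n m
  simp [shift, Matrix.one_apply]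

lemma conjTranspose_shift (r : ZMod q) : (shift r)ᴴ = shift (-r) := by
  ext n m
  simp only [shift, Matrix.conjTranspose_apply, Matrix.of_apply]
  have : m = n + r ↔ n = m + -r := ⟨fun h => by rw [h]; ring, fun h => by rw [h]; ring⟩
  simp only [this]
  split_ifs <;> simp

variable [NeZero q]

/-- Multiplication by the character `n ↦ e(pn/q)`. -/
noncomputable def phase (p : ZMod q) : Matrix (ZMod q) (ZMod q) ℂ :=
  Matrix.diagonal fun n => ZMod.stdAddChar (p * n)

lemma shift_mul_apply (r : ZMod q) (M : Matrix (ZMod q) (ZMod q) ℂ) (n m : ZMod q) :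
    (shift r * M) n m = M (n - r) m := by
  rw [Matrix.mul_apply, Finset.sum_eq_single (n - r)]
  · simp [shift]
  · intro b _ hb
    have : n ≠ b + r := fun h => hb (by rw [h]; ring)
    simp [shift, this]
  · simp

lemma shift_mul_shift (r s : ZMod q) : shift r * shift s = shift (r + s) := by
  ext n m
  rw [shift_mul_apply]
  simp only [shift, Matrix.of_apply, sub_eq_iff_eq_add]
  congr 2
  ring

lemma shift_isometry (r : ZMod q) : (shift r)ᴴ * shift r = 1 := by
  rw [conjTranspose_shift, shift_mul_shift, neg_add_cancel, shift_zero]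

lemma phase_mul_phase (p s : ZMod q) : phase p * phase s = phase (p + s) := by
  simp [phase, Matrix.diagonal_mul_diagonal, add_mul, AddChar.map_add_eq_mul]

lemma phase_zero : (phase 0 : Matrix (ZMod q) (ZMod q) ℂ) = 1 := by
  simp [phase]

lemma conjTranspose_phase (p : ZMod q) : (phase p)ᴴ = phase (-p) := by
  rw [phase, phase, Matrix.diagonal_conjTranspose]
  congr 1
  ext n
  rw [Pi.star_apply, neg_mul, AddChar.map_neg_eq_conj]
  rfl

lemma phase_isometry (p : ZMod q) : (phase p)ᴴ * phase p = 1 := by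
  rw [conjTranspose_phase, phase_mul_phase, neg_add_cancel, phase_zero]

lemma phase_mul_shift (p r : ZMod q) :
    phase p * shift r = (ZMod.stdAddChar (p * r) : ℂ) • (shift r * phase p) := by
  ext n m
  rw [phase, Matrix.diagonal_mul, Matrix.smul_apply, Matrix.mul_diagonal]
  simp only [shift, Matrix.of_apply]
  split_ifs with h
  · rw [h, mul_add, AddChar.map_add_eq_mul]
    simp [mul_comm]
  · simp

lemma shift_mul_phase (p r : ZMod q) :
    shift r * phase p = (ZMod.stdAddChar (-(p * r)) : ℂ) • (phase p * shift r) := by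
  rw [phase_mul_shift, smul_smul, ← AddChar.map_add_eq_mul, neg_add_cancel]
  simp

lemma stdAddChar_one :
    (ZMod.stdAddChar (1 : ZMod q) : ℂ) = Complex.exp (2 * π * Complex.I / q) := by
  have := ZMod.stdAddChar_coe (N := q) 1
  simpa using this

/-- The Bloch fibres of the almost Mathieu operator at frequency `p / q`. -/
noncomputable def harper (p : ZMod q) (z₁ z₂ : ℂ) : Matrix (ZMod q) (ZMod q) ℂ :=
  Complex.exp (Complex.I * z₂) • shift 1 + Complex.exp (-(Complex.I * z₂)) • shift (-1) +
    (Complex.exp (Complex.I * z₁) • phase p + Complex.exp (-(Complex.I * z₁)) • phase (-p))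

lemma conj_smul_isometry {A X : Matrix (ZMod q) (ZMod q) ℂ} (hA : Aᴴ * A = 1) {w : ℂ}
    (h : A * X = w • (X * A)) : A * X * Aᴴ = w • X := by
  rw [h, Matrix.smul_mul, mul_assoc, mul_eq_one_comm.1 hA, mul_one]

lemma shift_conj_harper {p r : ZMod q} (hr : p * r = 1) (z₁ z₂ : ℂ) :
    shift (-r) * harper p z₁ z₂ * (shift (-r))ᴴ
      = harper p (z₁ + ((2 * π / q : ℝ) : ℂ)) z₂ := by
  have hs : ∀ s : ZMod q, shift (-r) * shift s * (shift (-r))ᴴ = shift s := by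
    intro s
    rw [conjTranspose_shift, shift_mul_shift, shift_mul_shift]
    congr 1; ring
  have hp : ∀ s : ZMod q, shift (-r) * phase s * (shift (-r))ᴴ
      = (ZMod.stdAddChar (s * r) : ℂ) • phase s := by
    intro s
    refine conj_smul_isometry (shift_isometry _) ?_
    rw [shift_mul_phase, mul_neg, neg_neg]
  simp only [harper, mul_add, add_mul, Matrix.mul_smul, Matrix.smul_mul, hs, hp, hr, neg_mul,
    AddChar.map_neg_eq_inv, stdAddChar_one, smul_smul]
  rw [← Complex.exp_neg, ← Complex.exp_add, ← Complex.exp_add]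
  congr 4
  · push_cast; ring
  · push_cast; ring

lemma phase_conj_harper (p : ZMod q) (z₁ z₂ : ℂ) :
    phase 1 * harper p z₁ z₂ * (phase 1)ᴴ
      = harper p z₁ (z₂ + ((2 * π / q : ℝ) : ℂ)) := by
  have hs : ∀ s : ZMod q, phase 1 * phase s * (phase 1)ᴴ = phase s := by
    intro s
    rw [conjTranspose_phase, phase_mul_phase, phase_mul_phase]
    congr 1; ring
  have hp : ∀ s : ZMod q, phase 1 * shift s * (phase 1)ᴴ
      = (ZMod.stdAddChar s : ℂ) • shift s := by
    intro s
    refine conj_smul_isometry (phase_isometry _) ?_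
    rw [phase_mul_shift, one_mul]
  simp only [harper, mul_add, add_mul, Matrix.mul_smul, Matrix.smul_mul, hs, hp,
    AddChar.map_neg_eq_inv, stdAddChar_one, smul_smul]
  rw [← Complex.exp_neg, ← Complex.exp_add, ← Complex.exp_add]
  congr 4
  · push_cast; ring
  · push_cast; ring

lemma shift_mul_phase_one (r : ZMod q) :
    shift (-r) * phase 1 = (ZMod.stdAddChar r : ℂ) • (phase 1 * shift (-r)) := by
  rw [shift_mul_phase]; simp

lemma harper_add_two_pi_left (p : ZMod q) (z₁ z₂ : ℂ) :
    harper p (z₁ + ((2 * π : ℝ) : ℂ)) z₂ = harper p z₁ z₂ := by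
  have h : ∀ z : ℂ, Complex.I * (z + ((2 * π : ℝ) : ℂ)) = Complex.I * z + 2 * π * Complex.I := by
    intro z; push_cast; ring
  simp only [harper, h, Complex.exp_neg, Complex.exp_periodic _]

lemma harper_add_two_pi_right (p : ZMod q) (z₁ z₂ : ℂ) :
    harper p z₁ (z₂ + ((2 * π : ℝ) : ℂ)) = harper p z₁ z₂ := by
  have h : ∀ z : ℂ, Complex.I * (z + ((2 * π : ℝ) : ℂ)) = Complex.I * z + 2 * π * Complex.I := by
    intro z; push_cast; ring
  simp only [harper, h, Complex.exp_neg, Complex.exp_periodic _]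

lemma harper_isHermitian (p : ZMod q) (x₁ x₂ : ℝ) : (harper p x₁ x₂).IsHermitian := by
  have h : ∀ x : ℝ, star (Complex.exp (Complex.I * x)) = Complex.exp (-(Complex.I * x)) := by
    intro x
    rw [Complex.star_def, ← Complex.exp_conj]
    simp
  have h' : ∀ x : ℝ, star (Complex.exp (-(Complex.I * x))) = Complex.exp (Complex.I * x) := by
    intro x; rw [← h, star_star]
  rw [Matrix.IsHermitian, harper]
  simp only [Matrix.conjTranspose_add, Matrix.conjTranspose_smul, conjTranspose_shift,
    conjTranspose_phase, h, h', neg_neg]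
  abel

lemma norm_exp_I_mul (z : ℂ) : ‖Complex.exp (Complex.I * z)‖ = exp (-z.im) := by
  rw [Complex.norm_exp]; simp

lemma norm_exp_neg_I_mul (z : ℂ) : ‖Complex.exp (-(Complex.I * z))‖ = exp z.im := by
  rw [Complex.norm_exp]; simp

lemma norm_shift_le (r : ZMod q) : ‖shift r‖ ≤ 1 := by
  have h := shift_isometry r
  exact norm_le_one_of_isometry h

lemma norm_phase_le (r : ZMod q) : ‖phase r‖ ≤ 1 := by
  have h := phase_isometry r
  exact norm_le_one_of_isometry h

lemma norm_smul_le_of_norm_le_one {A : Matrix (ZMod q) (ZMod q) ℂ} (hA : ‖A‖ ≤ 1) (w : ℂ) :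
    ‖w • A‖ ≤ ‖w‖ := by
  rw [norm_smul]; exact mul_le_of_le_one_right (norm_nonneg _) hA

lemma norm_harper_le (p : ZMod q) (z₁ z₂ : ℂ) :
    ‖harper p z₁ z₂‖ ≤ 2 * exp |z₁.im| + 2 * exp |z₂.im| := by
  have h1 : ∀ (z : ℂ) (A B : Matrix (ZMod q) (ZMod q) ℂ), ‖A‖ ≤ 1 → ‖B‖ ≤ 1 →
      ‖Complex.exp (Complex.I * z) • A + Complex.exp (-(Complex.I * z)) • B‖
        ≤ 2 * exp |z.im| := by
    intro z A B hA hB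
    refine (norm_add_le _ _).trans ?_
    have e1 := norm_smul_le_of_norm_le_one hA (Complex.exp (Complex.I * z))
    have e2 := norm_smul_le_of_norm_le_one hB (Complex.exp (-(Complex.I * z)))
    rw [norm_exp_I_mul] at e1
    rw [norm_exp_neg_I_mul] at e2
    have e3 := exp_le_exp.2 (neg_le_abs z.im)
    have e4 := exp_le_exp.2 (le_abs_self z.im)
    linarith
  refine (norm_add_le _ _).trans ?_
  have := h1 z₁ (phase p) (phase (-p)) (norm_phase_le _) (norm_phase_le _)
  have := h1 z₂ (shift 1) (shift (-1)) (norm_shift_le _) (norm_shift_le _)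
  linarith

lemma continuous_harper (p : ZMod q) : Continuous fun z : ℂ × ℂ => harper p z.1 z.2 := by
  unfold harper
  fun_prop

lemma differentiable_harper_comp (p : ZMod q) {f g : ℂ → ℂ} {s : Set ℂ}
    (hf : DifferentiableOn ℂ f s) (hg : DifferentiableOn ℂ g s) :
    DifferentiableOn ℂ (fun z => harper p (f z) (g z)) s := by
  unfold harper
  fun_prop

/-- Chambers' formula. -/
lemma exists_chambers {p r : ZMod q} (hr : p * r = 1) :
    ∃ a a' b b' : ℂ, ‖a‖ = 1 ∧ ‖a'‖ = 1 ∧ ‖b‖ = 1 ∧ ‖b'‖ = 1 ∧ ∀ ζ : ℂ, ∃ c : ℂ, ∀ z₁ z₂ : ℂ,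
      (ζ • 1 - harper p z₁ z₂).det = c
        + (a * Complex.exp (Complex.I * z₁) ^ q + a' * Complex.exp (-(Complex.I * z₁)) ^ q)
        + (b * Complex.exp (Complex.I * z₂) ^ q + b' * Complex.exp (-(Complex.I * z₂)) ^ q) := by
  have hneg : ∀ {A : Matrix (ZMod q) (ZMod q) ℂ}, Aᴴ * A = 1 → ‖(-A).det‖ = 1 := by
    intro A hA
    exact norm_det_of_isometry (by rw [Matrix.conjTranspose_neg, neg_mul_neg, hA])
  have hdet0 : ∀ {A : Matrix (ZMod q) (ZMod q) ℂ}, Aᴴ * A = 1 → A.det ≠ 0 := by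
    intro A hA h
    have := norm_det_of_isometry hA
    simp [h] at this
  have hw : IsPrimitiveRoot (ZMod.stdAddChar (1 : ZMod q) : ℂ) (Fintype.card (ZMod q)) := by
    rw [ZMod.card, stdAddChar_one]
    exact Complex.isPrimitiveRoot_exp q (NeZero.ne q)
  refine ⟨(-phase p).det, (-phase (-p)).det, (-shift 1).det, (-shift (-1)).det,
    hneg (phase_isometry _), hneg (phase_isometry _), hneg (shift_isometry _),
    hneg (shift_isometry _), fun ζ => ?_⟩
  have h1 : ∀ z₂ : ℂ, ∃ c : ℂ, ∀ z₁ : ℂ, (ζ • 1 - harper p z₁ z₂).det = c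
      + ((-phase p).det * Complex.exp (Complex.I * z₁) ^ q
        + (-phase (-p)).det * Complex.exp (-(Complex.I * z₁)) ^ q) := by
    intro z₂
    obtain ⟨c, hc⟩ := exists_det_laurent (A := shift (-r)) (U := phase p) (V := phase (-p))
      (W := ζ • 1 - (Complex.exp (Complex.I * z₂) • shift 1
        + Complex.exp (-(Complex.I * z₂)) • shift (-1))) hw (hdet0 (shift_isometry _))
      (by simp only [mul_sub, sub_mul, mul_add, add_mul, Matrix.mul_smul, Matrix.smul_mul,
            shift_mul_shift, mul_one, one_mul, add_comm])
      (by rw [shift_mul_phase, mul_neg, neg_neg, hr])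
      (by rw [shift_mul_phase, neg_mul_neg, hr, AddChar.map_neg_eq_inv])
    refine ⟨c, fun z₁ => ?_⟩
    have := hc (Complex.exp (Complex.I * z₁)) (Complex.exp_ne_zero _)
    rw [← Complex.exp_neg, ZMod.card] at this
    rw [← add_assoc, ← this, harper]
    congr 1
    abel
  have h2 : ∀ z₁ : ℂ, ∃ c : ℂ, ∀ z₂ : ℂ, (ζ • 1 - harper p z₁ z₂).det = c
      + ((-shift (1 : ZMod q)).det * Complex.exp (Complex.I * z₂) ^ q
        + (-shift (-1 : ZMod q)).det * Complex.exp (-(Complex.I * z₂)) ^ q) := by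
    intro z₁
    obtain ⟨c, hc⟩ := exists_det_laurent (A := phase 1) (U := shift 1) (V := shift (-1))
      (W := ζ • 1 - (Complex.exp (Complex.I * z₁) • phase p
        + Complex.exp (-(Complex.I * z₁)) • phase (-p))) hw (hdet0 (phase_isometry _))
      (by simp only [mul_sub, sub_mul, mul_add, add_mul, Matrix.mul_smul, Matrix.smul_mul,
            phase_mul_phase, mul_one, one_mul, add_comm])
      (by rw [phase_mul_shift, one_mul])
      (by rw [phase_mul_shift, one_mul, AddChar.map_neg_eq_inv])
    refine ⟨c, fun z₂ => ?_⟩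
    have := hc (Complex.exp (Complex.I * z₂)) (Complex.exp_ne_zero _)
    rw [← Complex.exp_neg, ZMod.card] at this
    rw [← add_assoc, ← this, harper]
    congr 1
    abel
  obtain ⟨c, hc⟩ := h1 0
  refine ⟨c - ((-shift (1 : ZMod q)).det + (-shift (-1 : ZMod q)).det), fun z₁ z₂ => ?_⟩
  obtain ⟨d, hd⟩ := h2 z₁
  have e1 := hc z₁
  have e2 := hd 0
  have e3 := hd z₂
  simp only [mul_zero, neg_zero, Complex.exp_zero, one_pow, mul_one] at e2
  linear_combination e3 - e2 + e1

end Harper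
end CritAM

namespace CritAM

lemma exists_inverse_norm_le {A : Type*} [CStarAlgebra A] {a : A} (ha : IsStarNormal a) {ζ : ℂ}
    {ρ : ℝ} (hρ : 0 < ρ) (h : ∀ z ∈ spectrum ℂ a, ρ ≤ ‖ζ - z‖) :
    ∃ b : A, b * (algebraMap ℂ A ζ - a) = 1 ∧ (algebraMap ℂ A ζ - a) * b = 1 ∧ ‖b‖ ≤ ρ⁻¹ := by
  have hne : ∀ z ∈ spectrum ℂ a, ζ - z ≠ 0 := fun z hz => by
    rw [← norm_pos_iff]; exact hρ.trans_le (h z hz)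
  have hc : ContinuousOn (fun z : ℂ => (ζ - z)⁻¹) (spectrum ℂ a) :=
    (continuousOn_const.sub continuousOn_id).inv₀ hne
  have hd : ContinuousOn (fun z : ℂ => ζ - z) (spectrum ℂ a) :=
    continuousOn_const.sub continuousOn_id
  have hsub : algebraMap ℂ A ζ - a = cfc (fun z : ℂ => ζ - z) a := by
    rw [cfc_sub (fun _ => ζ) (fun z => z) a, cfc_const ζ a, cfc_id' ℂ a]
  refine ⟨cfc (fun z : ℂ => (ζ - z)⁻¹) a, ?_, ?_, ?_⟩
  · rw [hsub, ← cfc_mul (fun z : ℂ => (ζ - z)⁻¹) (fun z : ℂ => ζ - z) a hc hd, ← cfc_one ℂ a]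
    exact cfc_congr fun z hz => inv_mul_cancel₀ (hne z hz)
  · rw [hsub, ← cfc_mul (fun z : ℂ => ζ - z) (fun z : ℂ => (ζ - z)⁻¹) a hd hc, ← cfc_one ℂ a]
    exact cfc_congr fun z hz => mul_inv_cancel₀ (hne z hz)
  · refine norm_cfc_le (inv_nonneg.2 hρ.le) fun z hz => ?_
    rw [norm_inv]
    exact inv_anti₀ hρ (h z hz)

open scoped Matrix ComplexOrder Matrix.Norms.L2Operator

section Hermitian
variable {n : Type*} [Fintype n] [DecidableEq n]

lemma mem_spectrum_iff_det_eq_zero {A : Matrix n n ℂ} {ζ : ℂ} :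
    ζ ∈ spectrum ℂ A ↔ (ζ • 1 - A).det = 0 := by
  rw [spectrum.mem_iff, Matrix.isUnit_iff_isUnit_det, isUnit_iff_ne_zero, not_not,
    Algebra.algebraMap_eq_smul_one]

lemma isUnit_and_norm_inv_le {A : Matrix n n ℂ} (hA : A.IsHermitian) {ζ : ℂ} {ρ : ℝ}
    (hρ : 0 < ρ) (h : ∀ z : ℂ, (z • 1 - A).det = 0 → ρ ≤ ‖ζ - z‖) :
    IsUnit (ζ • 1 - A) ∧ ‖(ζ • 1 - A)⁻¹‖ ≤ ρ⁻¹ := by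
  have hA' : IsSelfAdjoint A := hA
  obtain ⟨b, hb1, hb2, hb⟩ := exists_inverse_norm_le hA'.isStarNormal hρ
    (fun z hz => h z (mem_spectrum_iff_det_eq_zero.1 hz))
  rw [Algebra.algebraMap_eq_smul_one] at hb1 hb2
  refine ⟨IsUnit.of_mul_eq_one _ hb2, ?_⟩
  rwa [Matrix.inv_eq_left_inv hb1]

lemma det_smul_one_sub_eq_prod {A : Matrix n n ℂ} (hA : A.IsHermitian) (ζ : ℂ) :
    (ζ • 1 - A).det = ∏ k, (ζ - hA.eigenvalues k) := by
  have h := congrArg (Polynomial.eval ζ) hA.charpoly_eq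
  rw [Matrix.eval_charpoly] at h
  rw [← Algebra.algebraMap_eq_smul_one]
  refine h.trans ?_
  simp [Polynomial.eval_prod]

end Hermitian

section Bands
variable {q : ℕ} [NeZero q]

/-- The union of the spectra of the Bloch fibres. -/
def bands (p : ZMod q) : Set ℝ :=
  {E | ∃ x₁ x₂ : ℝ, ((E : ℂ) • 1 - harper p x₁ x₂).det = 0}

lemma eigenvalues_mem_bands (p : ZMod q) (x₁ x₂ : ℝ) (k : ZMod q) :
    (harper_isHermitian p x₁ x₂).eigenvalues k ∈ bands p :=
  ⟨x₁, x₂, by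
    rw [det_smul_one_sub_eq_prod (harper_isHermitian p x₁ x₂)]
    exact Finset.prod_eq_zero (Finset.mem_univ k) (sub_self _)⟩

lemma exists_mem_bands_of_det_eq_zero {p : ZMod q} {x₁ x₂ : ℝ} {ζ : ℂ}
    (h : (ζ • 1 - harper p x₁ x₂).det = 0) : ∃ E ∈ bands p, ζ = (E : ℝ) := by
  rw [det_smul_one_sub_eq_prod (harper_isHermitian p x₁ x₂), Finset.prod_eq_zero_iff] at h
  obtain ⟨k, -, hk⟩ := h
  exact ⟨_, eigenvalues_mem_bands p x₁ x₂ k, sub_eq_zero.1 hk⟩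

lemma bands_nonempty (p : ZMod q) : (bands p).Nonempty :=
  ⟨_, eigenvalues_mem_bands p 0 0 0⟩

lemma abs_le_of_mem_bands {p : ZMod q} {E : ℝ} (hE : E ∈ bands p) : |E| ≤ 4 := by
  obtain ⟨x₁, x₂, h⟩ := hE
  have h1 := spectrum.norm_le_norm_of_mem (mem_spectrum_iff_det_eq_zero.2 h)
  have h2 := norm_harper_le p x₁ x₂
  simp only [Complex.ofReal_im, abs_zero, Real.exp_zero, Complex.norm_real, Real.norm_eq_abs]
    at h1 h2
  linarith

lemma isUnit_harper_of_dist {p : ZMod q} {ζ : ℂ} {ρ : ℝ} (hρ : 0 < ρ)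
    (h : ∀ E ∈ bands p, ρ ≤ ‖ζ - (E : ℝ)‖) (x₁ x₂ : ℝ) :
    IsUnit (ζ • 1 - harper p x₁ x₂) ∧ ‖(ζ • 1 - harper p x₁ x₂)⁻¹‖ ≤ ρ⁻¹ := by
  refine isUnit_and_norm_inv_le (harper_isHermitian p x₁ x₂) hρ fun z hz => ?_
  obtain ⟨E, hE, rfl⟩ := exists_mem_bands_of_det_eq_zero hz
  exact h E hE

end Bands
end CritAM

namespace CritAM

open scoped Matrix ComplexOrder Matrix.Norms.L2Operator

lemma norm_exp_pow_of_real (q : ℕ) (x : ℝ) : ‖Complex.exp (Complex.I * x) ^ q‖ = 1 ∧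
    ‖Complex.exp (-(Complex.I * x)) ^ q‖ = 1 := by
  constructor <;> simp [Complex.norm_exp]

section CharDet
variable {q : ℕ} [NeZero q]

/-- The characteristic determinant of the Bloch fibre at the origin. -/
noncomputable def charDet (p : ZMod q) (ζ : ℂ) : ℂ := (ζ • 1 - harper p 0 0).det

/-- The eigenvalues of the Bloch fibre at the origin. -/
noncomputable def eig (p : ZMod q) (k : ZMod q) : ℝ := (harper_isHermitian p 0 0).eigenvalues k

lemma eig_mem_bands (p k : ZMod q) : eig p k ∈ bands p := eigenvalues_mem_bands p 0 0 k

lemma charDet_eq_prod (p : ZMod q) (ζ : ℂ) : charDet p ζ = ∏ k, (ζ - eig p k) := by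
  have h := det_smul_one_sub_eq_prod (harper_isHermitian p 0 0) ζ
  simp only [Complex.ofReal_zero] at h
  exact h

lemma differentiable_charDet (p : ZMod q) : Differentiable ℂ (charDet p) := by
  have : charDet p = fun ζ => ∏ k, (ζ - (eig p k : ℂ)) := funext (charDet_eq_prod p)
  rw [this]
  fun_prop

lemma norm_charDet (p : ZMod q) (ζ : ℂ) : ‖charDet p ζ‖ = ∏ k, ‖ζ - eig p k‖ := by
  rw [charDet_eq_prod, norm_prod]

lemma normSq_vertical (E η d : ℝ) :
    ‖(E : ℂ) + η * Complex.I - d‖ ^ 2 = (E - d) ^ 2 + η ^ 2 := by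
  rw [Complex.sq_norm, Complex.normSq_apply]
  simp
  ring

lemma norm_vertical_le {E η η' d : ℝ} (h : |η| ≤ |η'|) :
    ‖(E : ℂ) + η * Complex.I - d‖ ≤ ‖(E : ℂ) + η' * Complex.I - d‖ := by
  refine le_of_sq_le_sq ?_ (norm_nonneg _)
  rw [normSq_vertical, normSq_vertical]
  have := sq_le_sq.2 h
  linarith

lemma norm_vertical_lt {E η η' d : ℝ} (h : |η| < |η'|) :
    ‖(E : ℂ) + η * Complex.I - d‖ < ‖(E : ℂ) + η' * Complex.I - d‖ := by
  refine lt_of_pow_lt_pow_left₀ 2 (norm_nonneg _) ?_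
  rw [normSq_vertical, normSq_vertical]
  have := sq_lt_sq.2 h
  linarith

lemma norm_charDet_vertical_le (p : ZMod q) {E η η' : ℝ} (h : |η| ≤ |η'|) :
    ‖charDet p (E + η * Complex.I)‖ ≤ ‖charDet p (E + η' * Complex.I)‖ := by
  rw [norm_charDet, norm_charDet]
  exact Finset.prod_le_prod (fun _ _ => norm_nonneg _) fun k _ => norm_vertical_le h

lemma norm_charDet_vertical_lt (p : ZMod q) {E η η' : ℝ} (h : |η| < |η'|) :
    ‖charDet p (E + η * Complex.I)‖ < ‖charDet p (E + η' * Complex.I)‖ := by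
  have hpos : ∀ k, 0 < ‖(E : ℂ) + η' * Complex.I - eig p k‖ := fun k =>
    (norm_nonneg _).trans_lt (norm_vertical_lt h)
  by_cases h0 : charDet p (E + η * Complex.I) = 0
  · rw [h0, norm_zero, norm_charDet]
    exact Finset.prod_pos fun k _ => hpos k
  · rw [norm_charDet, norm_charDet]
    refine Finset.prod_lt_prod_of_nonempty (fun k _ => ?_) (fun k _ => norm_vertical_lt h)
      Finset.univ_nonempty
    refine norm_pos_iff.2 fun hk => h0 ?_
    rw [charDet_eq_prod]
    exact Finset.prod_eq_zero (Finset.mem_univ k) hk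

lemma norm_charDet_le_pow {p : ZMod q} {ζ : ℂ} {R : ℝ} (h : ‖ζ‖ + 4 ≤ R) :
    ‖charDet p ζ‖ ≤ R ^ q := by
  rw [norm_charDet]
  refine (Finset.prod_le_prod (g := fun _ => R) (fun _ _ => norm_nonneg _)
    fun k _ => ?_).trans_eq ?_
  · refine (norm_sub_le _ _).trans (le_trans ?_ h)
    have := abs_le_of_mem_bands (eig_mem_bands p k)
    rw [Complex.norm_real, Real.norm_eq_abs]
    linarith
  · rw [Finset.prod_const, Finset.card_univ, ZMod.card]

lemma norm_charDet_sub_det_le {p r : ZMod q} (hr : p * r = 1) (ζ : ℂ) (x₁ x₂ : ℝ) :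
    ‖charDet p ζ - (ζ • 1 - harper p x₁ x₂).det‖ ≤ 8 := by
  obtain ⟨a, a', b, b', ha, ha', hb, hb', h⟩ := exists_chambers hr
  obtain ⟨c, hc⟩ := h ζ
  have h0 := hc 0 0
  have key : ∀ u v : ℂ, ‖u‖ = 1 → ‖v‖ = 1 → ‖u * (1 - v)‖ ≤ 2 := by
    intro u v hu hv
    rw [norm_mul, hu, one_mul]
    refine (norm_sub_le _ _).trans ?_
    rw [hv, norm_one]; norm_num
  obtain ⟨e1, e2⟩ := norm_exp_pow_of_real q x₁
  obtain ⟨e3, e4⟩ := norm_exp_pow_of_real q x₂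
  have : charDet p ζ - (ζ • 1 - harper p x₁ x₂).det
      = (a * (1 - Complex.exp (Complex.I * x₁) ^ q)
          + a' * (1 - Complex.exp (-(Complex.I * x₁)) ^ q))
      + (b * (1 - Complex.exp (Complex.I * x₂) ^ q)
        + b' * (1 - Complex.exp (-(Complex.I * x₂)) ^ q)) := by
    rw [charDet, h0, hc]
    simp only [mul_zero, neg_zero, Complex.exp_zero, one_pow]
    ring
  rw [this]
  refine (norm_add_le _ _).trans ?_
  have f1 := norm_add_le (a * (1 - Complex.exp (Complex.I * x₁) ^ q))
    (a' * (1 - Complex.exp (-(Complex.I * x₁)) ^ q))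
  have f2 := norm_add_le (b * (1 - Complex.exp (Complex.I * x₂) ^ q))
    (b' * (1 - Complex.exp (-(Complex.I * x₂)) ^ q))
  linarith [key a _ ha e1, key a' _ ha' e2, key b _ hb e3, key b' _ hb' e4]

lemma norm_charDet_le_of_mem_bands {p r : ZMod q} (hr : p * r = 1) {E : ℝ} (hE : E ∈ bands p) :
    ‖charDet p E‖ ≤ 8 := by
  obtain ⟨x₁, x₂, h⟩ := hE
  have := norm_charDet_sub_det_le hr E x₁ x₂
  rwa [h, sub_zero] at this

lemma exists_one_le_norm_charDet {p r : ZMod q} (hr : p * r = 1) :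
    ∃ E ∈ bands p, 1 ≤ ‖charDet p E‖ := by
  obtain ⟨a, a', b, b', ha, ha', hb, hb', h⟩ := exists_chambers hr
  have hq : (q : ℂ) ≠ 0 := Nat.cast_ne_zero.2 (NeZero.ne q)
  have hpow : ∀ x : ℝ, Complex.exp (Complex.I * ((x / q : ℝ) : ℂ)) ^ q = Complex.exp (x * Complex.I)
      ∧ Complex.exp (-(Complex.I * ((x / q : ℝ) : ℂ))) ^ q = Complex.exp (-(x * Complex.I)) := by
    intro x
    rw [← Complex.exp_nat_mul, ← Complex.exp_nat_mul]
    constructor <;> congr 1 <;> push_cast <;> field_simp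
  have key : ∀ x : ℝ, ∃ E ∈ bands p, charDet p E
      = a * (1 - Complex.exp (x * Complex.I)) + a' * (1 - Complex.exp (-(x * Complex.I))) := by
    intro x
    set k : ZMod q := 0
    refine ⟨_, eigenvalues_mem_bands p (x / q) 0 k, ?_⟩
    set E := (harper_isHermitian p (x / q) 0).eigenvalues k
    have hE : ((E : ℂ) • 1 - harper p ((x / q : ℝ) : ℂ) ((0 : ℝ) : ℂ)).det = 0 := by
      rw [det_smul_one_sub_eq_prod (harper_isHermitian p (x / q) 0)]
      exact Finset.prod_eq_zero (Finset.mem_univ k) (sub_self _)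
    obtain ⟨c, hc⟩ := h E
    rw [hc, (hpow x).1, (hpow x).2] at hE
    rw [charDet, hc]
    simp only [mul_zero, neg_zero, Complex.exp_zero, one_pow, Complex.ofReal_zero] at hE ⊢
    linear_combination hE
  obtain ⟨E₁, hE₁, h1⟩ := key π
  obtain ⟨E₂, hE₂, h2⟩ := key (π / 2)
  by_contra hcon
  push Not at hcon
  have g1 := hcon E₁ hE₁
  have g2 := hcon E₂ hE₂
  rw [h1, Complex.exp_neg, Complex.exp_pi_mul_I] at g1
  rw [h2, Complex.exp_neg] at g2
  push_cast at g2
  rw [Complex.exp_pi_div_two_mul_I, Complex.inv_I] at g2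
  have e1 : a * (1 - -1) + a' * (1 - (-1)⁻¹) = 2 * (a + a') := by norm_num; ring
  have e2 : a * (1 - Complex.I) + a' * (1 - -Complex.I)
      = (a + a') * (1 + Complex.I) - 2 * Complex.I * a := by ring
  rw [e1, norm_mul, Complex.norm_ofNat] at g1
  have h3 : ‖(a + a') * (1 + Complex.I)‖ ≤ 1 := by
    rw [norm_mul]
    have : ‖(1 : ℂ) + Complex.I‖ ≤ 2 := (norm_add_le _ _).trans (by norm_num)
    nlinarith [norm_nonneg (a + a')]
  have h4 : ‖2 * Complex.I * a‖ = 2 := by simp [ha]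
  rw [e2] at g2
  have h5 := norm_sub_norm_le (2 * Complex.I * a) ((a + a') * (1 + Complex.I))
  rw [norm_sub_rev] at h5
  linarith

lemma norm_harper_sub_le (p : ZMod q) {z₁ z₂ w₁ w₂ : ℂ} (h₁ : ‖w₁‖ ≤ 1) (h₂ : ‖w₂‖ ≤ 1) :
    ‖harper p (z₁ + w₁) (z₂ + w₂) - harper p z₁ z₂‖
      ≤ 4 * exp |z₁.im| * ‖w₁‖ + 4 * exp |z₂.im| * ‖w₂‖ := by
  have h1 : ∀ (z w : ℂ) (A B : Matrix (ZMod q) (ZMod q) ℂ), ‖w‖ ≤ 1 → ‖A‖ ≤ 1 → ‖B‖ ≤ 1 →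
      ‖(Complex.exp (Complex.I * (z + w)) • A + Complex.exp (-(Complex.I * (z + w))) • B)
        - (Complex.exp (Complex.I * z) • A + Complex.exp (-(Complex.I * z)) • B)‖
        ≤ 4 * exp |z.im| * ‖w‖ := by
    intro z w A B hw hA hB
    have e : (Complex.exp (Complex.I * (z + w)) • A + Complex.exp (-(Complex.I * (z + w))) • B)
        - (Complex.exp (Complex.I * z) • A + Complex.exp (-(Complex.I * z)) • B)
        = (Complex.exp (Complex.I * z) * (Complex.exp (Complex.I * w) - 1)) • A
          + (Complex.exp (-(Complex.I * z)) * (Complex.exp (-(Complex.I * w)) - 1)) • B := by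
      rw [mul_add, neg_add, Complex.exp_add, Complex.exp_add, mul_sub, mul_sub, sub_smul, sub_smul,
        mul_one, mul_one]
      abel
    rw [e]
    refine (norm_add_le _ _).trans ?_
    have e1 := norm_smul_le_of_norm_le_one hA
      (Complex.exp (Complex.I * z) * (Complex.exp (Complex.I * w) - 1))
    have e2 := norm_smul_le_of_norm_le_one hB
      (Complex.exp (-(Complex.I * z)) * (Complex.exp (-(Complex.I * w)) - 1))
    rw [norm_mul, norm_exp_I_mul] at e1
    rw [norm_mul, norm_exp_neg_I_mul] at e2
    have e3 := exp_le_exp.2 (neg_le_abs z.im)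
    have e4 := exp_le_exp.2 (le_abs_self z.im)
    have hw1 : ‖Complex.I * w‖ = ‖w‖ := by simp
    have e5 := Complex.norm_exp_sub_one_le (x := Complex.I * w) (by rwa [hw1])
    have e6 := Complex.norm_exp_sub_one_le (x := -(Complex.I * w)) (by rwa [norm_neg, hw1])
    rw [hw1] at e5
    rw [norm_neg, hw1] at e6
    have e7 := mul_le_mul e3 e5 (norm_nonneg _) (exp_pos _).le
    have e8 := mul_le_mul e4 e6 (norm_nonneg _) (exp_pos _).le
    linarith
  have e : ∀ a b c d : Matrix (ZMod q) (ZMod q) ℂ, a + b - (c + d) = (a - c) + (b - d) := by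
    intros; abel
  rw [harper, harper, e]
  refine (norm_add_le _ _).trans ?_
  have := h1 z₁ w₁ (phase p) (phase (-p)) h₁ (norm_phase_le _) (norm_phase_le _)
  have := h1 z₂ w₂ (shift 1) (shift (-1)) h₂ (norm_shift_le _) (norm_shift_le _)
  linarith

lemma isUnit_of_norm_sub_lt {M M' : Matrix (ZMod q) (ZMod q) ℂ} {ρ : ℝ} (hρ : 0 < ρ)
    (hM : IsUnit M) (hinv : ‖M⁻¹‖ ≤ ρ⁻¹) (h : ‖M' - M‖ < ρ) : IsUnit M' := by
  obtain ⟨u, rfl⟩ := hM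
  rw [← Matrix.coe_units_inv] at hinv
  have hpos : 0 < ‖(↑u⁻¹ : Matrix (ZMod q) (ZMod q) ℂ)‖ := Units.norm_pos _
  refine ⟨u.ofNearby M' (h.trans_le ?_), rfl⟩
  rw [le_inv_comm₀ hρ hpos]
  exact hinv

lemma norm_charDet_ge {p r : ZMod q} (hr : p * r = 1) {ζ : ℂ} {ρ : ℝ} (hρ : 0 < ρ) (hρ1 : ρ ≤ 1)
    (h : ∀ E ∈ bands p, ρ ≤ ‖ζ - (E : ℝ)‖) : exp (q * (ρ / 16)) - 3 ≤ ‖charDet p ζ‖ := by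
  obtain ⟨a, a', b, b', ha, ha', hb, hb', hch⟩ := exists_chambers hr
  obtain ⟨c, hc⟩ := hch ζ
  have hq : (q : ℂ) ≠ 0 := Nat.cast_ne_zero.2 (NeZero.ne q)
  have hq' : (0 : ℝ) < q := Nat.cast_pos.2 (NeZero.pos q)
  have ha0 : a ≠ 0 := norm_pos_iff.1 (by rw [ha]; exact one_pos)
  have ha'0 : a' ≠ 0 := norm_pos_iff.1 (by rw [ha']; exact one_pos)
  set C := c + b + b' with hC
  obtain ⟨s, hs⟩ := IsAlgClosed.exists_eq_mul_self (C ^ 2 - 4 * a * a')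
  obtain ⟨X, hX, hX1⟩ : ∃ X : ℂ, a * X ^ 2 + C * X + a' = 0 ∧ 1 ≤ ‖X‖ := by
    have h1 : ∀ t : ℂ, t ^ 2 = s * s →
        a * ((-C + t) / (2 * a)) ^ 2 + C * ((-C + t) / (2 * a)) + a' = 0 := by
      intro t ht
      rw [← hs] at ht
      field_simp
      linear_combination ht
    have h2 : ((-C + s) / (2 * a)) * ((-C + -s) / (2 * a)) = a' / a := by
      field_simp
      linear_combination hs
    have h3 : ‖(-C + s) / (2 * a)‖ * ‖(-C + -s) / (2 * a)‖ = 1 := by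
      rw [← norm_mul, h2, norm_div, ha, ha', div_one]
    by_cases h4 : 1 ≤ ‖(-C + s) / (2 * a)‖
    · exact ⟨_, h1 s (sq s), h4⟩
    · refine ⟨_, h1 (-s) (by ring), ?_⟩
      push Not at h4
      by_contra h5
      push Not at h5
      have := mul_lt_one_of_nonneg_of_lt_one_left (norm_nonneg _) h4 h5.le
      linarith
  have hX0 : X ≠ 0 := norm_pos_iff.1 (one_pos.trans_le hX1)
  have hXbig : exp (q * (ρ / 16)) ≤ ‖X‖ := by
    by_contra hlt
    push Not at hlt
    set z := Complex.log X / (q * Complex.I) with hz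
    have hIz : Complex.I * z = Complex.log X / q := by
      rw [hz]; field_simp
    have hzX : Complex.exp (Complex.I * z) ^ q = X := by
      rw [← Complex.exp_nat_mul, hIz, mul_div_cancel₀ _ hq, Complex.exp_log hX0]
    have hzX' : Complex.exp (-(Complex.I * z)) ^ q = X⁻¹ := by
      rw [Complex.exp_neg, inv_pow, hzX]
    have him : |z.im| ≤ ρ / 16 := by
      have e1 : z.im = -(log ‖X‖ / q) := by
        have : (Complex.I * z).re = -z.im := by simp
        have e2 : (Complex.log X / q).re = log ‖X‖ / q := by
          rw [← Complex.log_re, ← Complex.ofReal_natCast, Complex.div_ofReal_re]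
        rw [hIz, e2] at this
        linarith
      rw [e1, abs_neg, abs_of_nonneg (div_nonneg (Real.log_nonneg hX1) hq'.le),
        div_le_iff₀ hq', mul_comm, ← Real.log_exp (q * (ρ / 16))]
      exact Real.log_le_log (one_pos.trans_le hX1) hlt.le
    obtain ⟨hu, hinv⟩ := isUnit_harper_of_dist hρ h z.re 0
    have hw : ‖Complex.I * (z.im : ℂ)‖ = |z.im| := by simp
    have hunit : IsUnit (ζ • 1 - harper p z 0) := by
      refine isUnit_of_norm_sub_lt hρ hu hinv ?_
      have e := norm_harper_sub_le p (z₁ := (z.re : ℂ)) (z₂ := 0) (w₁ := Complex.I * (z.im : ℂ))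
        (w₂ := 0) (by rw [hw]; linarith) (by simp)
      rw [hw, mul_comm Complex.I, Complex.re_add_im, add_zero] at e
      rw [sub_sub_sub_cancel_left, norm_sub_rev]
      simp only [Complex.ofReal_im, abs_zero, Real.exp_zero, norm_zero, mul_zero, add_zero,
        mul_one, Complex.ofReal_zero] at e ⊢
      linarith
    rw [Matrix.isUnit_iff_isUnit_det, isUnit_iff_ne_zero] at hunit
    apply hunit
    rw [hc, hzX, hzX']
    simp only [mul_zero, neg_zero, Complex.exp_zero, one_pow, mul_one]
    have : X * (c + (a * X + a' * X⁻¹) + (b + b')) = 0 := by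
      rw [← hX, hC]
      field_simp
      ring
    exact (mul_eq_zero.1 this).resolve_left hX0
  have hD : charDet p ζ = C + (a + a') := by
    rw [charDet, hc, hC]
    simp only [mul_zero, neg_zero, Complex.exp_zero, one_pow, mul_one]
    ring
  have hCX : -C = a * X + a' * X⁻¹ := by
    have : X * (-C) = X * (a * X + a' * X⁻¹) := by
      field_simp
      linear_combination -hX
    exact mul_left_cancel₀ hX0 this
  have h6 : ‖X‖ - 1 ≤ ‖C‖ := by
    rw [← norm_neg C, hCX]
    have e1 : ‖a' * X⁻¹‖ ≤ 1 := by
      rw [norm_mul, ha', one_mul, norm_inv]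
      exact inv_le_one_of_one_le₀ hX1
    have e2 : ‖a * X‖ = ‖X‖ := by rw [norm_mul, ha, one_mul]
    have e3 := norm_sub_norm_le (a * X) (-(a' * X⁻¹))
    rw [norm_neg, sub_neg_eq_add] at e3
    linarith
  have h7 : ‖C‖ - 2 ≤ ‖charDet p ζ‖ := by
    have e1 : ‖a + a'‖ ≤ 2 := (norm_add_le _ _).trans (by rw [ha, ha']; norm_num)
    have e3 := norm_sub_norm_le C (-(a + a'))
    rw [norm_neg, sub_neg_eq_add, ← hD] at e3
    linarith
  linarith

end CharDet

end CritAM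

namespace CritAM

open scoped Matrix ComplexOrder Matrix.Norms.L2Operator

section Growth
variable {q : ℕ} [NeZero q]

/-- The maximum of the characteristic determinant at height `ρ` above the `ρ`-neighbourhood of
the bands. -/
noncomputable def growth (p : ZMod q) (ρ : ℝ) : ℝ :=
  sSup ((fun E : ℝ => ‖charDet p (E + ρ * Complex.I)‖) '' {E | Metric.infDist E (bands p) ≤ ρ})

lemma exists_mem_bands_abs_sub_lt {p : ZMod q} {E ρ ρ' : ℝ}
    (hE : Metric.infDist E (bands p) ≤ ρ) (h : ρ < ρ') : ∃ E' ∈ bands p, |E - E'| < ρ' := by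
  obtain ⟨E', hE', h'⟩ := (Metric.infDist_lt_iff (bands_nonempty p)).1 (hE.trans_lt h)
  exact ⟨E', hE', by rwa [Real.dist_eq] at h'⟩

lemma abs_le_of_infDist_le {p : ZMod q} {E ρ : ℝ} (hE : Metric.infDist E (bands p) ≤ ρ) :
    |E| ≤ 4 + ρ := by
  refine le_of_forall_gt_imp_ge_of_dense fun a ha => ?_
  obtain ⟨E', hE', h⟩ := exists_mem_bands_abs_sub_lt hE (show ρ < a - 4 by linarith)
  have := abs_le_of_mem_bands hE'
  have := abs_sub_abs_le_abs_sub E E'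
  linarith

lemma isCompact_infDist_le (p : ZMod q) (ρ : ℝ) :
    IsCompact {E | Metric.infDist E (bands p) ≤ ρ} := by
  refine (isCompact_Icc (a := -(4 + ρ)) (b := 4 + ρ)).of_isClosed_subset ?_ fun E hE => ?_
  · exact isClosed_le (Metric.continuous_infDist_pt _) continuous_const
  · exact abs_le.1 (abs_le_of_infDist_le hE)

lemma continuous_norm_charDet_vertical (p : ZMod q) (ρ : ℝ) :
    Continuous fun E : ℝ => ‖charDet p (E + ρ * Complex.I)‖ :=
  ((differentiable_charDet p).continuous.comp (by fun_prop)).norm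

lemma exists_eq_growth (p : ZMod q) {ρ : ℝ} (hρ : 0 ≤ ρ) :
    ∃ E, Metric.infDist E (bands p) ≤ ρ ∧ ‖charDet p (E + ρ * Complex.I)‖ = growth p ρ := by
  obtain ⟨E₀, hE₀⟩ := bands_nonempty p
  obtain ⟨E, hE, h⟩ := (isCompact_infDist_le p ρ).exists_sSup_image_eq
    ⟨E₀, by rw [Set.mem_ofPred_eq, Metric.infDist_zero_of_mem hE₀]; exact hρ⟩
    (continuous_norm_charDet_vertical p ρ).continuousOn
  exact ⟨E, hE, h.symm⟩

lemma norm_charDet_le_growth {p : ZMod q} {E η ρ : ℝ} (hE : Metric.infDist E (bands p) ≤ ρ)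
    (hη : |η| ≤ ρ) : ‖charDet p (E + η * Complex.I)‖ ≤ growth p ρ := by
  refine (norm_charDet_vertical_le p (hη.trans (le_abs_self ρ))).trans ?_
  exact le_csSup ((isCompact_infDist_le p ρ).image
    (continuous_norm_charDet_vertical p ρ)).bddAbove ⟨E, hE, rfl⟩

lemma norm_charDet_lt_growth {p : ZMod q} {ζ : ℂ} {ρ E : ℝ} (hE : E ∈ bands p)
    (h : ‖ζ - E‖ < ρ) : ‖charDet p ζ‖ < growth p ρ := by
  have h1 : |ζ.im| < |ρ| := by
    refine lt_of_lt_of_le ?_ (le_abs_self ρ)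
    have := Complex.abs_im_le_norm (ζ - E)
    simp only [Complex.sub_im, Complex.ofReal_im, sub_zero] at this
    linarith
  have h2 : Metric.infDist ζ.re (bands p) ≤ ρ := by
    refine (Metric.infDist_le_dist_of_mem hE).trans ?_
    have := Complex.abs_re_le_norm (ζ - E)
    simp only [Complex.sub_re, Complex.ofReal_re] at this
    rw [Real.dist_eq]
    linarith
  have h3 := norm_charDet_vertical_lt p (E := ζ.re) h1
  rw [Complex.re_add_im] at h3
  refine h3.trans_le (norm_charDet_le_growth h2 (abs_of_nonneg ?_).le)
  exact (norm_nonneg _).trans h.le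

lemma le_norm_sub_of_growth_le {p : ZMod q} {ζ : ℂ} {ρ : ℝ} (h : growth p ρ ≤ ‖charDet p ζ‖) :
    ∀ E ∈ bands p, ρ ≤ ‖ζ - (E : ℝ)‖ := by
  intro E hE
  by_contra hlt
  push Not at hlt
  exact (norm_charDet_lt_growth hE hlt).not_ge h

lemma one_le_growth {p r : ZMod q} (hr : p * r = 1) {ρ : ℝ} (hρ : 0 ≤ ρ) : 1 ≤ growth p ρ := by
  obtain ⟨E, hE, h⟩ := exists_one_le_norm_charDet hr
  refine h.trans ?_
  have := norm_charDet_le_growth (p := p) (E := E) (η := 0) (ρ := ρ)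
    (by rw [Metric.infDist_zero_of_mem hE]; exact hρ) (by simpa using hρ)
  simpa using this

lemma growth_zero_le {p r : ZMod q} (hr : p * r = 1) : growth p 0 ≤ 8 := by
  obtain ⟨E, hE, hEq⟩ := exists_eq_growth p le_rfl
  rw [← hEq, Complex.ofReal_zero, zero_mul, add_zero]
  have hcl : E ∈ closure (bands p) := by
    rw [Metric.mem_closure_iff_infDist_zero (bands_nonempty p)]
    exact le_antisymm hE Metric.infDist_nonneg
  refine closure_minimal (t := {E : ℝ | ‖charDet p E‖ ≤ 8})
    (fun E hE => norm_charDet_le_of_mem_bands hr hE) ?_ hcl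
  exact isClosed_le ((differentiable_charDet p).continuous.comp
    Complex.continuous_ofReal).norm continuous_const

lemma growth_le_pow (p : ZMod q) {ρ : ℝ} (hρ : 0 ≤ ρ) (hρ1 : ρ ≤ 1) : growth p ρ ≤ 10 ^ q := by
  obtain ⟨E, hE, hEq⟩ := exists_eq_growth p hρ
  rw [← hEq]
  refine norm_charDet_le_pow ?_
  have := abs_le_of_infDist_le hE
  have h1 := norm_add_le (E : ℂ) (ρ * Complex.I)
  rw [norm_mul, Complex.norm_I, mul_one, Complex.norm_real, Complex.norm_real, Real.norm_eq_abs,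
    Real.norm_eq_abs, abs_of_nonneg hρ] at h1
  linarith

lemma exists_growth_le (p : ZMod q) :
    ∃ C : ℝ, 0 ≤ C ∧ ∀ ρ, 0 < ρ → ρ ≤ 1 → growth p ρ ≤ growth p 0 + C * ρ := by
  have hcd : Continuous (deriv (charDet p)) :=
    ((differentiable_charDet p).contDiff (n := 1)).continuous_deriv le_rfl
  obtain ⟨C, hC⟩ := (isCompact_closedBall (0 : ℂ) 10).exists_bound_of_continuousOn
    hcd.continuousOn
  have hC0 : 0 ≤ C := (norm_nonneg _).trans (hC 0 (by simp))
  refine ⟨C * 3, by positivity, fun ρ hρ hρ1 => ?_⟩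
  obtain ⟨E, hE, hEq⟩ := exists_eq_growth p hρ.le
  obtain ⟨E', hE', hEE'⟩ := exists_mem_bands_abs_sub_lt hE (show ρ < 2 * ρ by linarith)
  have h1 := norm_charDet_le_growth (p := p) (E := E') (η := 0) (ρ := 0)
    (by rw [Metric.infDist_zero_of_mem hE']) (by simp)
  rw [Complex.ofReal_zero, zero_mul, add_zero] at h1
  have hE1 := abs_le_of_infDist_le hE
  have hE'1 := abs_le_of_mem_bands hE'
  have hmem1 : (E : ℂ) + ρ * Complex.I ∈ Metric.closedBall (0 : ℂ) 10 := by
    rw [mem_closedBall_zero_iff]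
    refine (norm_add_le _ _).trans ?_
    rw [norm_mul, Complex.norm_I, mul_one, Complex.norm_real, Complex.norm_real, Real.norm_eq_abs,
      Real.norm_eq_abs, abs_of_pos hρ]
    linarith
  have hmem2 : (E' : ℂ) ∈ Metric.closedBall (0 : ℂ) 10 := by
    rw [mem_closedBall_zero_iff, Complex.norm_real, Real.norm_eq_abs]
    linarith
  have h2 := (convex_closedBall (0 : ℂ) 10).norm_image_sub_le_of_norm_deriv_le
    (fun x _ => (differentiable_charDet p) x) hC hmem2 hmem1
  have h3 : ‖(E : ℂ) + ρ * Complex.I - E'‖ ≤ 3 * ρ := by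
    have : (E : ℂ) + ρ * Complex.I - E' = ((E - E' : ℝ) : ℂ) + ρ * Complex.I := by
      push_cast; ring
    rw [this]
    refine (norm_add_le _ _).trans ?_
    rw [norm_mul, Complex.norm_I, mul_one, Complex.norm_real, Complex.norm_real, Real.norm_eq_abs,
      Real.norm_eq_abs, abs_of_pos hρ]
    linarith
  have h4 := norm_sub_norm_le (charDet p (E + ρ * Complex.I)) (charDet p E')
  rw [hEq] at h4
  have h5 := mul_le_mul_of_nonneg_left h3 hC0
  linarith

end Growth

end CritAM

namespace CritAM

open scoped Matrix ComplexOrder Matrix.Norms.L2Operator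

section Inverse
variable {n : Type*} [Fintype n] [DecidableEq n]

lemma continuousAt_matrix_inv {A : Matrix n n ℂ} (hA : IsUnit A) :
    ContinuousAt (fun B : Matrix n n ℂ => B⁻¹) A := by
  obtain ⟨u, rfl⟩ := hA
  have := NormedRing.inverse_continuousAt u
  refine this.congr (Filter.Eventually.of_forall fun B => ?_)
  exact (Matrix.nonsing_inv_eq_ringInverse B).symm

lemma differentiableAt_matrix_inv {A : Matrix n n ℂ} (hA : IsUnit A) :
    DifferentiableAt ℂ (fun B : Matrix n n ℂ => B⁻¹) A := by
  obtain ⟨u, rfl⟩ := hA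
  have : (fun B : Matrix n n ℂ => B⁻¹) = Ring.inverse :=
    funext Matrix.nonsing_inv_eq_ringInverse
  rw [this]
  exact differentiableAt_inverse u.isUnit

/-- A compact set on which a point always has a neighbourhood inside the set is empty. -/
lemma eq_empty_of_isCompact_of_mem_nhds {M : Set ℂ} (hM : IsCompact M)
    (h : ∀ ζ ∈ M, M ∈ nhds ζ) : M = ∅ := by
  have hopen : IsOpen M := isOpen_iff_mem_nhds.2 h
  rcases isClopen_iff.1 ⟨hM.isClosed, hopen⟩ with h | h
  · exact h
  · rw [h] at hM
    exact absurd hM (noncompact_univ ℂ)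

end Inverse

section ResolventBound
variable {q : ℕ} [NeZero q]

/-- The width of the strip in which the resolvent is controlled. -/
noncomputable def stripWidth (p : ZMod q) (ρ : ℝ) (ζ : ℂ) : ℝ :=
  (log ‖charDet p ζ‖ - log (growth p ρ)) / q

/-- The region outside the `ρ`-neighbourhood of the bands in which the resolvent is controlled. -/
def outer (p : ZMod q) (ρ : ℝ) : Set ℂ := {ζ | ‖ζ‖ ≤ 30 ∧ growth p ρ ≤ ‖charDet p ζ‖}

lemma isCompact_outer (p : ZMod q) (ρ : ℝ) : IsCompact (outer p ρ) := by
  refine (isCompact_closedBall (0 : ℂ) 30).of_isClosed_subset ?_ fun ζ hζ => ?_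
  · exact (isClosed_le continuous_norm continuous_const).inter
      (isClosed_le continuous_const (differentiable_charDet p).continuous.norm)
  · rw [mem_closedBall_zero_iff]; exact hζ.1

lemma charDet_ne_zero_of_mem_outer {p : ZMod q} {ρ : ℝ} (hS : 1 ≤ growth p ρ) {ζ : ℂ}
    (hζ : ζ ∈ outer p ρ) : charDet p ζ ≠ 0 :=
  norm_pos_iff.1 (one_pos.trans_le (hS.trans hζ.2))

lemma continuousOn_stripWidth {p : ZMod q} {ρ : ℝ} (hS : 1 ≤ growth p ρ) :
    ContinuousOn (stripWidth p ρ) (outer p ρ) := by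
  refine ((ContinuousOn.log (differentiable_charDet p).continuous.norm.continuousOn
    fun ζ hζ => ?_).sub continuousOn_const).div_const _
  exact norm_ne_zero_iff.2 (charDet_ne_zero_of_mem_outer hS hζ)

lemma stripWidth_nonneg {p : ZMod q} {ρ : ℝ} (hS : 1 ≤ growth p ρ) {ζ : ℂ}
    (hζ : ζ ∈ outer p ρ) : 0 ≤ stripWidth p ρ ζ :=
  div_nonneg (sub_nonneg.2 (Real.log_le_log (one_pos.trans_le hS) hζ.2)) (Nat.cast_nonneg _)

lemma exp_stripWidth_le {p : ZMod q} {ρ : ℝ} (hS : 1 ≤ growth p ρ) {ζ : ℂ}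
    (hζ : ζ ∈ outer p ρ) : exp (stripWidth p ρ ζ) ≤ 34 := by
  have hq' : (0 : ℝ) < q := Nat.cast_pos.2 (NeZero.pos q)
  rw [← Real.le_log_iff_exp_le (by norm_num), stripWidth, div_le_iff₀ hq']
  have h1 := Real.log_le_log (norm_pos_iff.2 (charDet_ne_zero_of_mem_outer hS hζ))
    (norm_charDet_le_pow (p := p) (ζ := ζ) (R := 34) (by linarith [hζ.1]))
  rw [Real.log_pow] at h1
  have h2 := Real.log_nonneg hS
  linarith

lemma exp_half_stripWidth_lt {p : ZMod q} {ρ : ℝ} (hS : 1 ≤ growth p ρ) {ζ : ℂ}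
    (hζ : ζ ∈ outer p ρ) {c : ℝ} (hc : |c| ≤ 1 / 2) : exp |c * stripWidth p ρ ζ| ≤ 5.9 := by
  have hV := stripWidth_nonneg hS hζ
  have h1 : exp |c * stripWidth p ρ ζ| ≤ exp (stripWidth p ρ ζ / 2) := by
    rw [exp_le_exp, abs_mul, abs_of_nonneg hV]
    nlinarith
  have h2 : exp (stripWidth p ρ ζ / 2) ^ 2 ≤ 34 := by
    rw [← Real.exp_nat_mul]
    refine le_trans (le_of_eq ?_) (exp_stripWidth_le hS hζ)
    congr 1; push_cast; ring
  refine h1.trans (le_of_sq_le_sq ?_ (by norm_num))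
  linarith

lemma exists_harper_eq_Icc (p : ZMod q) (x₁ x₂ y₁ y₂ : ℝ) :
    ∃ x₁' ∈ Set.Icc 0 (2 * π), ∃ x₂' ∈ Set.Icc 0 (2 * π),
      harper p (x₁ + y₁ * Complex.I) (x₂ + y₂ * Complex.I)
        = harper p ((x₁' : ℝ) + y₁ * Complex.I) ((x₂' : ℝ) + y₂ * Complex.I) := by
  have h1 : ∀ z₂, Function.Periodic (fun x : ℝ => harper p (x + y₁ * Complex.I) z₂) (2 * π) := by
    intro z₂ x
    change harper p (((x + 2 * π : ℝ) : ℂ) + y₁ * Complex.I) z₂ = harper p (x + y₁ * Complex.I) z₂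
    rw [← harper_add_two_pi_left p ((x : ℂ) + y₁ * Complex.I)]
    congr 1; push_cast; ring
  have h2 : ∀ z₁, Function.Periodic (fun x : ℝ => harper p z₁ (x + y₂ * Complex.I)) (2 * π) := by
    intro z₁ x
    change harper p z₁ (((x + 2 * π : ℝ) : ℂ) + y₂ * Complex.I) = harper p z₁ (x + y₂ * Complex.I)
    rw [← harper_add_two_pi_right p z₁ ((x : ℂ) + y₂ * Complex.I)]
    congr 1; push_cast; ring
  obtain ⟨a, ha, hae⟩ := (h1 (x₂ + y₂ * Complex.I)).exists_mem_Ico₀ two_pi_pos x₁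
  obtain ⟨b, hb, hbe⟩ := (h2 (a + y₁ * Complex.I)).exists_mem_Ico₀ two_pi_pos x₂
  exact ⟨a, Set.Ico_subset_Icc_self ha, b, Set.Ico_subset_Icc_self hb, hae.trans hbe⟩

/-- The pencil evaluated on the edge of a strip of width proportional to `stripWidth`. -/
noncomputable def edgePencil (p : ZMod q) (ρ c₁ c₂ : ℝ) (ζ : ℂ) (x₁ x₂ : ℝ) :
    Matrix (ZMod q) (ZMod q) ℂ :=
  ζ • 1 - harper p (x₁ + (c₁ * stripWidth p ρ ζ : ℝ) * Complex.I)
    (x₂ + (c₂ * stripWidth p ρ ζ : ℝ) * Complex.I)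

lemma norm_inv_edgePencil_le_of_norm_eq {p : ZMod q} {ρ c₁ c₂ : ℝ} (hS : 1 ≤ growth p ρ)
    (hc₁ : |c₁| ≤ 1 / 2) (hc₂ : |c₂| ≤ 1 / 2) {ζ : ℂ} (hζ : ζ ∈ outer p ρ) (h30 : ‖ζ‖ = 30)
    {x₁ x₂ : ℝ} (hu : IsUnit (edgePencil p ρ c₁ c₂ ζ x₁ x₂)) :
    ‖(edgePencil p ρ c₁ c₂ ζ x₁ x₂)⁻¹‖ ≤ 1 := by
  set R := (edgePencil p ρ c₁ c₂ ζ x₁ x₂)⁻¹ with hR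
  have hmul : edgePencil p ρ c₁ c₂ ζ x₁ x₂ * R = 1 :=
    Matrix.mul_nonsing_inv _ ((Matrix.isUnit_iff_isUnit_det _).1 hu)
  set T := harper p (x₁ + (c₁ * stripWidth p ρ ζ : ℝ) * Complex.I)
    (x₂ + (c₂ * stripWidth p ρ ζ : ℝ) * Complex.I) with hT
  have hTn : ‖T‖ ≤ 24 := by
    refine (norm_harper_le _ _ _).trans ?_
    have h1 := exp_half_stripWidth_lt hS hζ hc₁
    have h2 := exp_half_stripWidth_lt hS hζ hc₂
    simp only [Complex.add_im, Complex.ofReal_im, Complex.mul_im, Complex.ofReal_re,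
      Complex.I_im, Complex.I_re, mul_one, mul_zero, zero_add, add_zero]
    linarith
  have h1 : ζ • R = 1 + T * R := by
    rw [edgePencil, sub_mul, Matrix.smul_mul, one_mul, ← hT] at hmul
    rw [← hmul]; abel
  have h2 := congrArg norm h1
  rw [norm_smul, h30] at h2
  have h3 := norm_add_le (1 : Matrix (ZMod q) (ZMod q) ℂ) (T * R)
  have h4 := Matrix.l2_opNorm_mul T R
  have h5 : ‖(1 : Matrix (ZMod q) (ZMod q) ℂ)‖ ≤ 1 :=
    norm_le_one_of_isometry (by rw [Matrix.conjTranspose_one, one_mul])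
  have h6 := mul_le_mul_of_nonneg_right hTn (norm_nonneg R)
  linarith

lemma norm_inv_edgePencil_le_of_growth_eq {p : ZMod q} {ρ c₁ c₂ : ℝ} (hρ : 0 < ρ) {ζ : ℂ}
    (h : growth p ρ = ‖charDet p ζ‖) (x₁ x₂ : ℝ) :
    ‖(edgePencil p ρ c₁ c₂ ζ x₁ x₂)⁻¹‖ ≤ ρ⁻¹ := by
  have hV : stripWidth p ρ ζ = 0 := by rw [stripWidth, h, sub_self, zero_div]
  rw [edgePencil, hV]
  simp only [mul_zero, Complex.ofReal_zero, zero_mul, add_zero]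
  exact (isUnit_harper_of_dist hρ (le_norm_sub_of_growth_le h.le) x₁ x₂).2

lemma continuousOn_inv_edgePencil {p : ZMod q} {ρ c₁ c₂ : ℝ} (hS : 1 ≤ growth p ρ)
    (hu : ∀ ζ ∈ outer p ρ, ∀ x₁ x₂, IsUnit (edgePencil p ρ c₁ c₂ ζ x₁ x₂)) :
    ContinuousOn (fun w : ℂ × ℝ × ℝ => (edgePencil p ρ c₁ c₂ w.1 w.2.1 w.2.2)⁻¹)
      {w | w.1 ∈ outer p ρ} := by
  have hV : ContinuousOn (fun w : ℂ × ℝ × ℝ => stripWidth p ρ w.1) {w | w.1 ∈ outer p ρ} :=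
    (continuousOn_stripWidth hS).comp continuousOn_fst fun w hw => hw
  have hE : ContinuousOn (fun w : ℂ × ℝ × ℝ => edgePencil p ρ c₁ c₂ w.1 w.2.1 w.2.2)
      {w | w.1 ∈ outer p ρ} := by
    refine ContinuousOn.sub (by fun_prop) ?_
    refine (continuous_harper p).comp_continuousOn (f := fun w : ℂ × ℝ × ℝ =>
      ((w.2.1 : ℂ) + (c₁ * stripWidth p ρ w.1 : ℝ) * Complex.I,
        (w.2.2 : ℂ) + (c₂ * stripWidth p ρ w.1 : ℝ) * Complex.I)) ?_
    have h1 : ContinuousOn (fun w : ℂ × ℝ × ℝ => ((c₁ * stripWidth p ρ w.1 : ℝ) : ℂ))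
        {w | w.1 ∈ outer p ρ} :=
      Complex.continuous_ofReal.comp_continuousOn (continuousOn_const.mul hV)
    have h2 : ContinuousOn (fun w : ℂ × ℝ × ℝ => ((c₂ * stripWidth p ρ w.1 : ℝ) : ℂ))
        {w | w.1 ∈ outer p ρ} :=
      Complex.continuous_ofReal.comp_continuousOn (continuousOn_const.mul hV)
    exact ContinuousOn.prodMk ((by fun_prop : ContinuousOn (fun w : ℂ × ℝ × ℝ => (w.2.1 : ℂ)) _).add
      (h1.mul continuousOn_const)) ((by fun_prop : ContinuousOn
        (fun w : ℂ × ℝ × ℝ => (w.2.2 : ℂ)) _).add (h2.mul continuousOn_const))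
  intro w hw
  have h1 := continuousAt_matrix_inv (hu w.1 hw w.2.1 w.2.2)
  have h2 := hE w hw
  exact ContinuousAt.comp_continuousWithinAt
    (g := fun B : Matrix (ZMod q) (ZMod q) ℂ => B⁻¹)
    (f := fun w : ℂ × ℝ × ℝ => edgePencil p ρ c₁ c₂ w.1 w.2.1 w.2.2) h1 h2

/-- The curve `ζ ↦ x + i c V(ζ)` extends to a holomorphic family up to a real translation. -/
lemma exists_edge_curve {p : ZMod q} {ρ : ℝ} (hS : 1 ≤ growth p ρ) {ζ₀ : ℂ}
    (h0 : growth p ρ < ‖charDet p ζ₀‖) (h30 : ‖ζ₀‖ < 30) (c₁ c₂ x₁ x₂ : ℝ) :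
    ∃ U : Set ℂ, IsOpen U ∧ ζ₀ ∈ U ∧ U ⊆ outer p ρ ∧ ∃ f : ℂ → Matrix (ZMod q) (ZMod q) ℂ,
      DifferentiableOn ℂ f U ∧ f ζ₀ = edgePencil p ρ c₁ c₂ ζ₀ x₁ x₂ ∧
      ∀ ζ ∈ U, ∃ x₁' x₂', f ζ = edgePencil p ρ c₁ c₂ ζ x₁' x₂' := by
  have hD0 : charDet p ζ₀ ≠ 0 := norm_pos_iff.1 (by linarith)
  have hDc := (differentiable_charDet p).continuous
  have hdiv : Continuous fun ζ => charDet p ζ / charDet p ζ₀ := hDc.div_const _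
  refine ⟨{ζ | growth p ρ < ‖charDet p ζ‖} ∩ {ζ | ‖ζ‖ < 30} ∩
    {ζ | charDet p ζ / charDet p ζ₀ ∈ Complex.slitPlane}, ?_, ⟨⟨h0, h30⟩, ?_⟩, ?_, ?_⟩
  · exact ((isOpen_lt continuous_const hDc.norm).inter (isOpen_lt continuous_norm
      continuous_const)).inter (Complex.isOpen_slitPlane.preimage hdiv)
  · rw [Set.mem_ofPred_eq, div_self hD0]; exact Complex.one_mem_slitPlane
  · rintro ζ ⟨⟨h1, h2⟩, -⟩; exact ⟨le_of_lt h2, le_of_lt h1⟩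
  set U := {ζ | growth p ρ < ‖charDet p ζ‖} ∩ {ζ | ‖ζ‖ < 30} ∩
    {ζ | charDet p ζ / charDet p ζ₀ ∈ Complex.slitPlane}
  let v : ℂ → ℂ := fun ζ => stripWidth p ρ ζ₀ + Complex.log (charDet p ζ / charDet p ζ₀) / q
  have hv : DifferentiableOn ℂ v U := by
    refine (differentiableOn_const _).add (DifferentiableOn.div_const ?_ _)
    exact DifferentiableOn.clog ((differentiable_charDet p).differentiableOn.div_const _)
      fun ζ hζ => hζ.2
  have hvre : ∀ ζ ∈ U, (v ζ).re = stripWidth p ρ ζ := by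
    rintro ζ ⟨⟨h1, -⟩, -⟩
    have e2 : (Complex.log (charDet p ζ / charDet p ζ₀) / q).re
        = log ‖charDet p ζ / charDet p ζ₀‖ / q := by
      rw [← Complex.log_re, ← Complex.ofReal_natCast, Complex.div_ofReal_re]
    have h1' : ‖charDet p ζ‖ ≠ 0 := by
      have : growth p ρ < ‖charDet p ζ‖ := h1
      linarith
    rw [Complex.add_re, e2, Complex.ofReal_re, norm_div,
      Real.log_div h1' (norm_ne_zero_iff.2 hD0), stripWidth, stripWidth]
    ring
  have hv0 : v ζ₀ = stripWidth p ρ ζ₀ := by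
    simp only [v, div_self hD0, Complex.log_one, zero_div, add_zero]
  refine ⟨fun ζ => ζ • 1 - harper p (x₁ + c₁ * v ζ * Complex.I) (x₂ + c₂ * v ζ * Complex.I),
    ?_, ?_, fun ζ hζ => ⟨x₁ - c₁ * (v ζ).im, x₂ - c₂ * (v ζ).im, ?_⟩⟩
  · refine DifferentiableOn.sub (by fun_prop) (differentiable_harper_comp p ?_ ?_)
    · exact (differentiableOn_const _).add (((differentiableOn_const _).mul hv).mul
        (differentiableOn_const _))
    · exact (differentiableOn_const _).add (((differentiableOn_const _).mul hv).mul
        (differentiableOn_const _))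
  · simp only [edgePencil, hv0, Complex.ofReal_mul]
  · have e : ∀ x c : ℝ, (x : ℂ) + c * v ζ * Complex.I
        = ((x - c * (v ζ).im : ℝ) : ℂ) + (c * stripWidth p ρ ζ : ℝ) * Complex.I := by
      intro x c
      rw [← hvre ζ hζ]
      conv_lhs => rw [← Complex.re_add_im (v ζ)]
      push_cast
      linear_combination (c * (v ζ).im : ℂ) * Complex.I_mul_I
    simp only [edgePencil, e]

lemma norm_inv_edgePencil_le {p : ZMod q} {ρ c₁ c₂ : ℝ} (hρ : 0 < ρ) (hρ1 : ρ ≤ 1)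
    (hS : 1 ≤ growth p ρ) (hc₁ : |c₁| ≤ 1 / 2) (hc₂ : |c₂| ≤ 1 / 2)
    (hu : ∀ ζ ∈ outer p ρ, ∀ x₁ x₂, IsUnit (edgePencil p ρ c₁ c₂ ζ x₁ x₂)) :
    ∀ ζ ∈ outer p ρ, ∀ x₁ x₂, ‖(edgePencil p ρ c₁ c₂ ζ x₁ x₂)⁻¹‖ ≤ ρ⁻¹ := by
  have hred : ∀ ζ x₁ x₂, ∃ x₁' ∈ Set.Icc 0 (2 * π), ∃ x₂' ∈ Set.Icc 0 (2 * π),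
      edgePencil p ρ c₁ c₂ ζ x₁ x₂ = edgePencil p ρ c₁ c₂ ζ x₁' x₂' := by
    intro ζ x₁ x₂
    obtain ⟨a, ha, b, hb, h⟩ := exists_harper_eq_Icc p x₁ x₂ (c₁ * stripWidth p ρ ζ)
      (c₂ * stripWidth p ρ ζ)
    exact ⟨a, ha, b, hb, by rw [edgePencil, edgePencil, h]⟩
  intro ζ₁ hζ₁ y₁ y₂
  by_contra hcon
  push Not at hcon
  set F : ℂ × ℝ × ℝ → ℝ := fun w => ‖(edgePencil p ρ c₁ c₂ w.1 w.2.1 w.2.2)⁻¹‖ with hF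
  set Q : Set (ℂ × ℝ × ℝ) := outer p ρ ×ˢ (Set.Icc 0 (2 * π) ×ˢ Set.Icc 0 (2 * π)) with hQ
  have hQc : IsCompact Q := (isCompact_outer p ρ).prod (isCompact_Icc.prod isCompact_Icc)
  have hFc : ContinuousOn F Q := (continuousOn_inv_edgePencil hS hu).norm.mono fun w hw => hw.1
  obtain ⟨a, ha, b, hb, hab⟩ := hred ζ₁ y₁ y₂
  obtain ⟨w₀, hw₀, hmax⟩ := hQc.exists_isMaxOn ⟨(ζ₁, a, b), hζ₁, ha, hb⟩ hFc
  have hmax' : ∀ ζ ∈ outer p ρ, ∀ x₁ x₂, ‖(edgePencil p ρ c₁ c₂ ζ x₁ x₂)⁻¹‖ ≤ F w₀ := by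
    intro ζ hζ x₁ x₂
    obtain ⟨a, ha, b, hb, hab⟩ := hred ζ x₁ x₂
    rw [hab]
    exact isMaxOn_iff.1 hmax (ζ, a, b) ⟨hζ, ha, hb⟩
  have hm : ρ⁻¹ < F w₀ := hcon.trans_le (hmax' ζ₁ hζ₁ y₁ y₂)
  have hρinv : 1 ≤ ρ⁻¹ := (one_le_inv₀ hρ).2 hρ1
  set M : Set ℂ := Prod.fst '' (Q ∩ F ⁻¹' {F w₀}) with hM
  have hMc : IsCompact M :=
    (hQc.of_isClosed_subset (hFc.preimage_isClosed_of_isClosed hQc.isClosed isClosed_singleton)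
      Set.inter_subset_left).image continuous_fst
  have hMe : M = ∅ := by
    refine eq_empty_of_isCompact_of_mem_nhds hMc ?_
    rintro ζ₀ ⟨⟨ζ₀, x₁, x₂⟩, ⟨hwQ, hwF⟩, rfl⟩
    have hζ₀ : ζ₀ ∈ outer p ρ := hwQ.1
    have hval : ‖(edgePencil p ρ c₁ c₂ ζ₀ x₁ x₂)⁻¹‖ = F w₀ := hwF
    have h0 : growth p ρ < ‖charDet p ζ₀‖ := by
      refine lt_of_le_of_ne hζ₀.2 fun he => ?_
      have := norm_inv_edgePencil_le_of_growth_eq (c₁ := c₁) (c₂ := c₂) hρ he x₁ x₂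
      linarith
    have h30 : ‖ζ₀‖ < 30 := by
      refine lt_of_le_of_ne hζ₀.1 fun he => ?_
      have := norm_inv_edgePencil_le_of_norm_eq hS hc₁ hc₂ hζ₀ he (hu ζ₀ hζ₀ x₁ x₂)
      linarith
    obtain ⟨U, hUo, hU0, hUsub, f, hfd, hf0, hf⟩ := exists_edge_curve hS h0 h30 c₁ c₂ x₁ x₂
    have hUn : U ∈ nhds ζ₀ := hUo.mem_nhds hU0
    have hd : ∀ᶠ z in nhds ζ₀, DifferentiableAt ℂ (fun z => (f z)⁻¹) z := by
      filter_upwards [hUn] with z hz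
      obtain ⟨x₁', x₂', he⟩ := hf z hz
      have hunit : IsUnit (f z) := by rw [he]; exact hu z (hUsub hz) _ _
      exact (differentiableAt_matrix_inv hunit).comp z (hfd.differentiableAt (hUo.mem_nhds hz))
    have hloc : IsLocalMax (norm ∘ fun z => (f z)⁻¹) ζ₀ := by
      filter_upwards [hUn] with z hz
      obtain ⟨x₁', x₂', he⟩ := hf z hz
      simp only [Function.comp, he, hf0, hval]
      exact hmax' z (hUsub hz) _ _
    filter_upwards [Complex.norm_eventually_eq_of_isLocalMax hd hloc, hUn] with z hz hzU
    obtain ⟨x₁', x₂', he⟩ := hf z hzU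
    rw [he, hf0, hval] at hz
    obtain ⟨a, ha, b, hb, hab⟩ := hred z x₁' x₂'
    rw [hab] at hz
    exact ⟨(z, a, b), ⟨⟨hUsub hzU, ha, hb⟩, hz⟩, rfl⟩
  have : w₀.1 ∈ M := ⟨w₀, ⟨hw₀, rfl⟩, rfl⟩
  rw [hMe] at this
  exact this

lemma stripWidth_lt_four {p : ZMod q} {ρ : ℝ} (hS : 1 ≤ growth p ρ) {ζ : ℂ}
    (hζ : ζ ∈ outer p ρ) : stripWidth p ρ ζ < 4 := by
  have h1 := exp_stripWidth_le hS hζ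
  by_contra hcon
  push Not at hcon
  have h2 : exp 4 ≤ exp (stripWidth p ρ ζ) := exp_le_exp.2 hcon
  have h3 : exp 4 = exp 1 ^ 4 := by rw [← Real.exp_nat_mul]; norm_num
  have h4 : (2.7 : ℝ) ^ 4 ≤ exp 1 ^ 4 :=
    pow_le_pow_left₀ (by norm_num) (by linarith [Real.exp_one_gt_d9]) 4
  norm_num at h4
  linarith

lemma norm_edgePencil_sub_le {p : ZMod q} {ρ c₁ c₂ s : ℝ} (hS : 1 ≤ growth p ρ)
    (hc₁ : |c₁| ≤ 1 / 2) (hc₂ : |c₂| ≤ 1 / 2) {d₁ d₂ : ℝ} (hs : s ≤ 1 / 4)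
    (hd₁ : |d₁| ≤ s) (hd₂ : |d₂| ≤ s) {ζ : ℂ} (hζ : ζ ∈ outer p ρ) (x₁ x₂ : ℝ) :
    ‖edgePencil p ρ (c₁ + d₁) (c₂ + d₂) ζ x₁ x₂ - edgePencil p ρ c₁ c₂ ζ x₁ x₂‖ ≤ 192 * s := by
  have hV := stripWidth_nonneg hS hζ
  have hV4 := stripWidth_lt_four hS hζ
  set V := stripWidth p ρ ζ with hVdef
  have e : ∀ x c d : ℝ, (x : ℂ) + ((c + d) * V : ℝ) * Complex.I
      = (x + (c * V : ℝ) * Complex.I) + (d * V : ℝ) * Complex.I := by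
    intro x c d; push_cast; ring
  have hw : ∀ d : ℝ, |d| ≤ s → ‖((d * V : ℝ) : ℂ) * Complex.I‖ ≤ 4 * s := by
    intro d hd
    rw [norm_mul, Complex.norm_I, mul_one, Complex.norm_real, Real.norm_eq_abs, abs_mul,
      abs_of_nonneg hV]
    nlinarith [abs_nonneg d]
  have h1 := exp_half_stripWidth_lt hS hζ hc₁
  have h2 := exp_half_stripWidth_lt hS hζ hc₂
  have h := norm_harper_sub_le p (z₁ := x₁ + (c₁ * V : ℝ) * Complex.I)
    (z₂ := x₂ + (c₂ * V : ℝ) * Complex.I) ((hw d₁ hd₁).trans (by linarith))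
    ((hw d₂ hd₂).trans (by linarith))
  have him : ∀ x c : ℝ, ((x : ℂ) + (c * V : ℝ) * Complex.I).im = c * V := by
    intro x c; simp
  rw [him, him] at h
  simp only [edgePencil, ← hVdef, e, sub_sub_sub_cancel_left]
  rw [norm_sub_rev]
  refine h.trans ?_
  have h5 := mul_le_mul h1 (hw d₁ hd₁) (norm_nonneg _) (by norm_num)
  have h6 := mul_le_mul h2 (hw d₂ hd₂) (norm_nonneg _) (by norm_num)
  rw [← hVdef] at h5 h6
  have h7 := (abs_nonneg d₁).trans hd₁
  linarith

lemma isUnit_edgePencil {p : ZMod q} {ρ c₁ c₂ : ℝ} (hρ : 0 < ρ) (hρ1 : ρ ≤ 1)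
    (hS : 1 ≤ growth p ρ) (hc₁ : |c₁| ≤ 1 / 2) (hc₂ : |c₂| ≤ 1 / 2) :
    ∀ ζ ∈ outer p ρ, ∀ x₁ x₂, IsUnit (edgePencil p ρ c₁ c₂ ζ x₁ x₂) := by
  obtain ⟨N, hN⟩ := exists_nat_gt (192 / ρ)
  have hN0 : (0 : ℝ) < N := lt_trans (by positivity) hN
  have hNρ : 192 < N * ρ := (div_lt_iff₀ hρ).1 hN
  have key : ∀ j : ℕ, j ≤ N → ∀ ζ ∈ outer p ρ, ∀ x₁ x₂,
      IsUnit (edgePencil p ρ (j / N * c₁) (j / N * c₂) ζ x₁ x₂) := by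
    intro j
    induction j with
    | zero =>
      intro _ ζ hζ x₁ x₂
      simp only [edgePencil, Nat.cast_zero, zero_div, zero_mul, Complex.ofReal_zero, add_zero]
      exact (isUnit_harper_of_dist hρ (le_norm_sub_of_growth_le hζ.2) x₁ x₂).1
    | succ j ih =>
      intro hj ζ hζ x₁ x₂
      have hjN : (j : ℝ) / N ≤ 1 := by
        rw [div_le_one hN0]; exact_mod_cast (Nat.le_succ j).trans hj
      have hj0 : 0 ≤ (j : ℝ) / N := by positivity
      have hc : ∀ c : ℝ, |c| ≤ 1 / 2 → |(j : ℝ) / N * c| ≤ 1 / 2 := by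
        intro c hc
        rw [abs_mul, abs_of_nonneg hj0]
        nlinarith [abs_nonneg c]
      have hd : ∀ c : ℝ, |c| ≤ 1 / 2 → |1 / (N : ℝ) * c| ≤ 1 / (2 * N) := by
        intro c hc
        rw [abs_mul, abs_of_nonneg (by positivity)]
        calc 1 / (N : ℝ) * |c| ≤ 1 / N * (1 / 2) := by gcongr
          _ = 1 / (2 * N) := by field_simp
      have hihj := ih ((Nat.le_succ j).trans hj)
      have hinv := norm_inv_edgePencil_le hρ hρ1 hS (hc c₁ hc₁) (hc c₂ hc₂) hihj ζ hζ x₁ x₂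
      have hs : 1 / (2 * (N : ℝ)) ≤ 1 / 4 := by
        rw [div_le_div_iff₀ (by positivity) (by norm_num)]
        nlinarith
      have hsub := norm_edgePencil_sub_le hS (hc c₁ hc₁) (hc c₂ hc₂) hs (hd c₁ hc₁) (hd c₂ hc₂)
        hζ x₁ x₂
      have e : ∀ c : ℝ, ((j + 1 : ℕ) : ℝ) / N * c = j / N * c + 1 / N * c := by
        intro c; push_cast; ring
      rw [e, e]
      refine isUnit_of_norm_sub_lt hρ (hihj ζ hζ x₁ x₂) hinv (hsub.trans_lt ?_)
      rw [mul_one_div, div_lt_iff₀ (by positivity)]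
      nlinarith
  have := key N le_rfl
  rwa [div_self hN0.ne', one_mul, one_mul] at this

/-- Off the bands the resolvent of the complexified operator is controlled in a strip whose width
is governed by the size of the characteristic determinant. -/
lemma isUnit_and_norm_inv_le_of_mem_outer {p : ZMod q} {ρ : ℝ} (hρ : 0 < ρ) (hρ1 : ρ ≤ 1)
    (hS : 1 ≤ growth p ρ) {ζ : ℂ} (hζ : ζ ∈ outer p ρ) {z₁ z₂ : ℂ}
    (h₁ : |z₁.im| ≤ stripWidth p ρ ζ / 2) (h₂ : |z₂.im| ≤ stripWidth p ρ ζ / 2) :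
    IsUnit (ζ • 1 - harper p z₁ z₂) ∧ ‖(ζ • 1 - harper p z₁ z₂)⁻¹‖ ≤ ρ⁻¹ := by
  have hV := stripWidth_nonneg hS hζ
  set V := stripWidth p ρ ζ with hVdef
  have key : ∀ y : ℝ, |y| ≤ V / 2 → ∃ c : ℝ, |c| ≤ 1 / 2 ∧ y = c * V := by
    intro y hy
    rcases hV.eq_or_lt with h0 | h0
    · refine ⟨0, by norm_num, ?_⟩
      rw [← h0, zero_div] at hy
      rw [zero_mul]; exact abs_nonpos_iff.1 hy
    · refine ⟨y / V, ?_, (div_mul_cancel₀ _ h0.ne').symm⟩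
      rw [abs_div, abs_of_pos h0, div_le_iff₀ h0]
      linarith
  obtain ⟨c₁, hc₁, e₁⟩ := key _ h₁
  obtain ⟨c₂, hc₂, e₂⟩ := key _ h₂
  have hu := isUnit_edgePencil hρ hρ1 hS hc₁ hc₂
  have hb := norm_inv_edgePencil_le hρ hρ1 hS hc₁ hc₂ hu ζ hζ z₁.re z₂.re
  have he : edgePencil p ρ c₁ c₂ ζ z₁.re z₂.re = ζ • 1 - harper p z₁ z₂ := by
    rw [edgePencil, ← hVdef, ← e₁, ← e₂, Complex.re_add_im, Complex.re_add_im]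
  rw [← he]
  exact ⟨hu ζ hζ _ _, hb⟩

end ResolventBound

end CritAM

namespace CritAM

open scoped Matrix ComplexOrder Matrix.Norms.L2Operator

section Riesz
variable {n : Type*} [Fintype n]

lemma trace_mul_conjTranspose_of_isometry {m : Type*} [Fintype m] [DecidableEq m]
    {U : Matrix n m ℂ} (hU : Uᴴ * U = 1) : (U * Uᴴ).trace = Fintype.card m := by
  rw [Matrix.trace_mul_comm, hU, Matrix.trace_one]

lemma det_compression_eq_zero {m k : Type*} [Fintype m] [Fintype k] [DecidableEq k]
    (hcard : Fintype.card m < Fintype.card k) (A : Matrix n m ℂ) (U V : Matrix n k ℂ) :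
    (Uᴴ * (A * Aᴴ) * V).det = 0 := by
  by_contra hne
  have hu : IsUnit (Uᴴ * (A * Aᴴ) * V) := (Matrix.isUnit_iff_isUnit_det _).2 (Ne.isUnit hne)
  have h1 := Matrix.rank_of_isUnit _ hu
  have e : Uᴴ * (A * Aᴴ) * V = (Uᴴ * A) * (Aᴴ * V) := by simp only [Matrix.mul_assoc]
  rw [e] at h1
  have h2 := Matrix.rank_mul_le_left (Uᴴ * A) (Aᴴ * V)
  have h3 := Matrix.rank_le_card_width (Uᴴ * A)
  omega

variable [DecidableEq n]

/-- The Riesz integral of the resolvent of `T` along a circle. -/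
noncomputable def riesz (c : ℂ) (t : ℝ) (T : Matrix n n ℂ) : Matrix n n ℂ :=
  (2 * π * Complex.I : ℂ)⁻¹ • ∮ ζ in C(c, t), (ζ • 1 - T)⁻¹

lemma norm_riesz_le {c : ℂ} {t C : ℝ} (ht : 0 ≤ t) {T : Matrix n n ℂ}
    (hb : ∀ ζ ∈ Metric.sphere c t, ‖(ζ • 1 - T)⁻¹‖ ≤ C) : ‖riesz c t T‖ ≤ t * C :=
  circleIntegral.norm_two_pi_i_inv_smul_integral_le_of_norm_le_const ht hb

/-- Conjugation by a unitary matrix as a continuous linear equivalence. -/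
noncomputable def conjEquiv (A : Matrix n n ℂ) (hA : Aᴴ * A = 1) :
    Matrix n n ℂ ≃L[ℂ] Matrix n n ℂ :=
  LinearEquiv.toContinuousLinearEquiv
    { toFun := fun X => A * X * Aᴴ
      map_add' := fun X Y => by rw [mul_add, add_mul]
      map_smul' := fun a X => by
        rw [Matrix.mul_smul, Matrix.smul_mul, RingHom.id_apply]
      invFun := fun X => Aᴴ * X * A
      left_inv := fun X => by
        have : Aᴴ * (A * X * Aᴴ) * A = (Aᴴ * A) * X * (Aᴴ * A) := by simp only [mul_assoc]
        simp only [this, hA, one_mul, mul_one]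
      right_inv := fun X => by
        have hA' : A * Aᴴ = 1 := mul_eq_one_comm.1 hA
        have : A * (Aᴴ * X * A) * Aᴴ = (A * Aᴴ) * X * (A * Aᴴ) := by simp only [mul_assoc]
        simp only [this, hA', one_mul, mul_one] }

lemma conjEquiv_apply (A : Matrix n n ℂ) (hA : Aᴴ * A = 1) (X : Matrix n n ℂ) :
    conjEquiv A hA X = A * X * Aᴴ := rfl

lemma inv_conj {A : Matrix n n ℂ} (hA : Aᴴ * A = 1) (ζ : ℂ) (T : Matrix n n ℂ) :
    (ζ • 1 - A * T * Aᴴ)⁻¹ = A * (ζ • 1 - T)⁻¹ * Aᴴ := by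
  have hA' : A * Aᴴ = 1 := mul_eq_one_comm.1 hA
  have hi : A⁻¹ = Aᴴ := Matrix.inv_eq_left_inv hA
  have hi' : Aᴴ⁻¹ = A := Matrix.inv_eq_left_inv hA'
  have : ζ • 1 - A * T * Aᴴ = A * (ζ • 1 - T) * Aᴴ := by
    rw [mul_sub, sub_mul, Matrix.mul_smul, mul_one, Matrix.smul_mul, hA']
  rw [this, Matrix.mul_inv_rev, Matrix.mul_inv_rev, hi, hi', ← mul_assoc]

lemma riesz_conj (c : ℂ) (t : ℝ) {A : Matrix n n ℂ} (hA : Aᴴ * A = 1) (T : Matrix n n ℂ) :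
    riesz c t (A * T * Aᴴ) = A * riesz c t T * Aᴴ := by
  have h := ContinuousLinearEquiv.integral_comp_comm (μ := volume.restrict (Set.Ioc 0 (2 * π)))
    (conjEquiv A hA) (fun θ => deriv (circleMap c t) θ • (circleMap c t θ • 1 - T)⁻¹)
  simp only [map_smul, conjEquiv_apply] at h
  simp only [riesz, circleIntegral, inv_conj hA, Matrix.mul_smul, Matrix.smul_mul,
    intervalIntegral.integral_of_le two_pi_pos.le]
  rw [h]

lemma continuous_resolvent_circleMap {c : ℂ} {t : ℝ} (ht : 0 ≤ t) {T : Matrix n n ℂ}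
    (hu : ∀ ζ ∈ Metric.sphere c t, IsUnit (ζ • 1 - T)) :
    Continuous fun θ : ℝ => (circleMap c t θ • 1 - T)⁻¹ := by
  rw [continuous_iff_continuousAt]
  intro θ
  have h1 := continuousAt_matrix_inv (hu _ (circleMap_mem_sphere c ht θ))
  have h2 : Continuous fun θ : ℝ => circleMap c t θ • (1 : Matrix n n ℂ) - T := by fun_prop
  exact ContinuousAt.comp (g := fun B : Matrix n n ℂ => B⁻¹)
    (f := fun θ : ℝ => circleMap c t θ • (1 : Matrix n n ℂ) - T) h1 h2.continuousAt

lemma continuous_deriv_circleMap (c : ℂ) (t : ℝ) : Continuous (deriv (circleMap c t)) := by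
  have : deriv (circleMap c t) = fun θ => circleMap 0 t θ * Complex.I :=
    funext fun θ => deriv_circleMap c t θ
  rw [this]
  fun_prop

lemma norm_deriv_circleMap {c : ℂ} {t : ℝ} (ht : 0 ≤ t) (θ : ℝ) :
    ‖deriv (circleMap c t) θ‖ = t := by
  rw [deriv_circleMap, norm_mul, Complex.norm_I, mul_one, norm_circleMap_zero, abs_of_nonneg ht]

lemma continuousOn_riesz {X : Type*} [TopologicalSpace X] [FirstCountableTopology X]
    {T : X → Matrix n n ℂ} {s : Set X} {c : ℂ} {t C : ℝ} (ht : 0 ≤ t) (hT : ContinuousOn T s)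
    (hu : ∀ x ∈ s, ∀ ζ ∈ Metric.sphere c t, IsUnit (ζ • 1 - T x))
    (hb : ∀ x ∈ s, ∀ ζ ∈ Metric.sphere c t, ‖(ζ • 1 - T x)⁻¹‖ ≤ C) :
    ContinuousOn (fun x => riesz c t (T x)) s := by
  suffices h : ContinuousOn (fun x => ∫ θ in (0 : ℝ)..2 * π,
      deriv (circleMap c t) θ • (circleMap c t θ • 1 - T x)⁻¹) s from
    h.const_smul (2 * π * Complex.I : ℂ)⁻¹
  intro x₀ hx₀
  refine intervalIntegral.continuousWithinAt_of_dominated_interval (bound := fun _ => t * C)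
    ?_ ?_ intervalIntegrable_const ?_
  · filter_upwards [self_mem_nhdsWithin] with x hx
    exact ((continuous_deriv_circleMap c t).smul
      (continuous_resolvent_circleMap ht (hu x hx))).aestronglyMeasurable
  · filter_upwards [self_mem_nhdsWithin] with x hx
    refine Filter.Eventually.of_forall fun θ _ => ?_
    rw [norm_smul, norm_deriv_circleMap ht]
    exact mul_le_mul_of_nonneg_left (hb x hx _ (circleMap_mem_sphere c ht θ)) ht
  · refine Filter.Eventually.of_forall fun θ _ => ?_
    have h1 := continuousAt_matrix_inv (hu x₀ hx₀ _ (circleMap_mem_sphere c ht θ))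
    have h2 : ContinuousWithinAt (fun x => circleMap c t θ • (1 : Matrix n n ℂ) - T x) s x₀ :=
      continuousWithinAt_const.sub (hT x₀ hx₀)
    have h3 : ContinuousWithinAt (fun x => (circleMap c t θ • (1 : Matrix n n ℂ) - T x)⁻¹) s x₀ :=
      ContinuousAt.comp_continuousWithinAt (g := fun B : Matrix n n ℂ => B⁻¹)
        (f := fun x => circleMap c t θ • (1 : Matrix n n ℂ) - T x) h1 h2
    exact h3.const_smul (deriv (circleMap c t) θ)

lemma hasDerivAt_resolvent {T : ℂ → Matrix n n ℂ} {z ζ : ℂ} (hT : DifferentiableAt ℂ T z)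
    (hu : IsUnit (ζ • 1 - T z)) :
    HasDerivAt (fun w => (ζ • 1 - T w)⁻¹) ((ζ • 1 - T z)⁻¹ * deriv T z * (ζ • 1 - T z)⁻¹) z := by
  have h1 : HasDerivAt (fun w => ζ • 1 - T w) (-deriv T z) z := hT.hasDerivAt.const_sub _
  obtain ⟨u, hu⟩ := hu
  have h2 := hasFDerivAt_ringInverse (𝕜 := ℂ) u
  have e : (fun B : Matrix n n ℂ => B⁻¹) = Ring.inverse :=
    funext Matrix.nonsing_inv_eq_ringInverse
  rw [← e, hu] at h2
  have h3 := h2.comp_hasDerivAt z h1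
  have e2 : (ζ • 1 - T z)⁻¹ = ((u⁻¹ : (Matrix n n ℂ)ˣ) : Matrix n n ℂ) := by
    rw [← hu, Matrix.coe_units_inv]
  rw [e2]
  refine h3.congr_deriv ?_
  simp

lemma differentiableOn_riesz {T : ℂ → Matrix n n ℂ} {s : Set ℂ} {c : ℂ} {t C : ℝ} (ht : 0 ≤ t)
    (hs : IsOpen s) (hT : DifferentiableOn ℂ T s)
    (hu : ∀ x ∈ s, ∀ ζ ∈ Metric.sphere c t, IsUnit (ζ • 1 - T x))
    (hb : ∀ x ∈ s, ∀ ζ ∈ Metric.sphere c t, ‖(ζ • 1 - T x)⁻¹‖ ≤ C) :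
    DifferentiableOn ℂ (fun x => riesz c t (T x)) s := by
  suffices h : DifferentiableOn ℂ (fun x => ∫ θ in (0 : ℝ)..2 * π,
      deriv (circleMap c t) θ • (circleMap c t θ • 1 - T x)⁻¹) s from
    h.const_smul (2 * π * Complex.I : ℂ)⁻¹
  intro z₀ hz₀
  refine DifferentiableAt.differentiableWithinAt ?_
  have hT' : ContinuousAt (deriv T) z₀ :=
    ((hT.analyticAt (hs.mem_nhds hz₀)).deriv).continuousAt
  have hnear : {z | z ∈ s ∧ ‖deriv T z‖ < ‖deriv T z₀‖ + 1} ∈ nhds z₀ :=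
    Filter.inter_mem (hs.mem_nhds hz₀) (hT'.norm.eventually_lt_const (lt_add_one _))
  have key := intervalIntegral.hasDerivAt_integral_of_dominated_loc_of_deriv_le
    (μ := volume) (a := 0) (b := 2 * π) (x₀ := z₀)
    (F := fun z θ => deriv (circleMap c t) θ • (circleMap c t θ • 1 - T z)⁻¹)
    (F' := fun z θ => deriv (circleMap c t) θ •
      ((circleMap c t θ • 1 - T z)⁻¹ * deriv T z * (circleMap c t θ • 1 - T z)⁻¹))
    (bound := fun _ => t * (C * (‖deriv T z₀‖ + 1) * C)) hnear ?_ ?_ ?_ ?_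
    intervalIntegrable_const ?_
  · exact key.2.differentiableAt
  · filter_upwards [hnear] with z hz
    exact ((continuous_deriv_circleMap c t).smul
      (continuous_resolvent_circleMap ht (hu z hz.1))).aestronglyMeasurable
  · exact ((continuous_deriv_circleMap c t).smul
      (continuous_resolvent_circleMap ht (hu z₀ hz₀))).intervalIntegrable _ _
  · have h1 := continuous_resolvent_circleMap ht (hu z₀ hz₀)
    exact ((continuous_deriv_circleMap c t).smul
      ((h1.mul continuous_const).mul h1)).aestronglyMeasurable
  · refine Filter.Eventually.of_forall fun θ _ z hz => ?_
    have h1 := hb z hz.1 _ (circleMap_mem_sphere c ht θ)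
    have hC : 0 ≤ C := (norm_nonneg _).trans h1
    rw [norm_smul, norm_deriv_circleMap ht]
    refine mul_le_mul_of_nonneg_left ?_ ht
    refine (norm_mul_le _ _).trans (mul_le_mul ?_ h1 (norm_nonneg _) (by positivity))
    exact (norm_mul_le _ _).trans (mul_le_mul h1 (le_of_lt hz.2) (norm_nonneg _) hC)
  · refine Filter.Eventually.of_forall fun θ _ z hz => ?_
    exact HasDerivAt.const_smul (deriv (circleMap c t) θ)
      (hasDerivAt_resolvent (hT.differentiableAt (hs.mem_nhds hz.1))
        (hu z hz.1 _ (circleMap_mem_sphere c ht θ)))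

lemma circleIntegral_inv_eq {c w : ℂ} {t : ℝ} (ht : 0 ≤ t) (hw : ‖w - c‖ ≠ t) :
    (2 * π * Complex.I : ℂ)⁻¹ * ∮ ζ in C(c, t), (ζ - w)⁻¹ = if ‖w - c‖ < t then 1 else 0 := by
  split_ifs with h
  · rw [circleIntegral.integral_sub_inv_of_mem_ball (by rwa [mem_ball_iff_norm])]
    exact inv_mul_cancel₀ Complex.two_pi_I_ne_zero
  · have hlt : t < ‖w - c‖ := lt_of_le_of_ne (not_lt.1 h) hw.symm
    have hne : ∀ z ∈ Metric.closedBall c t, z - w ≠ 0 := by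
      intro z hz h0
      rw [sub_eq_zero] at h0
      rw [h0, mem_closedBall_iff_norm] at hz
      linarith
    have := Complex.circleIntegral_eq_zero_of_differentiable_on_off_countable (c := c) ht
      (f := fun ζ => (ζ - w)⁻¹) Set.countable_empty
      (ContinuousOn.inv₀ (by fun_prop) hne)
      (fun z hz => DifferentiableAt.inv (by fun_prop) (hne z (Metric.ball_subset_closedBall hz.1)))
    rw [this, mul_zero]

/-- Compressing a diagonal vector into a matrix between `W` and its adjoint. -/
noncomputable def diagConj (W : Matrix n n ℂ) : (n → ℂ) →L[ℂ] Matrix n n ℂ :=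
  LinearMap.toContinuousLinearMap
    { toFun := fun d => W * Matrix.diagonal d * Wᴴ
      map_add' := fun x y => by
        rw [← add_mul, ← mul_add, Matrix.diagonal_add]
        rfl
      map_smul' := fun a x => by
        rw [Matrix.diagonal_smul, Matrix.mul_smul, Matrix.smul_mul, RingHom.id_apply] }

lemma diagConj_apply (W : Matrix n n ℂ) (d : n → ℂ) :
    diagConj W d = W * Matrix.diagonal d * Wᴴ := rfl

lemma inv_diagConj {W : Matrix n n ℂ} (hW : Wᴴ * W = 1) {d : n → ℂ} {ζ : ℂ}
    (hd : ∀ k, ζ ≠ d k) : (ζ • 1 - diagConj W d)⁻¹ = diagConj W fun k => (ζ - d k)⁻¹ := by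
  rw [diagConj_apply, diagConj_apply, inv_conj hW]
  congr 2
  refine Matrix.inv_eq_right_inv ?_
  rw [← Matrix.diagonal_one, ← Matrix.diagonal_smul, Matrix.diagonal_sub,
    Matrix.diagonal_mul_diagonal]
  congr 1
  funext k
  simpa using mul_inv_cancel₀ (sub_ne_zero.2 (hd k))

lemma riesz_diagConj {W : Matrix n n ℂ} (hW : Wᴴ * W = 1) {d : n → ℂ} {c : ℂ} {t : ℝ}
    (ht : 0 ≤ t) (hd : ∀ k, ‖d k - c‖ ≠ t) :
    riesz c t (diagConj W d) = diagConj W fun k => if ‖d k - c‖ < t then 1 else 0 := by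
  have hne : ∀ θ k, circleMap c t θ ≠ d k := by
    intro θ k h
    refine hd k ?_
    rw [← h, ← mem_sphere_iff_norm]
    exact circleMap_mem_sphere c ht θ
  have hcont : Continuous fun θ : ℝ =>
      deriv (circleMap c t) θ • fun k => (circleMap c t θ - d k)⁻¹ := by
    refine (continuous_deriv_circleMap c t).smul (continuous_pi fun k => ?_)
    exact Continuous.inv₀ (by fun_prop) fun θ => sub_ne_zero.2 (hne θ k)
  have h := (diagConj W).intervalIntegral_comp_comm
    (hcont.intervalIntegrable (μ := volume) 0 (2 * π))
  simp only [riesz, circleIntegral, inv_diagConj hW (hne _)]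
  simp only [map_smul] at h
  rw [h, ← map_smul]
  congr 1
  funext k
  rw [← circleIntegral_inv_eq ht (hd k), Pi.smul_apply, smul_eq_mul]
  congr 1
  have h2 := (ContinuousLinearMap.proj (R := ℂ) (φ := fun _ : n => ℂ) k).intervalIntegral_comp_comm
    (hcont.intervalIntegrable (μ := volume) 0 (2 * π))
  exact h2.symm

lemma isHermitian_eq_diagConj {T : Matrix n n ℂ} (hT : T.IsHermitian) :
    ∃ W : Matrix n n ℂ, Wᴴ * W = 1 ∧ T = diagConj W fun k => (hT.eigenvalues k : ℂ) := by
  refine ⟨hT.eigenvectorUnitary, ?_, ?_⟩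
  · exact Unitary.coe_star_mul_self hT.eigenvectorUnitary
  · have h := hT.spectral_theorem
    rw [Unitary.conjStarAlgAut_apply] at h
    exact h

lemma diagConj_indicator (W : Matrix n n ℂ) (S : n → Prop) [DecidablePred S] :
    (diagConj W fun k => if S k then 1 else 0)
      = W.submatrix id (Subtype.val : {k // S k} → n)
        * (W.submatrix id (Subtype.val : {k // S k} → n))ᴴ := by
  ext a b
  rw [diagConj_apply, Matrix.mul_apply, Matrix.mul_apply]
  simp only [Matrix.mul_diagonal, Matrix.conjTranspose_apply, Matrix.submatrix_apply, id]
  rw [← Finset.sum_subtype (Finset.univ.filter S) (by simp) (fun k => W a k * star (W b k)),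
    Finset.sum_filter]
  refine Finset.sum_congr rfl fun k _ => ?_
  split_ifs <;> simp

/-- The Riesz integral of a Hermitian matrix is the projection on the eigenspaces enclosed by the
circle. -/
lemma exists_riesz_eq {T : Matrix n n ℂ} (hT : T.IsHermitian) {c : ℂ} {t : ℝ} (ht : 0 ≤ t)
    (hd : ∀ k, ‖(hT.eigenvalues k : ℂ) - c‖ ≠ t) :
    ∃ U : Matrix n (Fin (Finset.univ.filter fun k => ‖(hT.eigenvalues k : ℂ) - c‖ < t).card) ℂ,
      Uᴴ * U = 1 ∧ riesz c t T = U * Uᴴ := by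
  obtain ⟨W, hW, hTW⟩ := isHermitian_eq_diagConj hT
  have h := riesz_diagConj hW ht hd
  rw [← hTW, diagConj_indicator] at h
  let e : Fin (Finset.univ.filter fun k => ‖(hT.eigenvalues k : ℂ) - c‖ < t).card ≃
      {k // ‖(hT.eigenvalues k : ℂ) - c‖ < t} :=
    (Fintype.equivFinOfCardEq (Fintype.card_subtype _)).symm
  refine ⟨W.submatrix id (Subtype.val ∘ e), ?_, ?_⟩
  · have h2 := Matrix.submatrix_mul_equiv Wᴴ W (Subtype.val ∘ e) (Equiv.refl n) (Subtype.val ∘ e)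
    rw [Equiv.coe_refl, hW, Matrix.submatrix_one _
      (Subtype.val_injective.comp e.injective)] at h2
    exact h2
  · rw [h]
    ext a b
    simp only [Matrix.mul_apply, Matrix.submatrix_apply, Matrix.conjTranspose_apply, id,
      Function.comp]
    exact (Equiv.sum_comp e fun k => W a k.1 * star (W b k.1)).symm

end Riesz

section Identity

lemma isPreconnected_strip (Y : ℝ) : IsPreconnected {z : ℂ | |z.im| < Y} := by
  have : {z : ℂ | |z.im| < Y} = Complex.imLm ⁻¹' Set.Ioo (-Y) Y := by
    ext z; simp [abs_lt]
  rw [this]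
  exact ((convex_Ioo (-Y) Y).linear_preimage Complex.imLm).isPreconnected

lemma isOpen_strip (Y : ℝ) : IsOpen {z : ℂ | |z.im| < Y} :=
  isOpen_lt (by fun_prop) continuous_const

lemma eq_zero_of_eq_zero_on_real {Y : ℝ} (hY : 0 < Y) {f : ℂ → ℂ}
    (hf : DifferentiableOn ℂ f {z | |z.im| < Y}) (h0 : ∀ x : ℝ, f x = 0) :
    ∀ z : ℂ, |z.im| < Y → f z = 0 := by
  have han : AnalyticOnNhd ℂ f {z | |z.im| < Y} := hf.analyticOnNhd (isOpen_strip Y)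
  refine han.eqOn_zero_of_preconnected_of_frequently_eq_zero (isPreconnected_strip Y) (z₀ := 0)
    (by simpa using hY) ?_
  have ht : Filter.Tendsto (fun k : ℕ => ((1 / ((k : ℝ) + 1) : ℝ) : ℂ)) Filter.atTop
      (nhdsWithin 0 {0}ᶜ) := by
    refine tendsto_nhdsWithin_iff.2 ⟨?_, Filter.Eventually.of_forall fun k => ?_⟩
    · have := (Complex.continuous_ofReal.tendsto 0).comp
        (tendsto_one_div_add_atTop_nhds_zero_nat (𝕜 := ℝ))
      simpa [Function.comp_def] using this
    · have : (1 / ((k : ℝ) + 1)) ≠ 0 := by positivity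
      simpa using (Complex.ofReal_ne_zero.2 this)
  exact ht.frequently (Filter.Frequently.of_forall fun k => h0 _)

lemma eq_of_continuous_natCast {X : Type*} [TopologicalSpace X] [PreconnectedSpace X] {f : X → ℕ}
    (hf : Continuous fun x => (f x : ℂ)) (x y : X) : f x = f y := by
  have h1 : Continuous fun x => (f x : ℝ) := by
    have := Complex.continuous_re.comp hf
    simpa [Function.comp_def] using this
  have h2 : Continuous f := Nat.isClosedEmbedding_coe_real.isInducing.continuous_iff.2 h1
  exact PreconnectedSpace.constant inferInstance h2

end Identity
end CritAM

namespace CritAM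

open scoped Matrix ComplexOrder Matrix.Norms.L2Operator

section Contour
variable {q : ℕ} [NeZero q]

/-- A circle enclosing part of the bands, on which the characteristic determinant is large, yields
an almost invariant subspace for the two magnetic translations. -/
lemma norm_stdAddChar_pow_sub_one_le {p r : ZMod q} (hr : p * r = 1) {ρ s Y E₀ E₁ : ℝ}
    (hρ : 0 < ρ) (hρ1 : ρ ≤ 1) (hρs : ρ < s) (hY : 0 < Y)
    (hE₁ : E₁ ∈ bands p) (hE : |E₁ - E₀| < s)
    (hout : ∀ ζ ∈ Metric.sphere (E₀ : ℂ) s, ζ ∈ outer p ρ)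
    (hwidth : ∀ ζ ∈ Metric.sphere (E₀ : ℂ) s, Y ≤ stripWidth p ρ ζ / 2) {i : ℕ}
    (hi : i = (Finset.univ.filter fun k => |eig p k - E₀| < s).card) {δ : ℝ}
    (hδ : δ = (exp (256 * i * log (s / ρ) * (2 * π / q) ^ 2 / Y ^ 2) - 1) / 3) :
    1 ≤ i ∧ (8 * (2 * π / q) ≤ Y → δ ≤ 1 / 8 → ‖(ZMod.stdAddChar r : ℂ) ^ i - 1‖ ≤ 8 * δ) := by
  have hq0 : (0 : ℝ) < q := Nat.cast_pos.2 (NeZero.pos q)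
  have hs : 0 < s := hρ.trans hρs
  have hS := one_le_growth hr hρ.le
  have hres : ∀ z₁ z₂ : ℂ, |z₁.im| ≤ Y → |z₂.im| ≤ Y → ∀ ζ ∈ Metric.sphere (E₀ : ℂ) s,
      IsUnit (ζ • 1 - harper p z₁ z₂) ∧ ‖(ζ • 1 - harper p z₁ z₂)⁻¹‖ ≤ ρ⁻¹ :=
    fun z₁ z₂ h1 h2 ζ hζ =>
    isUnit_and_norm_inv_le_of_mem_outer hρ hρ1 hS (hout ζ hζ) (h1.trans (hwidth ζ hζ))
      (h2.trans (hwidth ζ hζ))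
  have hreal : ∀ x₁ x₂ : ℝ, ∀ ζ ∈ Metric.sphere (E₀ : ℂ) s,
      IsUnit (ζ • 1 - harper p x₁ x₂) ∧ ‖(ζ • 1 - harper p x₁ x₂)⁻¹‖ ≤ ρ⁻¹ := fun x₁ x₂ ζ hζ =>
    hres x₁ x₂ (by simpa using hY.le) (by simpa using hY.le) ζ hζ
  have hsep : ∀ x₁ x₂ : ℝ, ∀ k,
      ‖((harper_isHermitian p x₁ x₂).eigenvalues k : ℂ) - E₀‖ ≠ s := by
    intro x₁ x₂ k hk
    have h1 := (hreal x₁ x₂ _ (mem_sphere_iff_norm.2 hk)).1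
    rw [Matrix.isUnit_iff_isUnit_det, det_smul_one_sub_eq_prod (harper_isHermitian p x₁ x₂)] at h1
    exact h1.ne_zero (Finset.prod_eq_zero (Finset.mem_univ k) (sub_self _))
  set P : ℂ → ℂ → Matrix (ZMod q) (ZMod q) ℂ := fun z₁ z₂ => riesz E₀ s (harper p z₁ z₂) with hP
  set N : ℝ × ℝ → ℕ := fun x => (Finset.univ.filter fun k =>
    ‖((harper_isHermitian p x.1 x.2).eigenvalues k : ℂ) - E₀‖ < s).card with hN
  have hPN : ∀ x₁ x₂ : ℝ, ∃ U : Matrix (ZMod q) (Fin (N (x₁, x₂))) ℂ,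
      Uᴴ * U = 1 ∧ P x₁ x₂ = U * Uᴴ := fun x₁ x₂ =>
    exists_riesz_eq (harper_isHermitian p x₁ x₂) hs.le (hsep x₁ x₂)
  have hcont : ContinuousOn (fun z : ℂ × ℂ => P z.1 z.2) {z | |z.1.im| ≤ Y ∧ |z.2.im| ≤ Y} :=
    continuousOn_riesz hs.le (continuous_harper p).continuousOn
      (fun z hz ζ hζ => (hres z.1 z.2 hz.1 hz.2 ζ hζ).1)
      (fun z hz ζ hζ => (hres z.1 z.2 hz.1 hz.2 ζ hζ).2)
  have hNc : ∀ x : ℝ × ℝ, N x = i := by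
    have h1 : Continuous fun x : ℝ × ℝ => P x.1 x.2 := by
      rw [← continuousOn_univ]
      refine hcont.comp (f := fun x : ℝ × ℝ => ((x.1 : ℂ), (x.2 : ℂ)))
        (Continuous.continuousOn (by fun_prop)) fun x _ => ?_
      simp only [Set.mem_ofPred_eq, Complex.ofReal_im, abs_zero]
      exact ⟨hY.le, hY.le⟩
    have h2 : Continuous fun x : ℝ × ℝ => (N x : ℂ) := by
      have : (fun x : ℝ × ℝ => (N x : ℂ)) = fun x => (P x.1 x.2).trace := by
        funext x
        obtain ⟨U, hU, hPU⟩ := hPN x.1 x.2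
        rw [hPU, trace_mul_conjTranspose_of_isometry hU, Fintype.card_fin]
      rw [this]
      exact h1.matrix_trace
    intro x
    rw [eq_of_continuous_natCast h2 x (0, 0), hi]
    refine congrArg Finset.card (Finset.filter_congr fun k _ => ?_)
    rw [← Complex.ofReal_sub, Complex.norm_real, Real.norm_eq_abs]
    rfl
  have hi1 : 1 ≤ i := by
    obtain ⟨x₁, x₂, hdet⟩ := hE₁
    rw [det_smul_one_sub_eq_prod (harper_isHermitian p x₁ x₂), Finset.prod_eq_zero_iff] at hdet
    obtain ⟨k, -, hk⟩ := hdet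
    rw [← hNc (x₁, x₂), Nat.one_le_iff_ne_zero, ← Nat.pos_iff_ne_zero, hN, Finset.card_pos]
    refine ⟨k, ?_⟩
    rw [Finset.mem_filter]
    refine ⟨Finset.mem_univ _, ?_⟩
    rw [← sub_eq_zero.1 hk, ← Complex.ofReal_sub, Complex.norm_real]
    exact hE
  refine ⟨hi1, fun hqY hδ8 => ?_⟩
  have hlt : ∀ z : ℂ, |z.im| < Y → |z.im| ≤ Y := fun z hz => le_of_lt hz
  have hd1 : ∀ z₂ : ℂ, |z₂.im| ≤ Y → DifferentiableOn ℂ (fun z => P z z₂) {z | |z.im| < Y} :=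
    fun z₂ hz₂ => differentiableOn_riesz hs.le (isOpen_strip Y)
      (differentiable_harper_comp p differentiableOn_id (differentiableOn_const _))
      (fun z hz ζ hζ => (hres z z₂ (hlt z hz) hz₂ ζ hζ).1)
      (fun z hz ζ hζ => (hres z z₂ (hlt z hz) hz₂ ζ hζ).2)
  have hd2 : ∀ z₁ : ℂ, |z₁.im| ≤ Y → DifferentiableOn ℂ (fun z => P z₁ z) {z | |z.im| < Y} :=
    fun z₁ hz₁ => differentiableOn_riesz hs.le (isOpen_strip Y)
      (differentiable_harper_comp p (differentiableOn_const _) differentiableOn_id)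
      (fun z hz ζ hζ => (hres z₁ z hz₁ (hlt z hz) ζ hζ).1)
      (fun z hz ζ hζ => (hres z₁ z hz₁ (hlt z hz) ζ hζ).2)
  have hrank : ∀ z₁ z₂ : ℂ, |z₁.im| < Y → |z₂.im| < Y →
      ∀ U V : Matrix (ZMod q) (Fin i ⊕ Unit) ℂ, (Uᴴ * P z₁ z₂ * V).det = 0 := by
    intro z₁ z₂ hz₁ hz₂ U V
    refine eq_zero_of_eq_zero_on_real hY
      (differentiableOn_det_compression U V (hd2 z₁ hz₁.le)) (fun x₂ => ?_) z₂ hz₂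
    refine eq_zero_of_eq_zero_on_real hY
      (differentiableOn_det_compression U V (hd1 x₂ (by simpa using hY.le))) (fun x₁ => ?_) z₁ hz₁
    obtain ⟨A, -, hA⟩ := hPN x₁ x₂
    rw [hA]
    refine det_compression_eq_zero ?_ A U V
    rw [Fintype.card_fin, hNc, Fintype.card_sum, Fintype.card_fin, Fintype.card_unit]
    exact Nat.lt_succ_self i
  obtain ⟨U, hU, hUP⟩ : ∃ U : Matrix (ZMod q) (Fin i) ℂ, Uᴴ * U = 1 ∧ P 0 0 = U * Uᴴ := by
    have := hPN 0 0
    rw [hNc, Complex.ofReal_zero] at this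
    exact this
  have h1 : 1 ≤ ‖(Uᴴ * P 0 0 * U).det‖ := by
    have : Uᴴ * P 0 0 * U = (Uᴴ * U) * (Uᴴ * U) := by rw [hUP]; simp only [Matrix.mul_assoc]
    rw [this, hU, one_mul, Matrix.det_one, norm_one]
  obtain ⟨X, hX, hXA, hXB⟩ := exists_isometry_of_covariant (P := P) (A := shift (-r))
    (B := phase 1) (Y := Y) (Mb := s / ρ) (h := 2 * π / q) hi1 hY ((one_lt_div hρ).2 hρs)
    (by positivity) hqY hcont hd1 hd2
    (fun z₁ z₂ hz₁ hz₂ => by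
      rw [div_eq_mul_inv]
      exact norm_riesz_le hs.le fun ζ hζ => (hres z₁ z₂ hz₁ hz₂ ζ hζ).2)
    (fun z₁ z₂ => by simp only [hP, harper_add_two_pi_left])
    (fun z₁ z₂ => by simp only [hP, harper_add_two_pi_right])
    (shift_isometry _) (phase_isometry _)
    (fun z₁ z₂ => by
      simp only [hP]
      rw [← shift_conj_harper hr, riesz_conj _ _ (shift_isometry _)])
    (fun z₁ z₂ => by
      simp only [hP]
      rw [← phase_conj_harper, riesz_conj _ _ (phase_isometry _)])
    hrank hU hU h1 hδ
  exact norm_pow_sub_one_le hX (shift_isometry _) (phase_isometry _) (shift_mul_phase_one r) hδ8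
    hXA hXB

end Contour
end CritAM

namespace CritAM

open scoped Matrix ComplexOrder Matrix.Norms.L2Operator

section Claim
variable {q : ℕ} [NeZero q]

lemma le_norm_stdAddChar_sub_one (m : ZMod q) :
    4 * |(m.valMinAbs : ℝ)| / q ≤ ‖(ZMod.stdAddChar m : ℂ) - 1‖ := by
  have hq0 : (0 : ℝ) < q := Nat.cast_pos.2 (NeZero.pos q)
  set j := m.valMinAbs with hj
  have h2 : |(j : ℝ)| ≤ q / 2 := by
    have h := ZMod.valMinAbs_mem_Ioc m
    rw [← hj] at h
    have h1 : -(q : ℝ) < j * 2 := by exact_mod_cast h.1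
    have h2 : (j : ℝ) * 2 ≤ q := by exact_mod_cast h.2
    exact abs_le.2 ⟨by linarith, by linarith⟩
  have e : (2 * π * Complex.I * j / q : ℂ) = Complex.I * ((2 * (π * j / q) : ℝ) : ℂ) := by
    push_cast; ring
  rw [← ZMod.coe_valMinAbs m, ← hj, ZMod.stdAddChar_coe, e, Complex.norm_exp_I_mul_ofReal_sub_one,
    mul_div_cancel_left₀ _ two_ne_zero, norm_mul, Real.norm_eq_abs, Real.norm_eq_abs, abs_two]
  have h4 : |π * (j : ℝ) / q| = π * |(j : ℝ)| / q := by
    rw [abs_div, abs_mul, abs_of_pos pi_pos, abs_of_pos hq0]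
  have h3 := Real.mul_abs_le_abs_sin (x := π * j / q) (by
    rw [h4, div_le_iff₀ hq0]
    nlinarith [pi_pos])
  rw [h4] at h3
  have h5 : 2 / π * (π * |(j : ℝ)| / q) = 2 * |(j : ℝ)| / q := by
    have := pi_pos.ne'
    field_simp
  rw [h5] at h3
  calc 4 * |(j : ℝ)| / q = 2 * (2 * |(j : ℝ)| / q) := by ring
    _ ≤ _ := by linarith

lemma log_norm_charDet_vertical {p : ZMod q} {E η : ℝ} (h : ∀ k, (E - eig p k) ^ 2 + η ^ 2 ≠ 0) :
    2 * log ‖charDet p (E + η * Complex.I)‖ = ∑ k, log ((E - eig p k) ^ 2 + η ^ 2) := by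
  rw [norm_charDet, Real.log_prod (fun k _ => ?_), Finset.mul_sum]
  · refine Finset.sum_congr rfl fun k _ => ?_
    rw [← normSq_vertical, Real.log_pow]
    norm_num
  · intro h0
    have := normSq_vertical E η (eig p k)
    rw [h0] at this
    exact h k (by rw [← this]; norm_num)

lemma sum_pot_eq {p : ZMod q} {E₀ ρ x η : ℝ} (hρ : 0 < ρ)
    (h : ∀ k, (x - (eig p k - E₀) / ρ) ^ 2 + η ^ 2 ≠ 0) :
    ∑ k, pot ((eig p k - E₀) / ρ) x η
      = 2 * (log ‖charDet p ((E₀ + ρ * x : ℝ) + (ρ * η : ℝ) * Complex.I)‖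
        - log ‖charDet p (E₀ + ρ * Complex.I)‖) := by
  have e1 : ∀ k, (E₀ + ρ * x - eig p k) ^ 2 + (ρ * η) ^ 2
      = ρ ^ 2 * ((x - (eig p k - E₀) / ρ) ^ 2 + η ^ 2) := by
    intro k; field_simp; ring
  have e2 : ∀ k, (E₀ - eig p k) ^ 2 + ρ ^ 2 = ρ ^ 2 * (1 + ((eig p k - E₀) / ρ) ^ 2) := by
    intro k; field_simp; ring
  have hρ2 : ρ ^ 2 ≠ 0 := by positivity
  have h1 : ∀ k, 1 + ((eig p k - E₀) / ρ) ^ 2 ≠ 0 := fun k => by positivity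
  rw [mul_sub, log_norm_charDet_vertical (fun k => by rw [e1]; exact mul_ne_zero hρ2 (h k)),
    log_norm_charDet_vertical (fun k => by rw [e2]; exact mul_ne_zero hρ2 (h1 k)),
    ← Finset.sum_sub_distrib]
  refine Finset.sum_congr rfl fun k _ => ?_
  rw [e1, e2, Real.log_mul hρ2 (h k), Real.log_mul hρ2 (h1 k), pot, Real.log_div (h k) (h1 k)]
  ring

/-- Existence of a circle, centred at a point where the growth is attained, on which the
characteristic determinant is large and which encloses few eigenvalues. -/
lemma exists_good_circle {p : ZMod q} {A ρ L : ℝ} (hA : 1000 ≤ log A)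
    (hA0 : 0 < A) (hρ : 0 < ρ)
    (hL : log (growth p ρ) - log (growth p 0) = L)
    (hL2 : log (growth p (A * ρ)) - log (growth p 0) ≤ 2 * L) :
    ∃ E₀ : ℝ, Metric.infDist E₀ (bands p) ≤ ρ ∧ ∃ t ∈ Set.Icc (2 : ℝ) 4,
      (∀ ζ ∈ Metric.sphere (E₀ : ℂ) (t * ρ),
        charDet p ζ ≠ 0 ∧ log (growth p 0) + L / 2 ≤ log ‖charDet p ζ‖) ∧
      ((Finset.univ.filter fun k => |eig p k - E₀| < t * ρ).card : ℝ) * log A ≤ 2 * L := by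
  obtain ⟨E₀, hE₀, hE₀g⟩ := exists_eq_growth p hρ.le
  have hA1 : 1001 ≤ A := by
    have := Real.log_le_sub_one_of_pos hA0; linarith
  have hdist : ∀ x η : ℝ, |x| ≤ A - 1 → 0 < η → η ≤ A →
      ∑ k, pot ((eig p k - E₀) / ρ) x η ≤ 2 * L := by
    intro x η hx hη hηA
    have hne : ∀ k, (x - (eig p k - E₀) / ρ) ^ 2 + η ^ 2 ≠ 0 := fun k => by positivity
    have hne' : charDet p ((E₀ + ρ * x : ℝ) + (ρ * η : ℝ) * Complex.I) ≠ 0 := by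
      rw [← norm_ne_zero_iff, norm_charDet, Finset.prod_ne_zero_iff]
      intro k _ h0
      have := normSq_vertical (E₀ + ρ * x) (ρ * η) (eig p k)
      rw [h0] at this
      have h2 : 0 < (ρ * η) ^ 2 := by positivity
      nlinarith [sq_nonneg (E₀ + ρ * x - eig p k)]
    rw [sum_pot_eq hρ hne, hE₀g]
    have h1 : Metric.infDist (E₀ + ρ * x) (bands p) ≤ A * ρ := by
      have h2 := Metric.infDist_le_infDist_add_dist (s := bands p) (x := E₀ + ρ * x) (y := E₀)
      rw [Real.dist_eq, add_sub_cancel_left, abs_mul, abs_of_pos hρ] at h2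
      nlinarith
    have h3 := norm_charDet_le_growth (p := p) (η := ρ * η) h1 (by
      rw [abs_of_pos (by positivity)]; nlinarith)
    have h4 := Real.log_le_log (norm_pos_iff.2 hne') h3
    linarith
  obtain ⟨t, ht, hdt, hlow, hcard⟩ := exists_circle hA0 hA (fun k => (eig p k - E₀) / ρ) hdist
  refine ⟨E₀, hE₀, t, ht, fun ζ hζ => ?_, ?_⟩
  · set x := (ζ.re - E₀) / ρ with hx
    set η := ζ.im / ρ with hη
    have hζe : ζ = (E₀ + ρ * x : ℝ) + (ρ * η : ℝ) * Complex.I := by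
      have h1 : E₀ + ρ * x = ζ.re := by rw [hx]; field_simp; ring
      have h2 : ρ * η = ζ.im := by rw [hη]; field_simp
      rw [h1, h2, Complex.re_add_im]
    have hxη : x ^ 2 + η ^ 2 = t ^ 2 := by
      rw [mem_sphere_iff_norm] at hζ
      have h1 := Complex.sq_norm (ζ - E₀)
      rw [hζ, Complex.normSq_apply] at h1
      simp only [Complex.sub_re, Complex.ofReal_re, Complex.sub_im, Complex.ofReal_im,
        sub_zero] at h1
      rw [hx, hη]
      field_simp
      linarith
    have hne : ∀ k, (x - (eig p k - E₀) / ρ) ^ 2 + η ^ 2 ≠ 0 := by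
      intro k h0
      have h1 : η = 0 := by
        have := sq_nonneg (x - (eig p k - E₀) / ρ)
        have := sq_nonneg η
        exact pow_eq_zero_iff two_ne_zero |>.1 (by linarith)
      have h2 : x = (eig p k - E₀) / ρ := by
        rw [h1] at h0
        exact sub_eq_zero.1 (pow_eq_zero_iff two_ne_zero |>.1 (by linarith))
      refine hdt k ?_
      rw [← h2, ← abs_of_nonneg (show 0 ≤ t by linarith [ht.1]), ← sq_eq_sq_iff_abs_eq_abs]
      rw [h1] at hxη; linarith
    have h1 := hlow x η hxη
    rw [sum_pot_eq hρ hne, hE₀g, ← hζe] at h1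
    refine ⟨?_, by linarith⟩
    rw [← norm_ne_zero_iff, norm_charDet, Finset.prod_ne_zero_iff]
    intro k _ h0
    have h2 := normSq_vertical (E₀ + ρ * x) (ρ * η) (eig p k)
    rw [← hζe, h0] at h2
    have e1 : (E₀ + ρ * x - eig p k) ^ 2 + (ρ * η) ^ 2
        = ρ ^ 2 * ((x - (eig p k - E₀) / ρ) ^ 2 + η ^ 2) := by
      field_simp; ring
    rw [e1] at h2
    exact mul_ne_zero (by positivity : ρ ^ 2 ≠ 0) (hne k) (by rw [← h2]; norm_num)
  · refine le_trans (mul_le_mul_of_nonneg_right ?_ (by linarith)) hcard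
    refine Nat.cast_le.2 (Finset.card_le_card fun k hk => ?_)
    rw [Finset.mem_filter] at hk ⊢
    refine ⟨hk.1, ?_⟩
    rw [abs_div, abs_of_pos hρ, div_le_iff₀ hρ]
    exact hk.2.le

/-- The logarithmic excess of the growth over its value on the spectrum. -/
noncomputable def excess (p : ZMod q) (ρ : ℝ) : ℝ := log (growth p ρ) - log (growth p 0)

lemma excess_le {p r : ZMod q} (hr : p * r = 1) {ρ : ℝ} (hρ : 0 ≤ ρ) (hρ1 : ρ ≤ 1) :
    excess p ρ ≤ q * log 10 := by
  have h1 := Real.log_le_log (one_pos.trans_le (one_le_growth hr hρ)) (growth_le_pow p hρ hρ1)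
  rw [Real.log_pow] at h1
  have h2 := Real.log_nonneg (one_le_growth hr le_rfl)
  rw [excess]; linarith

lemma exists_excess_le {p r : ZMod q} (hr : p * r = 1) :
    ∃ C : ℝ, 0 ≤ C ∧ ∀ ρ, 0 < ρ → ρ ≤ 1 → excess p ρ ≤ C * ρ := by
  obtain ⟨C, hC, h⟩ := exists_growth_le p
  refine ⟨C, hC, fun ρ hρ hρ1 => ?_⟩
  have h0 := one_le_growth hr (le_refl (0 : ℝ))
  have hS := one_le_growth hr hρ.le
  have h0' : 0 < growth p 0 := by linarith
  rw [excess, ← Real.log_div (by linarith) h0'.ne']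
  have h1 := Real.log_le_sub_one_of_pos (x := growth p ρ / growth p 0) (by positivity)
  have h2 : growth p ρ / growth p 0 ≤ 1 + C * ρ := by
    rw [div_le_iff₀ h0']
    have := h ρ hρ hρ1
    nlinarith [mul_nonneg hC hρ.le]
  linarith

/-- Arithmetic condition on a residue modelling a badly approximable rotation number. -/
def Bad (p : ZMod q) (κ : ℝ) : Prop :=
  ∀ (j : ℤ) (i : ℕ), 1 ≤ i → i < q → (j * p : ZMod q) = i → κ * q ≤ |(j : ℝ)| * i

lemma exponent_le {q i l l' L κ : ℝ} (hq : 0 < q) (hi : 0 < i) (hl : 0 < l)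
    (hκ : l = 10 ^ 9 / κ) (hL : i * l / 2 ≤ L) (hl' : l' ≤ 4 * l) :
    256 * i * l' * (2 * π / q) ^ 2 / (L / (8 * q)) ^ 2 ≤ 0.0105 * (κ / i) := by
  have hM : 0 < i * l := by positivity
  have hL0 : 0 < L := by linarith
  have hκ0 : 0 < κ := by
    rw [hκ] at hl
    exact (div_pos_iff_of_pos_left (by norm_num)).1 hl
  have e : 256 * i * l' * (2 * π / q) ^ 2 / (L / (8 * q)) ^ 2
      = 65536 * i * l' * π ^ 2 / L ^ 2 := by
    field_simp
    ring
  have hπ : π ^ 2 ≤ 10 := by nlinarith [pi_lt_d2, pi_pos]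
  have e2 : κ / i = 10 ^ 9 / (i * l) := by rw [hκ]; field_simp
  have hM2 : (i * l) ^ 2 / 4 ≤ L ^ 2 := by nlinarith
  rw [e, e2, ← mul_div_assoc, div_le_div_iff₀ (by positivity) hM]
  calc 65536 * i * l' * π ^ 2 * (i * l)
      ≤ 65536 * i * (4 * l) * π ^ 2 * (i * l) := by gcongr
    _ ≤ 65536 * i * (4 * l) * 10 * (i * l) := by gcongr
    _ = 10485760 * ((i * l) ^ 2 / 4) := by ring
    _ ≤ 10485760 * L ^ 2 := by gcongr
    _ ≤ 0.0105 * 10 ^ 9 * L ^ 2 := by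
      have := sq_nonneg L
      linarith

set_option maxHeartbeats 1000000 in
lemma false_of_excess_jump {p r : ZMod q} (hr : p * r = 1) {κ K ρ L : ℝ} (hκ : 0 < κ)
    (hκ1 : κ ≤ 1 / 2) (hbad : Bad p κ) (hK0 : 0 < K) (hK : log K = 10 ^ 9 / κ) (hρ : 0 < ρ)
    (hρ1 : ρ ≤ 1) (hL : excess p ρ = L) (hLpos : 0 < L) (hLq : L ≤ q * log 10)
    (hup : excess p (K * ρ) ≤ 2 * L) (hdown : excess p (ρ / K ^ 3) ≤ L / 8) : False := by
  have hq0 : (0 : ℝ) < q := Nat.cast_pos.2 (NeZero.pos q)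
  have hlK : 2 * 10 ^ 9 ≤ log K := by
    rw [hK, le_div_iff₀ hκ]; nlinarith
  have hK1 : 1 < K := by
    have := Real.log_le_sub_one_of_pos hK0
    linarith
  obtain ⟨E₀, hE₀, t, ht, hcirc, hcard⟩ :=
    exists_good_circle (by linarith : 1000 ≤ log K) hK0 hρ hL hup
  obtain ⟨E₁, hE₁, hE₁'⟩ := exists_mem_bands_abs_sub_lt hE₀ (show ρ < t * ρ by nlinarith [ht.1])
  rw [abs_sub_comm] at hE₁'
  set i := (Finset.univ.filter fun k => |eig p k - E₀| < t * ρ).card with hi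
  set ρ' := ρ / K ^ 3 with hρ'
  have hK3 : 1 ≤ K ^ 3 := one_le_pow₀ hK1.le
  have hρ'0 : 0 < ρ' := by positivity
  have hρ'ρ : ρ' ≤ ρ := div_le_self hρ.le hK3
  set δ := (exp (256 * i * log (t * ρ / ρ') * (2 * π / q) ^ 2 / (L / (8 * q)) ^ 2) - 1) / 3 with hδ
  have hg' : 0 < growth p ρ' := one_pos.trans_le (one_le_growth hr hρ'0.le)
  have hlog : ∀ ζ ∈ Metric.sphere (E₀ : ℂ) (t * ρ),
      log (growth p ρ') + 3 * L / 8 ≤ log ‖charDet p ζ‖ := fun ζ hζ => by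
    have h1 := (hcirc ζ hζ).2
    rw [excess] at hdown
    linarith
  have hout : ∀ ζ ∈ Metric.sphere (E₀ : ℂ) (t * ρ), ζ ∈ outer p ρ' := fun ζ hζ => by
    have h3 := hlog ζ hζ
    refine ⟨?_, (Real.log_le_log_iff hg' (norm_pos_iff.2 (hcirc ζ hζ).1)).1 (by linarith)⟩
    have h1 := abs_le_of_infDist_le hE₀
    rw [mem_sphere_iff_norm] at hζ
    have h2 := norm_le_norm_sub_add ζ (E₀ : ℂ)
    rw [hζ, Complex.norm_real, Real.norm_eq_abs] at h2
    nlinarith [ht.2]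
  have hwidth : ∀ ζ ∈ Metric.sphere (E₀ : ℂ) (t * ρ),
      L / (8 * q) ≤ stripWidth p ρ' ζ / 2 := fun ζ hζ => by
    have := hlog ζ hζ
    rw [stripWidth, div_div, div_le_div_iff₀ (by positivity) (by positivity)]
    nlinarith
  obtain ⟨hi1, hmain⟩ := norm_stdAddChar_pow_sub_one_le hr (ρ := ρ') (s := t * ρ) (Y := L / (8 * q))
    (E₀ := E₀) (E₁ := E₁) hρ'0 (hρ'ρ.trans hρ1) (by nlinarith [ht.1]) (by positivity) hE₁
    (by rwa [abs_sub_comm] at hE₁' ⊢)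
    hout hwidth hi hδ
  have hi0 : (1 : ℝ) ≤ i := by exact_mod_cast hi1
  have hi0' : (0 : ℝ) < i := by linarith
  have hLi : i * log K / 2 ≤ L := by linarith
  have hLbig : 10 ^ 9 ≤ L := by nlinarith
  have hiq : i < q := by
    have h10 : log 10 ≤ 9 := by
      have := Real.log_le_sub_one_of_pos (show (0 : ℝ) < 10 by norm_num)
      linarith
    have : (i : ℝ) * (2 * 10 ^ 9) ≤ 18 * q := by nlinarith
    have : (i : ℝ) < q := by nlinarith
    exact_mod_cast this
  have hlogs : log (t * ρ / ρ') ≤ 4 * log K := by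
    have e : t * ρ / ρ' = t * K ^ 3 := by rw [hρ']; field_simp
    have ht0 : 0 < t := by linarith [ht.1]
    rw [e, Real.log_mul ht0.ne' (by positivity), Real.log_pow]
    have := Real.log_le_sub_one_of_pos ht0
    have := ht.2
    push_cast
    linarith
  have hX := exponent_le hq0 hi0' (by linarith : 0 < log K) hK hLi hlogs
  have hκi : κ / i ≤ 1 / 2 := by
    rw [div_le_iff₀ hi0']; nlinarith
  have hκi0 : 0 < κ / i := by positivity
  set X := 256 * i * log (t * ρ / ρ') * (2 * π / q) ^ 2 / (L / (8 * q)) ^ 2 with hXdef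
  have hX0 : 0 ≤ X := by
    have : 0 ≤ log (t * ρ / ρ') := Real.log_nonneg (by
      rw [le_div_iff₀ hρ'0]; nlinarith [ht.1])
    positivity
  have hexp : exp X - 1 ≤ 2 * X := by
    have := Real.abs_exp_sub_one_le (x := X) (by rw [abs_of_nonneg hX0]; linarith)
    rw [abs_of_nonneg hX0] at this
    exact (le_abs_self _).trans this
  have hδ' : δ ≤ 0.01 * (κ / i) := by rw [hδ]; linarith
  have hfin := hmain (by
    rw [← mul_div_assoc, div_le_div_iff₀ hq0 (by positivity)]
    nlinarith [pi_lt_d2, pi_pos]) (by linarith)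
  have h1 : (ZMod.stdAddChar r : ℂ) ^ i = ZMod.stdAddChar ((i : ZMod q) * r) := by
    rw [← nsmul_eq_mul, AddChar.map_nsmul_eq_pow]
  rw [h1] at hfin
  have h2 := le_norm_stdAddChar_sub_one ((i : ZMod q) * r)
  have h3 := hbad ((i : ZMod q) * r).valMinAbs i hi1 hiq (by
    rw [ZMod.coe_valMinAbs, mul_assoc, mul_comm r, hr, mul_one])
  have h4 : 4 * (κ / i) ≤ 4 * |(((i : ZMod q) * r).valMinAbs : ℝ)| / q := by
    rw [← mul_div_assoc, div_le_div_iff₀ hi0' hq0]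
    linarith
  linarith

/-- Geometric decay of the excess along the scales `K ^ (-k)`. -/
lemma excess_le_of_bad {p r : ZMod q} (hr : p * r = 1) {κ K : ℝ} (hκ : 0 < κ)
    (hκ1 : κ ≤ 1 / 2) (hbad : Bad p κ) (hK : K = exp (10 ^ 9 / κ)) (k : ℕ) :
    excess p ((K ^ k)⁻¹) * 2 ^ k ≤ q * log 10 := by
  have hK0 : 0 < K := hK ▸ exp_pos _
  have hlK : log K = 10 ^ 9 / κ := by rw [hK, Real.log_exp]
  have hK4 : 4 < K := by
    have h1 := Real.log_le_sub_one_of_pos hK0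
    have h2 : 2 * 10 ^ 9 ≤ log K := by
      rw [hlK, le_div_iff₀ hκ]; nlinarith
    linarith
  have hone : ∀ k : ℕ, (K ^ k)⁻¹ ≤ 1 := fun k => inv_le_one_of_one_le₀ (one_le_pow₀ (by linarith))
  have hq0 : (0 : ℝ) ≤ q * log 10 := by
    have := Real.log_nonneg (show (1 : ℝ) ≤ 10 by norm_num); positivity
  by_contra hlt
  push Not at hlt
  set b : ℕ → ℝ := fun k => excess p ((K ^ k)⁻¹) * 2 ^ k with hb
  have hbpos : 0 < b k := hq0.trans_lt hlt
  obtain ⟨C, hC, hCb⟩ := exists_excess_le hr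
  have hlim : Filter.Tendsto (fun k : ℕ => C * (2 / K) ^ k) Filter.atTop (nhds (C * 0)) :=
    (tendsto_pow_atTop_nhds_zero_of_lt_one (by positivity)
      (by rw [div_lt_one hK0]; linarith)).const_mul C
  rw [mul_zero] at hlim
  obtain ⟨N, hN⟩ := Filter.eventually_atTop.1 (hlim.eventually_lt_const hbpos)
  have hbN : ∀ n ≥ N, b n < b k := fun n hn => by
    refine lt_of_le_of_lt ?_ (hN n hn)
    have := hCb ((K ^ n)⁻¹) (by positivity) (hone n)
    calc b n ≤ C * (K ^ n)⁻¹ * 2 ^ n := by exact mul_le_mul_of_nonneg_right this (by positivity)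
      _ = C * (2 / K) ^ n := by rw [div_pow]; ring
  obtain ⟨m, hm, hmax⟩ := Finset.exists_max_image (Finset.range (max N k + 1)) b ⟨0, by simp⟩
  have hkm : b k ≤ b m := hmax k (by simp)
  have hall : ∀ n, b n ≤ b m := fun n => by
    by_cases hn : n < max N k + 1
    · exact hmax n (by simpa using hn)
    · push Not at hn
      exact ((hbN n ((le_max_left N k).trans (by lia))).trans_le hkm).le
  have hm0 : m ≠ 0 := by
    rintro rfl
    have h1 : b 0 ≤ q * log 10 := by
      have := excess_le hr (ρ := 1) zero_le_one le_rfl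
      simpa [hb] using this
    linarith
  obtain ⟨m, rfl⟩ := Nat.exists_eq_succ_of_ne_zero hm0
  have hbm : 0 < b (m + 1) := hbpos.trans_le hkm
  have hLpos : 0 < excess p ((K ^ (m + 1))⁻¹) := by
    by_contra h; push Not at h
    exact hbm.not_ge (mul_nonpos_of_nonpos_of_nonneg h (by positivity))
  refine false_of_excess_jump hr hκ hκ1 hbad hK0 hlK (ρ := (K ^ (m + 1))⁻¹) (by positivity)
    (hone _) rfl hLpos (excess_le hr (by positivity) (hone _)) ?_ ?_
  · have e : K * (K ^ (m + 1))⁻¹ = (K ^ m)⁻¹ := by rw [pow_succ]; field_simp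
    rw [e]
    have h1 := hall m
    simp only [hb, pow_succ (2 : ℝ)] at h1
    have h2 : (0 : ℝ) < 2 ^ m := by positivity
    rw [← mul_le_mul_iff_left₀ h2]
    linarith
  · have e : (K ^ (m + 1))⁻¹ / K ^ 3 = (K ^ (m + 1 + 3))⁻¹ := by
      rw [pow_add K (m + 1) 3, mul_inv]; rfl
    rw [e]
    have h1 := hall (m + 1 + 3)
    simp only [hb, pow_add (2 : ℝ) (m + 1) 3, Nat.succ_eq_add_one] at h1
    have h2 : (0 : ℝ) < 2 ^ (m + 1) := by positivity
    rw [← mul_le_mul_iff_left₀ h2]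
    linarith

end Claim
end CritAM

namespace CritAM

section Count
variable {q : ℕ} [NeZero q]

lemma pow_card_mul_norm_charDet_le (p : ZMod q) {K ρ E : ℝ} (hK : 2 ≤ K) (hρ : 0 ≤ ρ) :
    (K / 2) ^ (Finset.univ.filter fun j => |eig p j - E| ≤ ρ).card
        * ‖charDet p (E + ρ * Complex.I)‖ ≤ ‖charDet p (E + (K * ρ : ℝ) * Complex.I)‖ := by
  rw [norm_charDet, norm_charDet, ← Finset.prod_const, Finset.prod_filter,
    ← Finset.prod_mul_distrib]
  refine Finset.prod_le_prod (fun j _ => ?_) fun j _ => ?_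
  · split_ifs <;> positivity
  · split_ifs with h
    · refine le_of_sq_le_sq ?_ (norm_nonneg _)
      rw [mul_pow, normSq_vertical, normSq_vertical]
      have h1 : (E - eig p j) ^ 2 ≤ ρ ^ 2 := sq_le_sq.2 (by rwa [abs_sub_comm, abs_of_nonneg hρ])
      have h2 := sq_nonneg (E - eig p j)
      calc (K / 2) ^ 2 * ((E - eig p j) ^ 2 + ρ ^ 2) ≤ (K / 2) ^ 2 * (ρ ^ 2 + ρ ^ 2) := by gcongr
        _ ≤ (E - eig p j) ^ 2 + (K * ρ) ^ 2 := by nlinarith [sq_nonneg (K * ρ)]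
    · rw [one_mul]
      refine norm_vertical_le ?_
      rw [abs_of_nonneg hρ, abs_of_nonneg (by positivity)]
      nlinarith

/-- Few eigenvalues lie in a short interval. -/
lemma card_mul_log_le {p r : ZMod q} (hr : p * r = 1) {κ K : ℝ} (hκ : 0 < κ)
    (hκ1 : κ ≤ 1 / 2) (hbad : Bad p κ) (hK : K = exp (10 ^ 9 / κ)) (k : ℕ)
    (hq : 4 ≤ exp (q * ((K ^ (k + 1))⁻¹ / 16))) (E : ℝ) :
    ((Finset.univ.filter fun j => |eig p j - E| ≤ (K ^ (k + 1))⁻¹).card : ℝ) * log (K / 2)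
      ≤ log 8 + q * log 10 / 2 ^ k := by
  have hK0 : 0 < K := hK ▸ exp_pos _
  have hK2 : 2 ≤ K := by
    have h1 := Real.log_le_sub_one_of_pos hK0
    have h2 : 2 * 10 ^ 9 ≤ log K := by
      rw [hK, Real.log_exp, le_div_iff₀ hκ]; nlinarith
    linarith
  set ρ := (K ^ (k + 1))⁻¹ with hρ
  have hρ0 : 0 < ρ := by positivity
  have hρ1 : ρ ≤ 1 := inv_le_one_of_one_le₀ (one_le_pow₀ (by linarith))
  have hKρ : K * ρ = (K ^ k)⁻¹ := by rw [hρ, pow_succ]; field_simp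
  set n := (Finset.univ.filter fun j => |eig p j - E| ≤ ρ).card with hn
  rcases Nat.eq_zero_or_pos n with h0 | hpos
  · rw [h0, Nat.cast_zero, zero_mul]
    have h8 : 0 ≤ log 8 := Real.log_nonneg (by norm_num)
    have h10 : 0 ≤ log 10 := Real.log_nonneg (by norm_num)
    positivity
  obtain ⟨j, hj⟩ := Finset.card_pos.1 hpos
  rw [Finset.mem_filter] at hj
  have hinf : Metric.infDist E (bands p) ≤ K * ρ := by
    refine (Metric.infDist_le_dist_of_mem (eig_mem_bands p j)).trans ?_
    rw [dist_comm, Real.dist_eq]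
    nlinarith [hj.2]
  have h1 := norm_charDet_le_growth hinf (le_of_eq (abs_of_nonneg (by positivity : 0 ≤ K * ρ)))
  have h2 := norm_charDet_ge hr (ζ := E + ρ * Complex.I) hρ0 hρ1 fun E' _ => by
    have := Complex.abs_im_le_norm ((E : ℂ) + ρ * Complex.I - E')
    simpa [abs_of_pos hρ0] using this
  have h3 := pow_card_mul_norm_charDet_le p (E := E) hK2 hρ0.le
  have hpow : 0 ≤ (K / 2) ^ n := by positivity
  have h4 : (K / 2) ^ n ≤ growth p (K * ρ) := by
    refine le_trans ?_ (h3.trans h1)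
    exact le_mul_of_one_le_right hpow (by linarith)
  have h5 := Real.log_le_log (by positivity) h4
  rw [Real.log_pow] at h5
  have h6 := excess_le_of_bad hr hκ hκ1 hbad hK k
  rw [← hKρ, ← le_div_iff₀ (by positivity), excess] at h6
  have h7 := Real.log_le_log (one_pos.trans_le (one_le_growth hr le_rfl)) (growth_zero_le hr)
  linarith

end Count

/-- A closed set approximated by the points of finite configurations without concentration has
positive Hausdorff dimension. -/
lemma dimH_pos_of_configurations {ι : ℕ → Type*} [∀ n, Fintype (ι n)] (e : ∀ n, ι n → ℝ)
    {σ : Set ℝ} (hσ : IsClosed σ) {R K c : ℝ} (hι : ∀ n, Nonempty (ι n)) (hK : 1 < K) (hc : 0 ≤ c)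
    (hR : ∀ n j, |e n j| ≤ R)
    (hcount : ∀ k : ℕ, ∀ᶠ n in Filter.atTop, ∀ E : ℝ,
      ((Finset.univ.filter fun j => |e n j - E| ≤ (K ^ (k + 1))⁻¹).card : ℝ)
        ≤ c / 2 ^ k * Fintype.card (ι n))
    (happrox : ∀ ε > 0, ∀ᶠ n in Filter.atTop, ∀ j, ∃ x ∈ σ, |e n j - x| ≤ ε) :
    0 < dimH σ := by
  classical
  let f : ℕ → ℝ → ℝ := fun n x =>
    ((Finset.univ.filter fun j => e n j ≤ x).card : ℝ) / Fintype.card (ι n)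
  have hcard : ∀ n, (0 : ℝ) < Fintype.card (ι n) := fun n => by
    have := hι n
    exact Nat.cast_pos.2 Fintype.card_pos
  have hf01 : ∀ n x, f n x ∈ Set.Icc (0 : ℝ) 1 := fun n x =>
    ⟨by positivity, (div_le_one (hcard n)).2 (Nat.cast_le.2 (Finset.card_le_univ _))⟩
  let U : Ultrafilter ℕ := Filter.hyperfilter ℕ
  have hU : (U : Filter ℕ) ≤ Filter.atTop := Nat.hyperfilter_le_atTop
  have hlim : ∀ x, ∃ y ∈ Set.Icc (0 : ℝ) 1, Filter.Tendsto (fun n => f n x) U (nhds y) := fun x =>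
    isCompact_Icc.ultrafilter_le_nhds (U.map fun n => f n x)
      (Filter.le_principal_iff.2 (Filter.univ_mem' (f := (U : Filter ℕ)) fun n => hf01 n x))
  choose F hF01 hF using hlim
  have hsub : ∀ n x y, x ≤ y → f n y - f n x
      = ((Finset.univ.filter fun j => x < e n j ∧ e n j ≤ y).card : ℝ) / Fintype.card (ι n) := by
    intro n x y hxy
    have h : (Finset.univ.filter fun j => e n j ≤ y)
        = (Finset.univ.filter fun j => e n j ≤ x) ∪
          (Finset.univ.filter fun j => x < e n j ∧ e n j ≤ y) := by
      ext j
      simp only [Finset.mem_filter, Finset.mem_univ, true_and, Finset.mem_union]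
      constructor
      · intro h
        rcases le_or_gt (e n j) x with h' | h'
        · exact Or.inl h'
        · exact Or.inr ⟨h', h⟩
      · rintro (h | h)
        · exact h.trans hxy
        · exact h.2
    have hd : Disjoint (Finset.univ.filter fun j => e n j ≤ x)
        (Finset.univ.filter fun j => x < e n j ∧ e n j ≤ y) := by
      rw [Finset.disjoint_filter]
      intro j _ h1 h2
      exact absurd h1 (not_le.2 h2.1)
    simp only [f]
    rw [h, Finset.card_union_of_disjoint hd, ← sub_div]
    push_cast
    ring
  have hmono : Monotone F := fun x y hxy =>
    le_of_tendsto_of_tendsto' (hF x) (hF y) fun n => by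
      rw [← sub_nonneg, hsub n x y hxy]; positivity
  have hstep : ∀ (k : ℕ) (x y : ℝ), x ≤ y → y - x ≤ (K ^ (k + 1))⁻¹ → F y - F x ≤ c / 2 ^ k := by
    intro k x y hxy hk
    refine le_of_tendsto ((hF y).sub (hF x)) (hU ?_)
    filter_upwards [hcount k] with n hn
    rw [hsub n x y hxy, div_le_iff₀ (hcard n)]
    refine le_trans (Nat.cast_le.2 (Finset.card_le_card fun j hj => ?_)) (hn y)
    rw [Finset.mem_filter] at hj ⊢
    exact ⟨hj.1, abs_le.2 ⟨by linarith [hj.2.1], by linarith [hj.2.2, sub_nonneg.2 hxy]⟩⟩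
  have hlogK : 0 < log K := Real.log_pos hK
  have hlog2 : 0 < log 2 := Real.log_pos one_lt_two
  set α : ℝ := log 2 / log K with hα
  have hα0 : 0 < α := by positivity
  have hKα : K ^ α = 2 := by
    rw [Real.rpow_def_of_pos (by linarith), hα, mul_div_cancel₀ _ hlogK.ne',
      Real.exp_log two_pos]
  have hpowα : ∀ k : ℕ, ((K ^ k)⁻¹) ^ α = (2 ^ k)⁻¹ := fun k => by
    rw [Real.inv_rpow (by positivity), ← Real.rpow_natCast, ← Real.rpow_mul (by linarith), mul_comm,
      Real.rpow_mul (by linarith), hKα, Real.rpow_natCast]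
  have hhol : ∀ x y, x ≤ y → F y - F x ≤ (4 * c + 2) * (y - x) ^ α := by
    intro x y hxy
    rcases hxy.eq_or_lt with rfl | hlt
    · simp [Real.zero_rpow hα0.ne']
    have hyx : 0 < y - x := sub_pos.2 hlt
    have hpos : 0 < (y - x) ^ α := by positivity
    by_cases h : y - x ≤ (K ^ 1)⁻¹
    · obtain ⟨k, hk1, hk2⟩ : ∃ k : ℕ, y - x ≤ (K ^ (k + 1))⁻¹ ∧ (K ^ (k + 2))⁻¹ < y - x := by
        have hex : ∃ m : ℕ, (K ^ (m + 2))⁻¹ < y - x := by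
          obtain ⟨m, hm⟩ := exists_pow_lt_of_lt_one hyx (inv_lt_one_of_one_lt₀ hK)
          refine ⟨m, lt_of_le_of_lt ?_ hm⟩
          rw [← inv_pow]
          exact pow_le_pow_of_le_one (by positivity) (inv_lt_one_of_one_lt₀ hK).le (by lia)
        refine ⟨Nat.find hex, ?_, Nat.find_spec hex⟩
        rcases Nat.eq_zero_or_pos (Nat.find hex) with h0 | hp
        · rw [h0]; exact h
        · have := Nat.find_min hex (m := Nat.find hex - 1) (by lia)
          rw [not_lt] at this
          rwa [show Nat.find hex - 1 + 2 = Nat.find hex + 1 by lia] at this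
      have h1 := hstep k x y hxy hk1
      have h2 := Real.rpow_le_rpow (by positivity) hk2.le hα0.le
      rw [hpowα] at h2
      have h3 : c / 2 ^ k = 4 * c * (2 ^ (k + 2))⁻¹ := by
        rw [pow_add]; field_simp; norm_num
      rw [h3] at h1
      have h4 : 4 * c * (2 ^ (k + 2))⁻¹ ≤ 4 * c * (y - x) ^ α := by gcongr
      linarith
    · push Not at h
      have h2 := Real.rpow_le_rpow (by positivity) h.le hα0.le
      rw [hpowα] at h2
      have h3 := (hF01 y).2
      have h4 := (hF01 x).1
      nlinarith
  have hHolder : HolderOnWith (4 * c + 2).toNNReal α.toNNReal F σ := by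
    intro x _ y _
    have key : dist (F x) (F y) ≤ (4 * c + 2) * dist x y ^ α := by
      rcases le_total x y with hxy | hxy
      · rw [dist_comm, dist_comm x, Real.dist_eq, Real.dist_eq,
          abs_of_nonneg (sub_nonneg.2 (hmono hxy)), abs_of_nonneg (sub_nonneg.2 hxy)]
        exact hhol x y hxy
      · rw [Real.dist_eq, Real.dist_eq,
          abs_of_nonneg (sub_nonneg.2 (hmono hxy)), abs_of_nonneg (sub_nonneg.2 hxy)]
        exact hhol y x hxy
    rw [edist_dist, edist_dist, Real.coe_toNNReal _ hα0.le,
      ENNReal.ofReal_rpow_of_nonneg dist_nonneg hα0.le]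
    refine (ENNReal.ofReal_le_ofReal key).trans_eq ?_
    rw [ENNReal.ofReal_mul (by positivity)]
    rfl
  have hcont : Continuous F := by
    have hz : Filter.Tendsto (fun k : ℕ => c / 2 ^ k) Filter.atTop (nhds 0) := by
      have := (tendsto_pow_atTop_nhds_zero_of_lt_one (r := (1 / 2 : ℝ)) (by norm_num)
        (by norm_num)).const_mul c
      rw [mul_zero] at this
      refine this.congr fun k => ?_
      rw [one_div, inv_pow]; rfl
    refine Metric.continuous_iff.2 fun x ε hε => ?_
    obtain ⟨k, hk⟩ := (hz.eventually_lt_const hε).exists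
    refine ⟨(K ^ (k + 1))⁻¹, by positivity, fun y hy => ?_⟩
    rw [Real.dist_eq] at hy ⊢
    rcases le_total x y with hxy | hxy
    · rw [abs_of_nonneg (sub_nonneg.2 hxy)] at hy
      rw [abs_of_nonneg (sub_nonneg.2 (hmono hxy))]
      exact (hstep k x y hxy hy.le).trans_lt hk
    · rw [abs_sub_comm, abs_of_nonneg (sub_nonneg.2 hxy)] at hy
      rw [abs_sub_comm, abs_of_nonneg (sub_nonneg.2 (hmono hxy))]
      exact (hstep k y x hxy hy.le).trans_lt hk
  have hlow : ∀ x, x < -R → F x = 0 := fun x hx => by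
    refine tendsto_nhds_unique (hF x) (tendsto_const_nhds.congr fun n => ?_)
    simp only [f]
    rw [Finset.filter_false_of_mem, Finset.card_empty, Nat.cast_zero, zero_div]
    intro j _
    have := (abs_le.1 (hR n j)).1
    linarith
  have hhigh : ∀ x, R ≤ x → F x = 1 := fun x hx => by
    refine tendsto_nhds_unique (hF x) (tendsto_const_nhds.congr fun n => ?_)
    simp only [f]
    rw [Finset.filter_true_of_mem, Finset.card_univ, div_self (hcard n).ne']
    intro j _
    have := (abs_le.1 (hR n j)).2
    linarith
  have hsurj : Set.Ioo (0 : ℝ) 1 ⊆ F '' σ := by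
    intro t ht
    have hne : (F ⁻¹' {t}).Nonempty := by
      obtain ⟨x, hx⟩ := intermediate_value_univ (-|R| - 1) |R| hcont
        (show t ∈ Set.Icc _ _ by
          rw [hlow _ (by linarith [neg_abs_le R, le_abs_self R, neg_le_abs R]),
            hhigh _ (le_abs_self R)]
          exact ⟨ht.1.le, ht.2.le⟩)
      exact ⟨x, hx⟩
    have hbdd : BddBelow (F ⁻¹' {t}) := by
      refine ⟨-R, fun x hx' => ?_⟩
      by_contra hlt
      push Not at hlt
      have h1 : F x = t := hx'
      rw [hlow x hlt] at h1
      exact ht.1.ne h1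
    have hcl : IsClosed (F ⁻¹' {t}) := isClosed_singleton.preimage hcont
    have hx := hcl.csInf_mem hne hbdd
    set x := sInf (F ⁻¹' {t}) with hxdef
    refine ⟨x, ?_, hx⟩
    by_contra hxσ
    obtain ⟨ε, hε, hball⟩ := Metric.isOpen_iff.1 hσ.isOpen_compl x hxσ
    have heq : F (x - ε / 2) = t := by
      have hx' : F x = t := hx
      rw [← hx']
      refine tendsto_nhds_unique (hF (x - ε / 2)) ((hF x).congr' (hU ?_))
      filter_upwards [happrox (ε / 4) (by positivity)] with n hn
      rw [← sub_eq_zero, hsub n _ _ (by linarith), Finset.filter_false_of_mem, Finset.card_empty,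
        Nat.cast_zero, zero_div]
      rintro j - ⟨h1, h2⟩
      obtain ⟨y, hy, hyj⟩ := hn j
      refine hball (a := y) ?_ hy
      rw [Metric.mem_ball, Real.dist_eq]
      rw [abs_le] at hyj
      rw [abs_lt]
      constructor <;> linarith [hyj.1, hyj.2]
    have := csInf_le hbdd (show x - ε / 2 ∈ F ⁻¹' {t} from heq)
    linarith
  by_contra h0
  have h0' : dimH σ = 0 := le_antisymm (not_lt.1 h0) zero_le
  have h1 := hHolder.dimH_image_le (Real.toNNReal_pos.2 hα0)
  rw [h0', ENNReal.zero_div] at h1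
  have h2 := dimH_mono hsurj
  rw [Real.dimH_of_nonempty_interior (by rw [interior_Ioo]; exact Set.nonempty_Ioo.2 one_pos)] at h2
  exact absurd (h2.trans h1) (by simp)

end CritAM

namespace CritAM

lemma summable_normSq (u : lp (fun _ : ℤ => ℂ) 2) : Summable fun n => ‖u n‖ ^ 2 := by
  have := (lp.memℓp u).summable (by norm_num)
  simpa using this

lemma norm_sq_eq_tsum (u : lp (fun _ : ℤ => ℂ) 2) : ‖u‖ ^ 2 = ∑' n, ‖u n‖ ^ 2 := by
  have := lp.norm_rpow_eq_tsum (p := 2) (by norm_num) u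
  simpa using this

lemma summable_mul_conj_shift {a b : ℤ → ℂ} (ha : Summable fun n => ‖a n‖ ^ 2)
    (hb : Summable fun n => ‖b n‖ ^ 2) (k : ℤ) :
    Summable fun n => b n * (starRingEnd ℂ) (a (n + k)) := by
  have h1 : Summable fun n : ℤ => ‖a (n + k)‖ ^ 2 := (Equiv.addRight k).summable_iff.2 ha
  refine Summable.of_norm_bounded (h1.add hb) fun n => ?_
  rw [norm_mul, RCLike.norm_conj]
  nlinarith [sq_nonneg (‖a (n + k)‖ - ‖b n‖), sq_nonneg ‖a (n + k)‖, sq_nonneg ‖b n‖]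

lemma tsum_mul_conj_shift (a b : ℤ → ℂ) (k : ℤ) :
    ∑' n, b n * (starRingEnd ℂ) (a (n + k)) = ∑' n, b (n + -k) * (starRingEnd ℂ) (a n) := by
  rw [← (Equiv.addRight (-k)).tsum_eq fun n : ℤ => b n * (starRingEnd ℂ) (a (n + k))]
  simp

lemma tsum_action_symm {a b : ℤ → ℂ} (ha : Summable fun n => ‖a n‖ ^ 2)
    (hb : Summable fun n => ‖b n‖ ^ 2) (V : ℤ → ℝ)
    (h₁ : Summable fun n => b n * (starRingEnd ℂ) (a (n + 1) + a (n - 1) + V n * a n))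
    (h₂ : Summable fun n => (b (n + 1) + b (n - 1) + V n * b n) * (starRingEnd ℂ) (a n)) :
    ∑' n, b n * (starRingEnd ℂ) (a (n + 1) + a (n - 1) + V n * a n)
      = ∑' n, (b (n + 1) + b (n - 1) + V n * b n) * (starRingEnd ℂ) (a n) := by
  have s₁ := summable_mul_conj_shift ha hb
  have s₂ : ∀ k : ℤ, Summable fun n => b (n + k) * (starRingEnd ℂ) (a n) := fun k => by
    have h : (fun n : ℤ => b (n + k) * (starRingEnd ℂ) (a n))
        = (fun n => b n * (starRingEnd ℂ) (a (n + -k))) ∘ Equiv.addRight k := by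
      funext n; simp
    rw [h]
    exact (Equiv.addRight k).summable_iff.2 (s₁ (-k))
  have key : ∑' n, b n * (starRingEnd ℂ) (a (n + 1) + a (n - 1) + V n * a n)
        - ∑' n, (b n * (starRingEnd ℂ) (a (n + 1)) + b n * (starRingEnd ℂ) (a (n + -1)))
      = ∑' n, (b (n + 1) + b (n - 1) + V n * b n) * (starRingEnd ℂ) (a n)
        - ∑' n, (b (n + 1) * (starRingEnd ℂ) (a n) + b (n + -1) * (starRingEnd ℂ) (a n)) := by
    rw [← h₁.tsum_sub ((s₁ 1).add (s₁ (-1))), ← h₂.tsum_sub ((s₂ 1).add (s₂ (-1)))]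
    refine tsum_congr fun n => ?_
    simp only [map_add, map_mul, Complex.conj_ofReal, sub_eq_add_neg n]
    ring
  rw [(s₁ 1).tsum_add (s₁ (-1)), (s₂ 1).tsum_add (s₂ (-1)), tsum_mul_conj_shift,
    tsum_mul_conj_shift, neg_neg, add_comm (∑' n, b (n + 1) * _)] at key
  exact sub_left_injective key

lemma isSelfAdjoint_of_action {V : ℤ → ℝ}
    {H : lp (fun _ : ℤ => ℂ) 2 →L[ℂ] lp (fun _ : ℤ => ℂ) 2}
    (hH : ∀ (u : lp (fun _ : ℤ => ℂ) 2) (n : ℤ),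
      H u n = u (n + 1) + u (n - 1) + (V n : ℂ) * u n) : IsSelfAdjoint H := by
  rw [ContinuousLinearMap.isSelfAdjoint_iff_isSymmetric]
  intro u v
  change inner ℂ (H u) v = inner ℂ u (H v)
  have h₁ := lp.summable_inner (𝕜 := ℂ) (H u) v
  have h₂ := lp.summable_inner (𝕜 := ℂ) u (H v)
  rw [lp.inner_eq_tsum, lp.inner_eq_tsum]
  simp only [RCLike.inner_apply, hH] at h₁ h₂ ⊢
  exact tsum_action_symm (summable_normSq u) (summable_normSq v) V h₁ h₂

lemma exists_mem_spectrum_near {X : Type*} [NormedAddCommGroup X] [InnerProductSpace ℂ X]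
    [CompleteSpace X] {H : X →L[ℂ] X} (hH : IsSelfAdjoint H) {E ε ε' : ℝ} {v : X} (hv : v ≠ 0)
    (h : ‖H v - (E : ℂ) • v‖ ≤ ε * ‖v‖) (hε : ε < ε') (hε' : 0 < ε') :
    ∃ x ∈ Complex.ofReal ⁻¹' spectrum ℂ H, |E - x| ≤ ε' := by
  by_contra hcon
  push Not at hcon
  have hdist : ∀ z ∈ spectrum ℂ H, ε' ≤ ‖(E : ℂ) - z‖ := by
    intro z hz
    have hre : z = (z.re : ℂ) := hH.mem_spectrum_eq_re hz
    have := hcon z.re (by rw [Set.mem_preimage, ← hre]; exact hz)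
    rw [hre, ← Complex.ofReal_sub, Complex.norm_real]
    exact this.le
  obtain ⟨b, hb1, -, hb⟩ := exists_inverse_norm_le hH.isStarNormal hε' hdist
  have h1 : b ((E : ℂ) • v - H v) = v := by
    have := congrArg (fun T : X →L[ℂ] X => T v) hb1
    simpa [Algebra.algebraMap_eq_smul_one] using this
  have h2 : ‖v‖ ≤ ε'⁻¹ * (ε * ‖v‖) := by
    calc ‖v‖ = ‖b ((E : ℂ) • v - H v)‖ := by rw [h1]
      _ ≤ ‖b‖ * ‖(E : ℂ) • v - H v‖ := b.le_opNorm _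
      _ ≤ ε'⁻¹ * (ε * ‖v‖) := by rw [norm_sub_rev]; gcongr
  have hvp : 0 < ‖v‖ := norm_pos_iff.2 hv
  rw [le_inv_mul_iff₀ hε'] at h2
  nlinarith

section Bloch
variable {q : ℕ} [NeZero q]

open scoped Matrix

/-- A periodic solution of the eigenvalue equation at rational frequency. -/
lemma exists_periodic_solution (P : ℤ) (k : ZMod q) :
    ∃ ψ : ℤ → ℂ, (∀ n, ψ (n + q) = ψ n) ∧ ψ ≠ 0 ∧ ∀ n : ℤ,
      ψ (n + 1) + ψ (n - 1) + ((2 * Real.cos (2 * π * (P / q) * n) : ℝ) : ℂ) * ψ n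
        = (eig (P : ZMod q) k : ℂ) * ψ n := by
  have hherm := harper_isHermitian (P : ZMod q) 0 0
  have hev := hherm.mulVec_eigenvectorBasis k
  have he : hherm.eigenvalues k = eig (P : ZMod q) k := rfl
  rw [he] at hev
  set φ : ZMod q → ℂ := ⇑(hherm.eigenvectorBasis k) with hφ
  have hφ0 : φ ≠ 0 := by
    intro h0
    have := hherm.eigenvectorBasis.orthonormal.ne_zero k
    refine this ?_
    ext i
    exact congrFun h0 i
  refine ⟨fun n => φ n, fun n => by simp, fun h0 => hφ0 ?_, fun n => ?_⟩
  · funext x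
    have := congrFun h0 (x.val : ℤ)
    simpa using this
  · have h := congrFun hev (n : ZMod q)
    have hs : ∀ r m : ZMod q, (shift r *ᵥ φ) m = φ (m - r) := by
      intro r m
      rw [Matrix.mulVec, dotProduct, Finset.sum_eq_single (m - r)]
      · simp [shift]
      · intro b _ hb
        have : m ≠ b + r := fun h => hb (by rw [h]; ring)
        simp [shift, this]
      · simp
    have hp : ∀ r m : ZMod q, (phase r *ᵥ φ) m = ZMod.stdAddChar (r * m) * φ m := by
      intro r m
      rw [phase, Matrix.mulVec_diagonal]
    simp only [harper, Complex.ofReal_zero, mul_zero, neg_zero, Complex.exp_zero, one_smul,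
      Matrix.add_mulVec, Pi.add_apply, hs, hp, Pi.smul_apply, sub_neg_eq_add] at h
    have hc : (ZMod.stdAddChar ((P : ZMod q) * (n : ZMod q)) : ℂ)
          + ZMod.stdAddChar (-(P : ZMod q) * (n : ZMod q))
        = ((2 * Real.cos (2 * π * (P / q) * n) : ℝ) : ℂ) := by
      have e1 : (P : ZMod q) * (n : ZMod q) = ((P * n : ℤ) : ZMod q) := by push_cast; ring
      have e2 : -(P : ZMod q) * (n : ZMod q) = ((-(P * n) : ℤ) : ZMod q) := by push_cast; ring
      rw [e1, e2, ZMod.stdAddChar_coe, ZMod.stdAddChar_coe]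
      push_cast
      rw [Complex.two_cos]
      congr 2
      · ring
      · ring
    push_cast at hc ⊢
    rw [← hc]
    rw [Complex.real_smul] at h
    refine Eq.trans ?_ h
    ring

end Bloch

end CritAM

namespace CritAM

lemma exists_forall_norm_le {q : ℕ} (hq : 0 < q) {ψ : ℤ → ℂ} (hψ : ∀ n, ψ (n + q) = ψ n) :
    ∃ l₀ : ℕ, l₀ < q ∧ ∀ n, ‖ψ n‖ ≤ ‖ψ l₀‖ := by
  obtain ⟨l₀, hl₀, hmax⟩ := Finset.exists_max_image (Finset.range q) (fun k : ℕ => ‖ψ k‖)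
    ⟨0, Finset.mem_range.2 hq⟩
  refine ⟨l₀, Finset.mem_range.1 hl₀, fun n => ?_⟩
  have hper : Function.Periodic ψ (q : ℤ) := hψ
  have hq' : (0 : ℤ) < q := by exact_mod_cast hq
  have h1 : ψ n = ψ (n % q) := by
    have := hper.int_mul (n / q) (n % q)
    rw [Int.cast_id, mul_comm, Int.emod_add_mul_ediv] at this
    exact this
  have h2 := Int.emod_nonneg n hq'.ne'
  have h3 := Int.emod_lt_of_pos n hq'
  obtain ⟨k, hk⟩ := Int.eq_ofNat_of_zero_le h2
  rw [h1, hk]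
  exact hmax k (Finset.mem_range.2 (by lia))

/-- Cutting off a periodic solution gives an approximate eigenvector. -/
lemma exists_approx_eigenvector {V W : ℤ → ℝ}
    {H : lp (fun _ : ℤ => ℂ) 2 →L[ℂ] lp (fun _ : ℤ => ℂ) 2}
    (hH : ∀ (u : lp (fun _ : ℤ => ℂ) 2) (n : ℤ),
      H u n = u (n + 1) + u (n - 1) + (V n : ℂ) * u n)
    {q N : ℕ} (hq : 0 < q) (hN : 0 < N) {ψ : ℤ → ℂ} (hψ : ∀ n, ψ (n + q) = ψ n) (hψ0 : ψ ≠ 0)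
    {E τ : ℝ} (hE : |E| ≤ 4) (hW : ∀ l, |W l| ≤ 2)
    (hsol : ∀ l, ψ (l + 1) + ψ (l - 1) + (W l : ℂ) * ψ l = (E : ℂ) * ψ l) (m : ℤ)
    (hτ : ∀ l : ℤ, 0 ≤ l → l < N * q → |V (m + l) - W l| ≤ τ) :
    ∃ v : lp (fun _ : ℤ => ℂ) 2, v ≠ 0 ∧
      ‖H v - (E : ℂ) • v‖ ^ 2 ≤ (2 * τ ^ 2 + 512 / N) * ‖v‖ ^ 2 := by
  obtain ⟨l₀, hl₀, hmax⟩ := exists_forall_norm_le hq hψ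
  set M := ‖ψ l₀‖ with hM
  have hM0 : 0 < M := by
    obtain ⟨n, hn⟩ := Function.ne_iff.1 hψ0
    exact (norm_pos_iff.2 hn).trans_le (hmax n)
  let f : ℤ → ℂ := fun n => if 0 ≤ n - m ∧ n - m < N * q then ψ (n - m) else 0
  have hf : Memℓp f 2 := by
    refine memℓp_gen (summable_of_hasFiniteSupport ?_)
    refine (Set.finite_Ico m (m + N * q)).subset fun n hn => ?_
    by_contra hn'
    have : f n = 0 := if_neg fun h => hn' ⟨by lia, by lia⟩
    simp [this] at hn
  let v : lp (fun _ : ℤ => ℂ) 2 := ⟨f, hf⟩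
  have hvf : ∀ n, v n = f n := fun n => rfl
  have hfM : ∀ n, ‖f n‖ ≤ M := fun n => by
    simp only [f]
    split_ifs
    · exact hmax _
    · simpa using hM0.le
  have hnorm : N * M ^ 2 ≤ ‖v‖ ^ 2 := by
    rw [norm_sq_eq_tsum]
    let g : ℕ → ℤ := fun k => m + l₀ + k * q
    have hg : Function.Injective g := fun a b hab => by
      have h1 : (a : ℤ) * q = b * q := by simp only [g] at hab; linarith
      have hq' : (q : ℤ) ≠ 0 := by exact_mod_cast hq.ne'
      exact_mod_cast mul_right_cancel₀ hq' h1
    refine le_trans ?_ ((summable_normSq v).sum_le_tsum ((Finset.range N).image g)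
      fun n _ => by positivity)
    rw [Finset.sum_image hg.injOn, Finset.sum_congr rfl (g := fun _ => M ^ 2), Finset.sum_const,
      Finset.card_range, nsmul_eq_mul]
    intro k hk
    rw [Finset.mem_range] at hk
    have hper : Function.Periodic ψ (q : ℤ) := hψ
    have h1 : g k - m = l₀ + k * q := by simp only [g]; ring
    have h2 : (k : ℤ) + 1 ≤ N := by exact_mod_cast hk
    have h3 : (0 : ℤ) < q := by exact_mod_cast hq
    have h4 : (l₀ : ℤ) < q := by exact_mod_cast hl₀
    have h5 : f (g k) = ψ l₀ := by
      simp only [f]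
      rw [h1, if_pos ⟨by positivity, by nlinarith⟩]
      exact hper.int_mul k l₀
    rw [hvf, h5]
  have hv0 : v ≠ 0 := by
    rintro h0
    rw [h0, norm_zero] at hnorm
    have : (0 : ℝ) < N := Nat.cast_pos.2 hN
    have : 0 < N * M ^ 2 := by positivity
    norm_num at hnorm
    linarith
  refine ⟨v, hv0, ?_⟩
  let b : ℤ → ℂ := fun n => f (n + 1) + f (n - 1) + (W (n - m) : ℂ) * f n - (E : ℂ) * f n
  let S : Finset ℤ := {m - 1, m, m + N * q - 1, m + N * q}
  have hb : ∀ n, n ∉ S → b n = 0 := by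
    intro n hn
    simp only [S, Finset.mem_insert, Finset.mem_singleton, not_or] at hn
    obtain ⟨h1, h2, h3, h4⟩ := hn
    have e1 : n + 1 - m = n - m + 1 := by ring
    have e2 : n - 1 - m = n - m - 1 := by ring
    by_cases hin : 0 < n - m ∧ n - m < N * q - 1
    · simp only [b, f]
      rw [if_pos (by lia), if_pos (by lia), if_pos (by lia), e1, e2, hsol, sub_self]
    · simp only [b, f]
      rw [if_neg (by lia), if_neg (by lia), if_neg (by lia)]
      simp
  have hb8 : ∀ n, ‖b n‖ ≤ 8 * M := by
    intro n
    have h1 : ‖(W (n - m) : ℂ) * f n‖ ≤ 2 * M := by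
      rw [norm_mul, Complex.norm_real]
      exact mul_le_mul (hW _) (hfM n) (norm_nonneg _) (by norm_num)
    have h2 : ‖(E : ℂ) * f n‖ ≤ 4 * M := by
      rw [norm_mul, Complex.norm_real]
      exact mul_le_mul hE (hfM n) (norm_nonneg _) (by norm_num)
    have h3 := norm_sub_le (f (n + 1) + f (n - 1) + (W (n - m) : ℂ) * f n) ((E : ℂ) * f n)
    have h4 := norm_add_le (f (n + 1) + f (n - 1)) ((W (n - m) : ℂ) * f n)
    have h5 := norm_add_le (f (n + 1)) (f (n - 1))
    have h6 := hfM (n + 1)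
    have h7 := hfM (n - 1)
    linarith
  let β : ℤ → ℝ := fun n => if n ∈ S then 64 * M ^ 2 else 0
  have hβ : ∀ n, ‖b n‖ ^ 2 ≤ β n := by
    intro n
    simp only [β]
    split_ifs with h
    · have := hb8 n
      have := norm_nonneg (b n)
      nlinarith
    · rw [hb n h]; simp
  have hβ0 : ∀ n ∉ S, β n = 0 := fun n hn => if_neg hn
  have hβsum : ∑' n, β n ≤ 256 * M ^ 2 := by
    rw [tsum_eq_sum hβ0]
    have h1 : ∑ n ∈ S, β n ≤ S.card • (64 * M ^ 2) :=
      Finset.sum_le_card_nsmul _ _ _ fun n hn => by simp only [β]; rw [if_pos hn]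
    have h2 : (S.card : ℝ) ≤ 4 := by exact_mod_cast Finset.card_le_four
    rw [nsmul_eq_mul] at h1
    nlinarith [sq_nonneg M]
  have hw : ∀ n, ‖(H v - (E : ℂ) • v) n‖ ^ 2 ≤ 2 * τ ^ 2 * ‖v n‖ ^ 2 + 2 * β n := by
    intro n
    have e : (H v - (E : ℂ) • v) n = ((V n - W (n - m) : ℝ) : ℂ) * f n + b n := by
      have : (H v - (E : ℂ) • v) n = H v n - (E : ℂ) * v n := rfl
      rw [this, hH, hvf, hvf, hvf]
      simp only [b]
      push_cast
      ring
    have h1 : ‖((V n - W (n - m) : ℝ) : ℂ) * f n‖ ≤ |τ| * ‖f n‖ := by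
      by_cases h : 0 ≤ n - m ∧ n - m < N * q
      · rw [norm_mul, Complex.norm_real, Real.norm_eq_abs]
        have := hτ _ h.1 h.2
        rw [add_sub_cancel] at this
        exact mul_le_mul_of_nonneg_right (this.trans (le_abs_self τ)) (norm_nonneg _)
      · have : f n = 0 := if_neg h
        simp [this]
    have h2 := norm_add_le (((V n - W (n - m) : ℝ) : ℂ) * f n) (b n)
    have h3 := hβ n
    rw [e, hvf]
    have h4 : ‖((V n - W (n - m) : ℝ) : ℂ) * f n + b n‖ ^ 2 ≤ (|τ| * ‖f n‖ + ‖b n‖) ^ 2 :=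
      pow_le_pow_left₀ (norm_nonneg _) (by linarith) 2
    have h5 : (|τ| * ‖f n‖) ^ 2 = τ ^ 2 * ‖f n‖ ^ 2 := by rw [mul_pow, sq_abs]
    nlinarith [sq_nonneg (|τ| * ‖f n‖ - ‖b n‖)]
  have hβs : Summable β := summable_of_ne_finset_zero hβ0
  have h1 := (summable_normSq (H v - (E : ℂ) • v)).tsum_le_tsum hw
    (((summable_normSq v).mul_left _).add (hβs.mul_left _))
  rw [((summable_normSq v).mul_left _).tsum_add (hβs.mul_left _), tsum_mul_left, tsum_mul_left,
    ← norm_sq_eq_tsum, ← norm_sq_eq_tsum] at h1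
  have hN0 : (0 : ℝ) < N := Nat.cast_pos.2 hN
  have h2 : 512 * M ^ 2 ≤ 512 / N * ‖v‖ ^ 2 := by
    rw [div_mul_eq_mul_div, le_div_iff₀ hN0]
    nlinarith
  linarith

end CritAM

namespace CritAM

/-- `μ` is badly approximable with constant `κ`. -/
def BadlyApproximable (μ κ : ℝ) : Prop := ∀ j l : ℤ, j ≠ 0 → κ ≤ |(j : ℝ)| * |j * μ - l|

lemma BadlyApproximable.irrational {μ κ : ℝ} (hκ : 0 < κ) (h : BadlyApproximable μ κ) :
    Irrational μ := by
  rintro ⟨x, rfl⟩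
  have h1 := h x.den x.num (by exact_mod_cast x.den_ne_zero)
  have h2 : ((x.den : ℤ) : ℝ) * (x : ℝ) - x.num = 0 := by
    have : (x.den : ℚ) * x = x.num := Rat.den_mul_eq_num x
    have h3 : (x.den : ℝ) * (x : ℝ) = x.num := by exact_mod_cast this
    push_cast
    linarith
  rw [h2] at h1
  simp at h1
  linarith

lemma quarter_le_abs_mul_abs_sqrt_two {x : ℤ} (hx : x ≠ 0) (y : ℤ) :
    1 / 4 ≤ |(x : ℝ)| * |x * √2 - y| := by
  have hx1 : (1 : ℝ) ≤ |(x : ℝ)| := by exact_mod_cast Int.one_le_abs hx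
  have hirr : Irrational (x * √2) := irrational_sqrt_two.intCast_mul hx
  have hs : √2 ^ 2 = 2 := Real.sq_sqrt (by norm_num)
  have hs1 : √2 ≤ 3 / 2 := by
    rw [Real.sqrt_le_left (by norm_num)]
    norm_num
  have hprod : (x * √2 - y) * (x * √2 + y) = ((2 * x ^ 2 - y ^ 2 : ℤ) : ℝ) := by
    push_cast
    linear_combination (x : ℝ) ^ 2 * hs
  have hne : (2 * x ^ 2 - y ^ 2 : ℤ) ≠ 0 := by
    intro h0
    rw [h0, Int.cast_zero, mul_eq_zero] at hprod
    rcases hprod with h | h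
    · exact hirr.ne_int y (by linarith)
    · exact hirr.ne_int (-y) (by push_cast; linarith)
  have h1 : (1 : ℝ) ≤ |x * √2 - y| * |x * √2 + y| := by
    rw [← abs_mul, hprod]
    exact_mod_cast Int.one_le_abs hne
  by_cases hbig : 1 ≤ |x * √2 - y|
  · nlinarith
  · have h2 : |x * √2 + y| ≤ 4 * |(x : ℝ)| := by
      have : (x * √2 + y : ℝ) = 2 * √2 * x - (x * √2 - y) := by ring
      rw [this]
      refine (abs_sub _ _).trans ?_
      rw [abs_mul, abs_of_nonneg (by positivity : (0 : ℝ) ≤ 2 * √2)]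
      nlinarith
    nlinarith [abs_nonneg (x * √2 - y : ℝ)]

lemma badlyApproximable_ratCast_add_sqrt_two (r : ℚ) :
    BadlyApproximable (r + √2) (1 / (4 * (r.den : ℝ) ^ 2)) := by
  intro j l hj
  have hd : (0 : ℝ) < r.den := by exact_mod_cast r.den_pos
  have h := quarter_le_abs_mul_abs_sqrt_two (x := j * r.den)
    (mul_ne_zero hj (by exact_mod_cast r.den_ne_zero)) (l * r.den - j * r.num)
  have hr : (r.den : ℝ) * (r : ℝ) = r.num := by exact_mod_cast Rat.den_mul_eq_num r
  have h2 : ((j * r.den : ℤ) : ℝ) * √2 - ((l * r.den - j * r.num : ℤ) : ℝ)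
      = r.den * (j * (r + √2) - l) := by
    push_cast
    linear_combination -(j : ℝ) * hr
  rw [h2, abs_mul, abs_of_pos hd] at h
  push_cast at h
  rw [abs_mul, abs_of_pos hd] at h
  rw [div_le_iff₀ (by positivity)]
  nlinarith

lemma dense_setOf_badlyApproximable :
    Dense {μ : ℝ | ∃ κ > 0, BadlyApproximable μ κ} := by
  have h : DenseRange fun r : ℚ => (r : ℝ) + √2 :=
    (Homeomorph.addRight (√2)).surjective.denseRange.comp Rat.denseRange_cast
      (Homeomorph.addRight (√2)).continuous
  refine h.mono ?_
  rintro _ ⟨r, rfl⟩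
  have hd : (0 : ℝ) < r.den := by exact_mod_cast r.den_pos
  exact ⟨_, by positivity, badlyApproximable_ratCast_add_sqrt_two r⟩

lemma BadlyApproximable.exists_rat {μ κ : ℝ} (hκ : 0 < κ) (h : BadlyApproximable μ κ) (n : ℕ) :
    ∃ x : ℚ, n ≤ x.den ∧ |μ - x| ≤ 1 / (x.den : ℝ) ^ 2 := by
  obtain ⟨N, hN⟩ := exists_nat_ge (n / κ)
  obtain ⟨x, hx, hxN⟩ := Real.exists_rat_abs_sub_le_and_den_le μ (Nat.succ_pos N)
  have hd : (0 : ℝ) < x.den := by exact_mod_cast x.den_pos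
  have hxN' : (x.den : ℝ) ≤ N + 1 := by exact_mod_cast hxN
  push_cast at hx
  have hr : (x.den : ℝ) * (x : ℝ) = x.num := by exact_mod_cast Rat.den_mul_eq_num x
  refine ⟨x, ?_, hx.trans ?_⟩
  · have h1 := h x.den x.num (by exact_mod_cast x.den_ne_zero)
    have h2 : ((x.den : ℤ) : ℝ) * μ - x.num = x.den * (μ - x) := by
      push_cast
      linear_combination hr
    rw [h2, abs_mul] at h1
    push_cast at h1
    rw [abs_of_pos hd] at h1
    have h3 : κ * (N + 1 + 1) ≤ x.den := by
      rw [le_div_iff₀ (by positivity)] at hx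
      have : |μ - x| * ((N + 1 + 1) * x.den) * x.den ≤ 1 * x.den :=
        mul_le_mul_of_nonneg_right hx hd.le
      nlinarith
    rw [div_le_iff₀ hκ] at hN
    have : (n : ℝ) ≤ x.den := by nlinarith
    exact_mod_cast this
  · apply one_div_le_one_div_of_le (by positivity)
    nlinarith

lemma BadlyApproximable.bad {μ κ : ℝ} (hκ : 0 < κ) (h : BadlyApproximable μ κ) {q : ℕ} [NeZero q]
    {P : ℤ} (hP : |μ - P / q| ≤ 1 / (q : ℝ) ^ 2) :
    Bad (P : ZMod q) (min (κ / 2) (1 / 2)) := by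
  have hq : (0 : ℝ) < q := by exact_mod_cast Nat.pos_of_ne_zero (NeZero.ne q)
  set c := min (κ / 2) (1 / 2) with hc
  have hc0 : 0 < c := by positivity
  have hcκ : c ≤ κ / 2 := min_le_left _ _
  have hc2 : c ≤ 1 / 2 := min_le_right _ _
  intro j i hi1 hiq hji
  have hi : (1 : ℝ) ≤ i := by exact_mod_cast hi1
  have hdvd : (q : ℤ) ∣ j * P - i := by
    rw [← ZMod.intCast_eq_intCast_iff_dvd_sub]
    push_cast
    exact hji.symm
  obtain ⟨l, hl⟩ := hdvd
  have hj : j ≠ 0 := by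
    rintro rfl
    have h1 : (q : ℤ) ∣ (i : ℤ) := by
      rw [zero_mul, zero_sub] at hl
      exact ⟨-l, by linarith⟩
    have := Int.le_of_dvd (by exact_mod_cast hi1) h1
    omega
  have hlR : (j : ℝ) * P - i = q * l := by exact_mod_cast hl
  have h1 := h j l hj
  have h2 : (j : ℝ) * μ - l = j * (μ - P / q) + i / q := by
    field_simp
    linear_combination hlR
  have h3 : |(j : ℝ) * μ - l| ≤ |(j : ℝ)| * (1 / (q : ℝ) ^ 2) + i / q := by
    rw [h2]
    refine (abs_add_le _ _).trans ?_
    rw [abs_mul, abs_of_nonneg (by positivity : (0 : ℝ) ≤ i / q)]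
    gcongr
  have h4 : κ ≤ |(j : ℝ)| * (|(j : ℝ)| * (1 / (q : ℝ) ^ 2) + i / q) :=
    h1.trans (mul_le_mul_of_nonneg_left h3 (abs_nonneg _))
  have h5 : κ * (q : ℝ) ^ 2 ≤ |(j : ℝ)| ^ 2 + |(j : ℝ)| * i * q := by
    have : |(j : ℝ)| * (|(j : ℝ)| * (1 / (q : ℝ) ^ 2) + i / q) * (q : ℝ) ^ 2
        = |(j : ℝ)| ^ 2 + |(j : ℝ)| * i * q := by
      field_simp
    rw [← this]
    gcongr
  have hj0 := abs_nonneg (j : ℝ)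
  by_contra! hlt
  have h6 : |(j : ℝ)| < c * q := by nlinarith
  have h7 : |(j : ℝ)| ^ 2 < (c * q) ^ 2 := by gcongr
  have h8 : |(j : ℝ)| * i * q ≤ c * q * q := by gcongr
  have h9 : (c * q) ^ 2 ≤ (κ / 2) * q ^ 2 := by
    rw [mul_pow]
    gcongr
    nlinarith
  nlinarith [sq_nonneg (q : ℝ)]

lemma exists_shift {μ : ℝ} (hμ : Irrational μ) (θ : ℝ) {η : ℝ} (hη : 0 < η) :
    ∃ m k : ℤ, |2 * π * μ * m + θ - 2 * π * k| < η := by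
  have hd := (dense_addSubgroupClosure_pair_iff (a := (2 * π * μ)) (b := (2 * π))).2
    (by rwa [mul_div_cancel_left₀ _ (by positivity)])
  obtain ⟨y, hy, hyη⟩ := hd.exists_dist_lt (-θ) hη
  obtain ⟨m, k, rfl⟩ := AddSubgroup.mem_closure_pair.1 hy
  refine ⟨m, -k, ?_⟩
  rw [Real.dist_eq, abs_sub_comm] at hyη
  convert hyη using 2
  simp
  ring

lemma exists_mem_spectrum_near_eig {μ θ : ℝ} (hμ : Irrational μ)
    {H : lp (fun _ : ℤ => ℂ) 2 →L[ℂ] lp (fun _ : ℤ => ℂ) 2}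
    (hH : ∀ (u : lp (fun _ : ℤ => ℂ) 2) (n : ℤ), H u n = u (n + 1) + u (n - 1) +
      ((2 * Real.cos (2 * π * μ * n + θ) : ℝ) : ℂ) * u n)
    {ε : ℝ} (hε : 0 < ε) :
    ∃ q₀ : ℕ, ∀ (q : ℕ) [NeZero q] (P : ℤ), q₀ ≤ q → |μ - P / q| ≤ 1 / (q : ℝ) ^ 2 →
      ∀ k : ZMod q, ∃ x ∈ Complex.ofReal ⁻¹' spectrum ℂ H, |eig (P : ZMod q) k - x| ≤ ε := by
  obtain ⟨N, hN⟩ := exists_nat_gt (2048 / ε ^ 2)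
  have hN0 : (0 : ℝ) < N := lt_of_le_of_lt (by positivity) hN
  set η := ε / 16 with hη
  have hη0 : 0 < η := by positivity
  obtain ⟨m, k₀, hm⟩ := exists_shift hμ θ hη0
  obtain ⟨q₀, hq₀⟩ := exists_nat_ge (2 * π * N / η)
  refine ⟨q₀, fun q _ P hq hP k => ?_⟩
  have hqn : 0 < q := Nat.pos_of_ne_zero (NeZero.ne q)
  have hqR : (0 : ℝ) < q := by exact_mod_cast hqn
  obtain ⟨ψ, hper, hψ0, hsol⟩ := exists_periodic_solution (q := q) P k
  have hτ : ∀ l : ℤ, 0 ≤ l → l < N * q →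
      |2 * Real.cos (2 * π * μ * ((m + l : ℤ) : ℝ) + θ) - 2 * Real.cos (2 * π * (P / q) * l)|
        ≤ 4 * η := by
    intro l hl0 hlq
    have hl0' : (0 : ℝ) ≤ l := by exact_mod_cast hl0
    have hlq' : (l : ℝ) ≤ N * q := by exact_mod_cast hlq.le
    have h1 : Real.cos (2 * π * μ * ((m + l : ℤ) : ℝ) + θ)
        = Real.cos (2 * π * μ * ((m + l : ℤ) : ℝ) + θ - k₀ * (2 * π)) :=
      (Real.cos_sub_int_mul_two_pi _ _).symm
    rw [← mul_sub, abs_mul, abs_two, h1]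
    have h2 := Real.abs_cos_sub_cos_le (2 * π * μ * ((m + l : ℤ) : ℝ) + θ - k₀ * (2 * π))
      (2 * π * (P / q) * l)
    have h3 : 2 * π * μ * ((m + l : ℤ) : ℝ) + θ - k₀ * (2 * π) - 2 * π * (P / q) * l
        = (2 * π * μ * m + θ - 2 * π * k₀) + 2 * π * l * (μ - P / q) := by
      push_cast
      ring
    have h4 : |2 * π * l * (μ - P / q)| ≤ η := by
      rw [abs_mul, abs_of_nonneg (by positivity)]
      calc 2 * π * l * |μ - P / q| ≤ 2 * π * (N * q) * (1 / (q : ℝ) ^ 2) := by gcongr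
        _ = 2 * π * N / q := by field_simp
        _ ≤ η := by
          rw [div_le_iff₀ hqR]
          rw [div_le_iff₀ hη0] at hq₀
          have : (q₀ : ℝ) ≤ q := by exact_mod_cast hq
          nlinarith
    rw [h3] at h2
    have h5 := h2.trans (abs_add_le _ _)
    linarith
  obtain ⟨v, hv0, hv⟩ := exists_approx_eigenvector
    (V := fun n : ℤ => 2 * Real.cos (2 * π * μ * n + θ))
    (W := fun n : ℤ => 2 * Real.cos (2 * π * (P / q) * n)) hH hqn (by exact_mod_cast hN0)
    hper hψ0 (abs_le_of_mem_bands (eig_mem_bands (P : ZMod q) k))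
    (fun l => by rw [abs_mul, abs_two]; linarith [Real.abs_cos_le_one (2 * π * (P / q) * l)])
    hsol m hτ
  have hb : 2 * (4 * η) ^ 2 + 512 / N ≤ (3 / 4 * ε) ^ 2 := by
    have : 512 / (N : ℝ) ≤ ε ^ 2 / 4 := by
      rw [div_lt_iff₀ (by positivity)] at hN
      rw [div_le_iff₀ hN0]
      linarith
    rw [hη]
    nlinarith [sq_nonneg ε]
  refine exists_mem_spectrum_near
    (isSelfAdjoint_of_action (V := fun n : ℤ => 2 * Real.cos (2 * π * μ * n + θ)) hH)
    hv0 (ε := 3 / 4 * ε) ?_ (by linarith) hε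
  refine abs_le_of_sq_le_sq' ?_ (by positivity) |>.2
  rw [mul_pow]
  exact hv.trans (by gcongr)

lemma dimH_spectrum_pos {μ κ : ℝ} (hκ : 0 < κ) (hbad : BadlyApproximable μ κ) (θ : ℝ)
    {H : lp (fun _ : ℤ => ℂ) 2 →L[ℂ] lp (fun _ : ℤ => ℂ) 2}
    (hH : ∀ (u : lp (fun _ : ℤ => ℂ) 2) (n : ℤ), H u n = u (n + 1) + u (n - 1) +
      ((2 * Real.cos (2 * π * μ * n + θ) : ℝ) : ℂ) * u n) :
    0 < dimH (Complex.ofReal ⁻¹' spectrum ℂ H) := by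
  choose x hxn hx using hbad.exists_rat hκ
  set c := min (κ / 2) (1 / 2) with hc
  have hc0 : 0 < c := by positivity
  have hc2 : c ≤ 1 / 2 := min_le_right _ _
  set K := Real.exp (10 ^ 9 / c) with hK
  have hKbig : Real.exp 2 ≤ K := by
    rw [hK]
    apply Real.exp_le_exp.2
    rw [le_div_iff₀ hc0]
    linarith
  have hK1 : 1 < K := lt_of_lt_of_le (by simp) hKbig
  have hlog : 1 ≤ Real.log (K / 2) := by
    rw [Real.log_div (by positivity) (by norm_num)]
    have h1 : 2 ≤ Real.log K := by
      rw [Real.le_log_iff_exp_le (by positivity)]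
      exact hKbig
    linarith [Real.log_two_lt_d9]
  have : ∀ n, NeZero (x n).den := fun n => ⟨(x n).den_ne_zero⟩
  have hx' : ∀ n, |μ - (x n).num / (x n).den| ≤ 1 / ((x n).den : ℝ) ^ 2 := by
    intro n
    have h1 := hx n
    rw [Rat.cast_def] at h1
    exact h1
  have hden : Filter.Tendsto (fun n => ((x n).den : ℝ)) Filter.atTop Filter.atTop :=
    Filter.tendsto_atTop_mono (fun n => by exact_mod_cast hxn n) tendsto_natCast_atTop_atTop
  refine dimH_pos_of_configurations (ι := fun n => ZMod (x n).den)
    (fun n k => eig ((x n).num : ZMod (x n).den) k) (R := 4) (K := K) (c := 1 + Real.log 10)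
    ((spectrum.isClosed H).preimage Complex.continuous_ofReal) (fun n => ⟨0⟩) hK1
    (by have := Real.log_nonneg (by norm_num : (1 : ℝ) ≤ 10); linarith)
    (fun n k => abs_le_of_mem_bands (eig_mem_bands _ k)) ?_ ?_
  · intro k
    have hs : 0 < (K ^ (k + 1))⁻¹ / 16 := by positivity
    filter_upwards [hden.eventually_ge_atTop (2 ^ k * Real.log 8),
      hden.eventually_ge_atTop (Real.log 4 / ((K ^ (k + 1))⁻¹ / 16))] with n h1 h2 E
    obtain ⟨r, hr⟩ : ∃ r : ZMod (x n).den, ((x n).num : ZMod (x n).den) * r = 1 := by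
      obtain ⟨a, b, hab⟩ : IsCoprime (x n).num ((x n).den : ℤ) :=
        Int.isCoprime_iff_gcd_eq_one.2 (by simpa [Int.gcd, Nat.Coprime] using (x n).reduced)
      refine ⟨a, ?_⟩
      have h3 := congrArg (Int.cast : ℤ → ZMod (x n).den) hab
      push_cast at h3
      rw [ZMod.natCast_self, mul_zero, add_zero, mul_comm] at h3
      exact h3
    have hq : 4 ≤ Real.exp ((x n).den * ((K ^ (k + 1))⁻¹ / 16)) := by
      rw [div_le_iff₀ hs] at h2
      rwa [Real.log_le_iff_le_exp (by norm_num)] at h2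
    have h3 := card_mul_log_le hr hc0 hc2 (hbad.bad hκ (hx' n)) hK k hq E
    rw [ZMod.card]
    have h4 : Real.log 8 ≤ (x n).den / 2 ^ k := by
      rw [le_div_iff₀ (by positivity)]
      linarith
    have h5 : (1 + Real.log 10) / 2 ^ k * ((x n).den : ℝ)
        = (x n).den / 2 ^ k + (x n).den * Real.log 10 / 2 ^ k := by ring
    rw [h5]
    refine le_trans ?_ (h3.trans (by gcongr))
    exact le_mul_of_one_le_right (by positivity) hlog
  · intro ε hε
    obtain ⟨q₀, hq₀⟩ := exists_mem_spectrum_near_eig (hbad.irrational hκ) hH hε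
    filter_upwards [Filter.eventually_ge_atTop q₀] with n hn k
    exact hq₀ (x n).den (x n).num (hn.trans (hxn n)) (hx' n) k

end CritAM

/-- There is a dense set `M' ⊆ ℝ` of irrational frequencies such that
for every `μ ∈ M'` and every phase `θ`, the spectrum of the critical almost Mathieu
operator `H_{μ,θ}`, viewed as a subset of `ℝ`, has strictly positive Hausdorff
dimension. -/
theorem exists_dense_irrational_hausdorff_dim_pos :
    ∃ M' : Set ℝ, Dense M' ∧ (∀ μ ∈ M', Irrational μ) ∧
      ∀ μ ∈ M', ∀ θ : ℝ,
        ∀ H : lp (fun _ : ℤ => ℂ) 2 →L[ℂ] lp (fun _ : ℤ => ℂ) 2,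
          (∀ (u : lp (fun _ : ℤ => ℂ) 2) (n : ℤ),
            H u n = u (n + 1) + u (n - 1)
              + ((2 * Real.cos (2 * π * μ * n + θ) : ℝ) : ℂ) * u n) →
          0 < dimH (Complex.ofReal ⁻¹' spectrum ℂ H) :=
  ⟨_, CritAM.dense_setOf_badlyApproximable, fun _ ⟨_, hκ, h⟩ => h.irrational hκ,
    fun _ ⟨_, hκ, h⟩ θ _ hH => CritAM.dimH_spectrum_pos hκ h θ hH⟩
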